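/- arXiv:2206.04175 — 3 statements merged into one kernel-verified Lean document; each statement's English description precedes it below -/
import Mathlib

section
/- Let P ⊂ ℝ^d be a full-dimensional rational polytope with denominator q and let ℓ be the smallest positive integer such that the interior of ℓP contains a lattice point. Then ((1+z+⋯+z^{ℓ−1})/(1+z+⋯+z^{q−1}))·h*_P(z) is a polynomial and can be written as a(z) + z^ℓ·b(z), where a(z) and b(z) are polynomials with nonnegative integer coefficients such that z^{qd}·a(1/z) = a(z) and z^{qd−ℓ}·b(1/z) = b(z). -/
open Pointwise

/-- `x ∈ ℤ^d`, i.e. every coordinate of `x` is an integer. -/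
def IsLatticePt {d : ℕ} (x : Fin d → ℝ) : Prop := ∀ i, ∃ a : ℤ, x i = (a : ℝ)

/-- `x ∈ ℚ^d`, i.e. every coordinate of `x` is rational. -/
def IsRationalPt {d : ℕ} (x : Fin d → ℝ) : Prop := ∀ i, ∃ a : ℚ, x i = (a : ℝ)

/-- `P` is a lattice polytope: the convex hull of finitely many points of `ℤ^d`. -/
def IsLatticePolytope {d : ℕ} (P : Set (Fin d → ℝ)) : Prop :=
  ∃ V : Finset (Fin d → ℝ), (∀ v ∈ V, IsLatticePt v) ∧ P = convexHull ℝ (V : Set (Fin d → ℝ))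

/-- `P` is a rational polytope: the convex hull of finitely many points of `ℚ^d`. -/
def IsRationalPolytope {d : ℕ} (P : Set (Fin d → ℝ)) : Prop :=
  ∃ V : Finset (Fin d → ℝ), (∀ v ∈ V, IsRationalPt v) ∧ P = convexHull ℝ (V : Set (Fin d → ℝ))

/-- A convex subset of `ℝ^d` is full-dimensional iff its interior is nonempty. -/
def IsFullDim {d : ℕ} (P : Set (Fin d → ℝ)) : Prop := (interior P).Nonempty

/-- The number of lattice points in `S`. -/
noncomputable def latCount {d : ℕ} (S : Set (Fin d → ℝ)) : ℕ :=
  Set.ncard {x ∈ S | IsLatticePt x}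

/-- The Ehrhart series `Ehr_P(z) = 1 + ∑_{n ≥ 1} #(nP ∩ ℤ^d) zⁿ`. -/
noncomputable def ehrSeries {d : ℕ} (P : Set (Fin d → ℝ)) : PowerSeries ℤ :=
  PowerSeries.mk fun n => if n = 0 then 1 else (latCount ((n : ℝ) • P) : ℤ)

/-- The interior Ehrhart series `∑_{n ≥ 1} #(nP° ∩ ℤ^d) zⁿ`. -/
noncomputable def ehrIntSeries {d : ℕ} (P : Set (Fin d → ℝ)) : PowerSeries ℤ :=
  PowerSeries.mk fun n => if n = 0 then 0 else (latCount (interior ((n : ℝ) • P)) : ℤ)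

/-- The boundary Ehrhart series `1 + ∑_{n ≥ 1} #(n ∂P ∩ ℤ^d) zⁿ`. -/
noncomputable def ehrBdSeries {d : ℕ} (P : Set (Fin d → ℝ)) : PowerSeries ℤ :=
  PowerSeries.mk fun n => if n = 0 then 1 else (latCount (frontier ((n : ℝ) • P)) : ℤ)

/-- `q` is the denominator of `P`: the smallest positive integer such that `qP` is a
lattice polytope. -/
def IsDenominator {d : ℕ} (P : Set (Fin d → ℝ)) (q : ℕ) : Prop :=
  0 < q ∧ IsLatticePolytope ((q : ℝ) • P) ∧
    ∀ k : ℕ, 0 < k → IsLatticePolytope ((k : ℝ) • P) → q ≤ k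

/-- `l` is the smallest positive integer such that the interior of `lP` contains a
lattice point. -/
def IsMinInteriorDilate {d : ℕ} (P : Set (Fin d → ℝ)) (l : ℕ) : Prop :=
  0 < l ∧ (∃ x, IsLatticePt x ∧ x ∈ interior ((l : ℝ) • P)) ∧
    ∀ k : ℕ, 0 < k → (∃ x, IsLatticePt x ∧ x ∈ interior ((k : ℝ) • P)) → l ≤ k

/-- The homogenization of the half-open simplex with vertices `w 0, …, w (k-1)`
where the facets opposite the first `r` vertices are removed:
`hom(Δ) = Σ_{j<r} ℝ_{>0} (w j, 1) + Σ_{j≥r} ℝ_{≥0} (w j, 1) ⊆ ℝ^{d+1}`. -/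
def homog {d k : ℕ} (w : Fin k → (Fin d → ℝ)) (r : ℕ) : Set (Fin (d + 1) → ℝ) :=
  {y | ∃ c : Fin k → ℝ, (∀ j : Fin k, (j : ℕ) < r → 0 < c j) ∧
    (∀ j : Fin k, r ≤ (j : ℕ) → 0 ≤ c j) ∧
    y = ∑ j : Fin k, c j • (Fin.snoc (w j) 1 : Fin (d + 1) → ℝ)}

/-- The fundamental parallelepiped
`F'_Δ = Σ_{j<r} (0,1] (q_j w_j, q_j) + Σ_{j≥r} [0,1) (q_j w_j, q_j) ⊆ ℝ^{d+1}`. -/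
def fpar {d k : ℕ} (w : Fin k → (Fin d → ℝ)) (r : ℕ) (q : Fin k → ℕ) :
    Set (Fin (d + 1) → ℝ) :=
  {y | ∃ c : Fin k → ℝ, (∀ j : Fin k, (j : ℕ) < r → c j ∈ Set.Ioc (0 : ℝ) 1) ∧
    (∀ j : Fin k, r ≤ (j : ℕ) → c j ∈ Set.Ico (0 : ℝ) 1) ∧
    y = ∑ j : Fin k, c j • ((q j : ℝ) • (Fin.snoc (w j) 1 : Fin (d + 1) → ℝ))}

/-- The generating function `∑_{x ∈ S ∩ ℤ^{d+1}} z^{x_{d+1}}` of a subset `S ⊆ ℝ^{d+1}`,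
graded by the last coordinate. -/
noncomputable def sliceSeries {d : ℕ} (S : Set (Fin (d + 1) → ℝ)) : PowerSeries ℤ :=
  PowerSeries.mk fun n =>
    (Set.ncard {y ∈ S | IsLatticePt y ∧ y (Fin.last d) = (n : ℝ)} : ℤ)

/-- A polynomial is palindromic if `z^{deg f} f(1/z) = f(z)`,
i.e. `f_i = f_{deg f − i}` for all `i ≤ deg f`. -/
def IsPalin (f : Polynomial ℤ) : Prop :=
  ∀ i ≤ f.natDegree, f.coeff i = f.coeff (f.natDegree - i)

/-- `P` is rational reflexive: the origin is an interior point and `P = {x : A x ≤ 𝟙}`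
for some integer matrix `A`. -/
def IsRationalReflexive {d : ℕ} (P : Set (Fin d → ℝ)) : Prop :=
  IsRationalPolytope P ∧ (0 : Fin d → ℝ) ∈ interior P ∧
    ∃ (m : ℕ) (A : Fin m → Fin d → ℤ),
      P = {x : Fin d → ℝ | ∀ j, (∑ i, (A j i : ℝ) * x i) ≤ 1}

/-- `P` is a reflexive (lattice) polytope. -/
def IsReflexive {d : ℕ} (P : Set (Fin d → ℝ)) : Prop :=
  IsLatticePolytope P ∧ (0 : Fin d → ℝ) ∈ interior P ∧
    ∃ (m : ℕ) (A : Fin m → Fin d → ℤ),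
      P = {x : Fin d → ℝ | ∀ j, (∑ i, (A j i : ℝ) * x i) ≤ 1}

/-- `P` is an integral translate of a reflexive polytope. -/
def IsTranslatedReflexive {d : ℕ} (P : Set (Fin d → ℝ)) : Prop :=
  ∃ (Q : Set (Fin d → ℝ)) (t : Fin d → ℤ), IsReflexive Q ∧
    P = (fun y => y + fun i => (t i : ℝ)) '' Q

/-- The rational Ehrhart series `1 + ∑_{n ≥ 1} #((n/r) P ∩ ℤ^d) wⁿ`. -/
noncomputable def ratEhrSeries {d : ℕ} (P : Set (Fin d → ℝ)) (r : ℕ) : PowerSeries ℤ :=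
  PowerSeries.mk fun n => if n = 0 then 1 else (latCount (((n : ℝ) / (r : ℝ)) • P) : ℤ)

/-- The rational boundary Ehrhart series `1 + ∑_{n ≥ 1} #((n/r) ∂P ∩ ℤ^d) wⁿ`. -/
noncomputable def ratEhrBdSeries {d : ℕ} (P : Set (Fin d → ℝ)) (r : ℕ) : PowerSeries ℤ :=
  PowerSeries.mk fun n =>
    if n = 0 then 1 else (latCount (frontier (((n : ℝ) / (r : ℝ)) • P)) : ℤ)

/-- `r` is the codenominator of `P`: given an irredundant halfspace description
`P = {x : A x ≤ b}` with integer data and `gcd(b_j, A_{j,1}, …, A_{j,d}) = 1` for each `j`,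
`r` is the least common multiple of the nonzero entries of `b`. -/
def IsCodenominator {d : ℕ} (P : Set (Fin d → ℝ)) (r : ℕ) : Prop :=
  ∃ (m : ℕ) (A : Fin m → Fin d → ℤ) (b : Fin m → ℤ),
    P = {x : Fin d → ℝ | ∀ j, (∑ i, (A j i : ℝ) * x i) ≤ (b j : ℝ)} ∧
    (∀ j₀ : Fin m,
      P ≠ {x : Fin d → ℝ | ∀ j, j ≠ j₀ → (∑ i, (A j i : ℝ) * x i) ≤ (b j : ℝ)}) ∧
    (∀ j, Int.gcd (b j) (Finset.univ.gcd fun i => A j i) = 1) ∧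
    (r : ℤ) = (Finset.univ.filter fun j => b j ≠ 0).lcm b

theorem lp_min_exists {d : ℕ} {ι : Type} [Fintype ι] (w : ι → Fin d → ℝ)
    (h : ι → ℝ) (hh : ∀ j, 0 < h j) (z : Fin d → ℝ)
    (hpos : ∃ μ : ι → ℝ, (∀ j, 0 ≤ μ j) ∧ ∑ j, μ j • w j = z) :
    ∃ μ : ι → ℝ, (∀ j, 0 ≤ μ j) ∧ ∑ j, μ j • w j = z ∧
      ∀ ν : ι → ℝ, (∀ j, 0 ≤ ν j) → ∑ j, ν j • w j = z → ∑ j, μ j * h j ≤ ∑ j, ν j * h j := by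
  obtain ⟨μ0, h0, hz0⟩ := hpos
  set M := ∑ j, μ0 j * h j with hM
  let S : Set (ι → ℝ) := {μ | (∀ j, 0 ≤ μ j) ∧ ∑ j, μ j • w j = z ∧ ∑ j, μ j * h j ≤ M}
  have hScl : IsClosed S := by
    have e1 : S = (⋂ j, {μ : ι → ℝ | 0 ≤ μ j}) ∩
        ({μ : ι → ℝ | ∑ j, μ j • w j = z} ∩ {μ : ι → ℝ | ∑ j, μ j * h j ≤ M}) := by
      ext μ; simp [S]
    rw [e1]
    refine IsClosed.inter (isClosed_iInter fun j => isClosed_le (by fun_prop) (by fun_prop))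
      (IsClosed.inter (isClosed_eq (by fun_prop) (by fun_prop))
        (isClosed_le (by fun_prop) (by fun_prop)))
  have hSsub : S ⊆ Set.Icc 0 (fun j => M / h j) := by
    rintro μ ⟨h1, -, h3⟩
    refine ⟨fun j => h1 j, fun j => ?_⟩
    rw [le_div_iff₀ (hh j)]
    refine le_trans ?_ h3
    exact Finset.single_le_sum (f := fun j => μ j * h j)
      (fun i _ => mul_nonneg (h1 i) (hh i).le) (Finset.mem_univ j)
  have hSc : IsCompact S := isCompact_Icc.of_isClosed_subset hScl hSsub
  obtain ⟨μ, ⟨m1, m2, m3⟩, hmin⟩ := hSc.exists_isMinOn (f := fun μ : ι → ℝ => ∑ j, μ j * h j)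
    ⟨μ0, h0, hz0, le_refl _⟩ (by fun_prop)
  refine ⟨μ, m1, m2, fun ν hν hνz => ?_⟩
  by_cases hc : ∑ j, ν j * h j ≤ M
  · exact hmin (show ν ∈ S from ⟨hν, hνz, hc⟩)
  · exact m3.trans (le_of_not_ge hc)

theorem lp_exists {d : ℕ} {ι : Type} [Fintype ι] (w : ι → Fin d → ℝ)
    (h : ι → ℝ) (hh : ∀ j, 0 < h j) (z : Fin d → ℝ)
    (hpos : ∃ μ : ι → ℝ, (∀ j, 0 ≤ μ j) ∧ ∑ j, μ j • w j = z)
    (gen : ∀ (e : Fin d → ι) (B : Module.Basis (Fin d) ℝ (Fin d → ℝ)), (∀ i, B i = w (e i)) →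
      ∀ j, (∀ i, e i ≠ j) → h j - ∑ i, B.repr (w j) i * h (e i) ≠ 0)
    (hz : ∀ J : Set ι, z ∈ Submodule.span ℝ (w '' J) → Submodule.span ℝ (w '' J) = ⊤) :
    ∃ (e : Fin d → ι) (B : Module.Basis (Fin d) ℝ (Fin d → ℝ)), (∀ i, B i = w (e i)) ∧
      (∀ j, (∀ i, e i ≠ j) → 0 < h j - ∑ i, B.repr (w j) i * h (e i)) ∧
      ∀ i, 0 < B.repr z i := by
  classical
  obtain ⟨μ, m1, m2, m3⟩ := lp_min_exists w h hh z hpos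
  let J : Set ι := {j | μ j ≠ 0}
  have hJ : Submodule.span ℝ (w '' J) = ⊤ := by
    apply hz
    rw [← m2]
    refine Submodule.sum_mem _ fun j _ => ?_
    by_cases hj : μ j = 0
    · simp [hj]
    · exact Submodule.smul_mem _ _ (Submodule.subset_span ⟨j, hj, rfl⟩)
  obtain ⟨κ, a, ha, hsp, hli⟩ := exists_linearIndependent' ℝ (fun j : J => w j)
  have hfin : Finite κ := Finite.of_injective a ha
  have : Fintype κ := Fintype.ofFinite κ
  have hsp' : ⊤ ≤ Submodule.span ℝ (Set.range ((fun j : J => w j) ∘ a)) := by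
    rw [hsp, ← hJ, Set.image_eq_range]
  let B0 := Module.Basis.mk hli hsp'
  have hcard : Fintype.card κ = d := by
    rw [← Module.finrank_eq_card_basis B0]; simp
  let E := Fintype.equivFinOfCardEq hcard
  let B := B0.reindex E
  let e : Fin d → ι := fun i => (a (E.symm i)).1
  have he : Function.Injective e := fun i i' hii => by
    have := ha (Subtype.ext hii)
    simpa using this
  have hB : ∀ i, B i = w (e i) := by
    intro i; simp [B, B0, e]
  have heJ : ∀ i, μ (e i) ≠ 0 := fun i => (a (E.symm i)).2
  have hJpos : ∀ j, μ j ≠ 0 → 0 < μ j := fun j hj => lt_of_le_of_ne (m1 j) (Ne.symm hj)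
  -- move along a direction
  let D : ι → ι → ℝ := fun j => Pi.single j 1 - ∑ i, B.repr (w j) i • Pi.single (e i) (1 : ℝ)
  have hDz : ∀ j, ∑ m, D j m • w m = 0 := by
    intro j
    have h1 : w j = ∑ i, B.repr (w j) i • w (e i) := by
      conv_lhs => rw [← B.sum_repr (w j)]
      simp [hB]
    simp only [D, Pi.sub_apply, Finset.sum_apply, Pi.smul_apply, sub_smul, Finset.sum_sub_distrib,
      Finset.sum_smul]
    rw [Finset.sum_comm]
    simp only [Pi.single_apply, smul_eq_mul, mul_ite, mul_one, mul_zero, ite_smul, zero_smul,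
      one_smul, Finset.sum_ite_eq', Finset.sum_ite_eq, Finset.mem_univ, if_true]
    rw [← h1, sub_self]
  have hDh : ∀ j, ∑ m, D j m * h m = h j - ∑ i, B.repr (w j) i * h (e i) := by
    intro j
    simp only [D, Pi.sub_apply, Finset.sum_apply, Pi.smul_apply, sub_mul, Finset.sum_sub_distrib,
      Finset.sum_mul]
    rw [Finset.sum_comm]
    simp [Pi.single_apply]
  have key : ∀ (j : ι) (θ : ℝ), (∀ m, 0 ≤ μ m + θ * D j m) →
      0 ≤ θ * (h j - ∑ i, B.repr (w j) i * h (e i)) := by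
    intro j θ hθ
    have := m3 (fun m => μ m + θ * D j m) hθ (by
      simp only [add_smul, mul_smul, Finset.sum_add_distrib, ← Finset.smul_sum, hDz, m2]; simp)
    simp only [add_mul, mul_assoc, Finset.sum_add_distrib, ← Finset.mul_sum, hDh] at this
    linarith
  have hev : ∀ j, ∀ᶠ θ in nhds (0 : ℝ), ∀ m, μ m ≠ 0 → 0 ≤ μ m + θ * D j m := by
    intro j
    rw [Filter.eventually_all]
    intro m
    by_cases hm : μ m = 0
    · simp [hm]
    · have hc : Filter.Tendsto (fun θ : ℝ => μ m + θ * D j m) (nhds 0) (nhds (μ m + 0 * D j m)) := by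
        apply Continuous.tendsto; fun_prop
      rw [zero_mul, add_zero] at hc
      filter_upwards [hc.eventually (lt_mem_nhds (hJpos m hm))] with θ h1 _
      exact h1.le
  have hD0 : ∀ j m, μ m = 0 → m ≠ j → D j m = 0 := by
    intro j m hm hmj
    have : ∀ i, m ≠ e i := fun i hi => heJ i (hi ▸ hm)
    simp [D, Pi.single_apply, hmj, this]
  have hD1 : ∀ j, μ j = 0 → D j j = 1 := by
    intro j hm
    have : ∀ i, j ≠ e i := fun i hi => heJ i (hi ▸ hm)
    simp [D, Pi.single_apply, this]
  have claimA : ∀ j, (∀ i, e i ≠ j) → 0 < h j - ∑ i, B.repr (w j) i * h (e i) := by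
    intro j hj
    obtain ⟨θ, hθ, hθ0⟩ := (((hev j).filter_mono nhdsWithin_le_nhds).and
      (self_mem_nhdsWithin (a := (0:ℝ)) (s := Set.Ioi 0))).exists
    have := key j θ (fun m => by
      by_cases hm : μ m = 0
      · by_cases hmj : m = j
        · subst hmj; rw [hm, hD1 m hm]; have : 0 < θ := hθ0; linarith
        · rw [hm, hD0 j m hm hmj]; simp
      · exact hθ m hm)
    have h2 := nonneg_of_mul_nonneg_right this hθ0
    exact lt_of_le_of_ne h2 (gen e B hB j hj).symm
  have claimB : ∀ j, μ j ≠ 0 → ∃ i, e i = j := by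
    intro j hj
    by_contra hcon
    push Not at hcon
    have hA := claimA j hcon
    obtain ⟨θ, hθ, hθ0⟩ := (((hev j).filter_mono nhdsWithin_le_nhds).and
      (self_mem_nhdsWithin (a := (0:ℝ)) (s := Set.Iio 0))).exists
    have := key j θ (fun m => by
      by_cases hm : μ m = 0
      · rw [hm, hD0 j m hm (fun h => hj (h ▸ hm))]; simp
      · exact hθ m hm)
    have h3 : θ < 0 := hθ0
    nlinarith
  refine ⟨e, B, hB, claimA, fun i => ?_⟩
  have hzB : z = ∑ i, μ (e i) • B i := by
    rw [← m2]
    simp only [hB]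
    rw [← Finset.sum_image (s := Finset.univ) (g := e) (f := fun j => μ j • w j) (fun a _ b _ hab => he hab)]
    symm
    apply Finset.sum_subset (Finset.subset_univ _)
    intro j _ hj
    by_cases hm : μ j = 0
    · simp [hm]
    · obtain ⟨i, hi⟩ := claimB j hm
      exact absurd (Finset.mem_image.2 ⟨i, Finset.mem_univ _, hi⟩) hj
  rw [hzB, B.repr_sum_self]
  exact hJpos _ (heJ i)

theorem exists_avoid {E : Type} [AddCommGroup E] [Module ℝ E] {ι : Type} [Finite ι]
    (p : ι → Submodule ℝ E) (hp : ∀ i, p i ≠ ⊤) : ∃ x : E, ∀ i, x ∉ p i := by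
  by_contra hcon
  push Not at hcon
  obtain ⟨i, hi⟩ := Subspace.exists_eq_top_of_iUnion_eq_univ (p := p) (by
    ext x; simpa using hcon x)
  exact hp i hi

theorem ev_sign (a b : ℝ) (hb : b ≠ 0) :
    ∀ᶠ δ in nhdsWithin (0 : ℝ) (Set.Ioi 0), (0 < a + δ * b ↔ (0 < a ∨ (a = 0 ∧ 0 < b))) ∧
      a + δ * b ≠ 0 := by
  have hc : Filter.Tendsto (fun θ : ℝ => a + θ * b) (nhdsWithin 0 (Set.Ioi 0)) (nhds (a + 0 * b)) := by
    apply Filter.Tendsto.mono_left _ nhdsWithin_le_nhds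
    apply Continuous.tendsto; fun_prop
  rw [zero_mul, add_zero] at hc
  have hp := self_mem_nhdsWithin (a := (0:ℝ)) (s := Set.Ioi 0)
  rcases lt_trichotomy a 0 with ha | ha | ha
  · filter_upwards [hc.eventually (gt_mem_nhds ha)] with δ h1
    exact ⟨⟨fun h => by linarith, fun h => by
      rcases h with h | h
      · linarith
      · linarith [h.1]⟩, by linarith⟩
  · filter_upwards [hp] with δ h1
    have h1 : 0 < δ := h1
    subst ha
    simp [h1, hb, h1.ne']
  · filter_upwards [hc.eventually (lt_mem_nhds ha)] with δ h1
    exact ⟨⟨fun _ => Or.inl ha, fun _ => h1⟩, by linarith⟩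

theorem fan_exists {d : ℕ} {ι : Type} [Fintype ι] (w : ι → Fin d → ℝ)
    (hpos : ∀ z, ∃ μ : ι → ℝ, (∀ j, 0 ≤ μ j) ∧ ∑ j, μ j • w j = z) :
    ∃ (K : Type) (_ : Fintype K) (e : K → Fin d → ι)
      (B : K → Module.Basis (Fin d) ℝ (Fin d → ℝ)) (g : Fin d → ℝ),
      (∀ k i, B k i = w (e k i)) ∧ (∀ k j, ∑ i, (B k).repr (w j) i ≤ 1) ∧
      (∀ k i, (B k).repr g i ≠ 0) ∧
      (∀ s : ℝ, s ≠ 0 → ∀ z, ∃! k, ∀ i, 0 < (B k).repr z i ∨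
        ((B k).repr z i = 0 ∧ 0 < s * (B k).repr g i)) := by
  classical
  let F := {e : Fin d → ι // ∃ B : Module.Basis (Fin d) ℝ (Fin d → ℝ), ∀ i, B i = w (e i)}
  choose Bf hBf using fun f : F => f.2
  have hBuniq : ∀ (e : Fin d → ι) (B : Module.Basis (Fin d) ℝ (Fin d → ℝ))
      (hB : ∀ i, B i = w (e i)), B = Bf ⟨e, B, hB⟩ := by
    intro e B hB
    apply Module.Basis.eq_of_apply_eq
    intro i
    rw [hB, hBf]
  -- generic heights
  obtain ⟨c, hc⟩ : ∃ c : ι → ℝ, ∀ (f : F) (j : ι), (∀ i, f.1 i ≠ j) →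
      c j - ∑ i, (Bf f).repr (w j) i * c (f.1 i) ≠ 0 := by
    let T := {x : F × ι // ∀ i, x.1.1 i ≠ x.2}
    obtain ⟨c, hc⟩ := exists_avoid (E := ι → ℝ) (fun x : T =>
      LinearMap.ker (LinearMap.proj (R := ℝ) (φ := fun _ : ι => ℝ) x.1.2 -
        ∑ i, (Bf x.1.1).repr (w x.1.2) i • LinearMap.proj (R := ℝ) (φ := fun _ : ι => ℝ) (x.1.1.1 i)))
      (by
        intro x hx
        rw [LinearMap.ker_eq_top] at hx
        have := congrArg (fun L => L (Pi.single x.1.2 1)) hx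
        have hne : ∀ i, x.1.1.1 i ≠ x.1.2 := x.2
        simp [Pi.single_apply, hne] at this)
    refine ⟨c, fun f j hj => ?_⟩
    have := hc ⟨(f, j), hj⟩
    simpa using this
  -- small perturbation
  obtain ⟨h, hh, hgen, hsgn⟩ : ∃ h : ι → ℝ, (∀ j, 0 < h j) ∧ (∀ (f : F) (j : ι), (∀ i, f.1 i ≠ j) →
      h j - ∑ i, (Bf f).repr (w j) i * h (f.1 i) ≠ 0) ∧
      (∀ (f : F) (j : ι), (∀ i, f.1 i ≠ j) → 0 < h j - ∑ i, (Bf f).repr (w j) i * h (f.1 i) →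
        ∑ i, (Bf f).repr (w j) i ≤ 1) := by
    have e1 : ∀ᶠ ε in nhdsWithin (0 : ℝ) (Set.Ioi 0), ∀ j, 0 < 1 + ε * c j := by
      rw [Filter.eventually_all]
      intro j
      have hc : Filter.Tendsto (fun θ : ℝ => 1 + θ * c j) (nhdsWithin 0 (Set.Ioi 0))
          (nhds (1 + 0 * c j)) := by
        apply Filter.Tendsto.mono_left _ nhdsWithin_le_nhds
        apply Continuous.tendsto; fun_prop
      rw [zero_mul, add_zero] at hc
      exact hc.eventually (lt_mem_nhds one_pos)
    have e2 : ∀ᶠ ε in nhdsWithin (0 : ℝ) (Set.Ioi 0), ∀ (f : F) (j : ι), (∀ i, f.1 i ≠ j) →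
        ((0 < (1 - ∑ i, (Bf f).repr (w j) i) + ε * (c j - ∑ i, (Bf f).repr (w j) i * c (f.1 i)) ↔
          (0 < (1 - ∑ i, (Bf f).repr (w j) i) ∨ ((1 - ∑ i, (Bf f).repr (w j) i) = 0 ∧
            0 < (c j - ∑ i, (Bf f).repr (w j) i * c (f.1 i))))) ∧
          (1 - ∑ i, (Bf f).repr (w j) i) + ε * (c j - ∑ i, (Bf f).repr (w j) i * c (f.1 i)) ≠ 0) := by
      rw [Filter.eventually_all]
      intro f
      rw [Filter.eventually_all]
      intro j
      by_cases hj : ∀ i, f.1 i ≠ j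
      · filter_upwards [ev_sign _ _ (hc f j hj)] with ε h _
        exact h
      · exact Filter.Eventually.of_forall fun ε h => absurd h hj
    obtain ⟨ε, h1, h2⟩ := (e1.and e2).exists
    have hcomp : ∀ (f : F) (j : ι), (1 + ε * c j) - ∑ i, (Bf f).repr (w j) i * (1 + ε * c (f.1 i)) =
        (1 - ∑ i, (Bf f).repr (w j) i) + ε * (c j - ∑ i, (Bf f).repr (w j) i * c (f.1 i)) := by
      intro f j
      have : ∀ i, (Bf f).repr (w j) i * (1 + ε * c (f.1 i)) =
        (Bf f).repr (w j) i + ε * ((Bf f).repr (w j) i * c (f.1 i)) := fun i => by ring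
      simp only [this, Finset.sum_add_distrib, ← Finset.mul_sum]
      ring
    refine ⟨fun j => 1 + ε * c j, h1, fun f j hj => ?_, fun f j hj => ?_⟩
    · rw [hcomp]; exact (h2 f j hj).2
    · rw [hcomp, (h2 f j hj).1]
      rintro (h | h)
      · linarith
      · linarith [h.1]
  -- generic direction
  obtain ⟨g, hg⟩ : ∃ g : Fin d → ℝ, ∀ J : Set ι, g ∈ Submodule.span ℝ (w '' J) →
      Submodule.span ℝ (w '' J) = ⊤ := by
    let T := {J : Set ι // Submodule.span ℝ (w '' J) ≠ ⊤}
    obtain ⟨g, hg⟩ := exists_avoid (fun J : T => Submodule.span ℝ (w '' J.1)) (fun J => J.2)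
    refine ⟨g, fun J hJ => ?_⟩
    by_contra hcon
    exact hg ⟨J, hcon⟩ hJ
  have hgB : ∀ (e : Fin d → ι) (B : Module.Basis (Fin d) ℝ (Fin d → ℝ)), (∀ i, B i = w (e i)) →
      ∀ i, B.repr g i ≠ 0 := by
    intro e B hB i hi
    have hmem : g ∈ Submodule.span ℝ (w '' (e '' {m | m ≠ i})) := by
      rw [← B.sum_repr g]
      refine Submodule.sum_mem _ fun m _ => ?_
      by_cases hm : m = i
      · rw [hm, hi]; simp
      · exact Submodule.smul_mem _ _ (Submodule.subset_span ⟨e m, ⟨m, hm, rfl⟩, (hB m).symm⟩)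
    have htop := hg _ hmem
    have hle : Submodule.span ℝ (w '' (e '' {m | m ≠ i})) ≤ LinearMap.ker (B.coord i) := by
      rw [Submodule.span_le]
      rintro _ ⟨_, ⟨m, hm, rfl⟩, rfl⟩
      have hm : m ≠ i := hm
      simp [← hB, Finsupp.single_apply, hm]
    rw [htop] at hle
    have : B i ∈ LinearMap.ker (B.coord i) := hle trivial
    simp at this
  let K := {I : Finset ι // ∃ (e : Fin d → ι) (B : Module.Basis (Fin d) ℝ (Fin d → ℝ)),
    (∀ j, j ∈ I ↔ ∃ i, e i = j) ∧ (∀ i, B i = w (e i)) ∧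
    (∀ j, (∀ i, e i ≠ j) → 0 < h j - ∑ i, B.repr (w j) i * h (e i))}
  choose e B hI hB hopt using fun k : K => k.2
  refine ⟨K, inferInstance, e, B, g, hB, ?_, fun k => hgB _ _ (hB k), ?_⟩
  · intro k j
    by_cases hj : ∀ i, e k i ≠ j
    · have h1 := hopt k j hj
      rw [hBuniq _ _ (hB k)] at h1 ⊢
      exact hsgn ⟨e k, B k, hB k⟩ j hj h1
    · push Not at hj
      obtain ⟨i, rfl⟩ := hj
      rw [← hB]
      simp [Finsupp.single_apply]
  · intro s hs z
    have e1 : ∀ᶠ δ in nhdsWithin (0 : ℝ) (Set.Ioi 0), ∀ (k : K) (i : Fin d),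
        ((0 < (B k).repr z i + δ * (s * (B k).repr g i) ↔ (0 < (B k).repr z i ∨
          ((B k).repr z i = 0 ∧ 0 < s * (B k).repr g i))) ∧
          (B k).repr z i + δ * (s * (B k).repr g i) ≠ 0) := by
      rw [Filter.eventually_all]
      intro k
      rw [Filter.eventually_all]
      intro i
      exact ev_sign _ _ (mul_ne_zero hs (hgB _ _ (hB k) i))
    have e2 : ∀ᶠ δ in nhdsWithin (0 : ℝ) (Set.Ioi 0), ∀ J : Set ι,
        z + (δ * s) • g ∈ Submodule.span ℝ (w '' J) → Submodule.span ℝ (w '' J) = ⊤ := by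
      rw [Filter.eventually_all]
      intro J
      by_cases hJ : Submodule.span ℝ (w '' J) = ⊤
      · simp [hJ]
      · have hex : ∃ δ0 : ℝ, ∀ δ, z + (δ * s) • g ∈ Submodule.span ℝ (w '' J) → δ = δ0 := by
          by_contra hcon
          push Not at hcon
          obtain ⟨δ1, h1, -⟩ := hcon 0
          obtain ⟨δ2, h2, h12⟩ := hcon δ1
          have h3 := Submodule.sub_mem _ h2 h1
          have h4 : (z + (δ2 * s) • g) - (z + (δ1 * s) • g) = ((δ2 - δ1) * s) • g := by
            module
          rw [h4, Submodule.smul_mem_iff _ (mul_ne_zero (sub_ne_zero.2 h12) hs)] at h3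
          exact hJ (hg J h3)
        obtain ⟨δ0, hδ0⟩ := hex
        have : ∀ᶠ δ in nhdsWithin (0 : ℝ) (Set.Ioi 0), δ ≠ δ0 := by
          by_cases h0 : δ0 = 0
          · filter_upwards [self_mem_nhdsWithin (a := (0:ℝ)) (s := Set.Ioi 0)] with δ hδ
            rw [h0]; exact ne_of_gt hδ
          · exact nhdsWithin_le_nhds (isOpen_ne.mem_nhds (Ne.symm h0))
        filter_upwards [this] with δ h1 h2
        exact absurd (hδ0 δ h2) h1
    obtain ⟨δ, h1, h2⟩ := (e1.and e2).exists
    set y := z + (δ * s) • g with hy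
    have hyr : ∀ (k : K) i, (B k).repr y i = (B k).repr z i + δ * (s * (B k).repr g i) := by
      intro k i
      simp [hy, mul_assoc]
    have hiff : ∀ k : K, (∀ i, 0 < (B k).repr z i ∨
        ((B k).repr z i = 0 ∧ 0 < s * (B k).repr g i)) ↔ ∀ i, 0 < (B k).repr y i := by
      intro k
      refine forall_congr' fun i => ?_
      rw [hyr, (h1 k i).1]
    simp only [hiff]
    obtain ⟨e', B', hB', hopt', hpos'⟩ := lp_exists w h hh y (hpos y) (by
      intro e B hB j hj
      rw [hBuniq e B hB]
      exact hgen ⟨e, B, hB⟩ j hj) h2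
    let k0 : K := ⟨Finset.univ.image e', e', B', by simp, hB', hopt'⟩
    -- comparison
    have hle : ∀ k : K, ∀ j, ∑ i, (B k).repr (w j) i * h (e k i) ≤ h j ∧
        (∑ i, (B k).repr (w j) i * h (e k i) = h j → j ∈ k.1) := by
      intro k j
      by_cases hj : ∀ i, e k i ≠ j
      · have := hopt k j hj
        exact ⟨by linarith, fun h => by linarith⟩
      · push Not at hj
        obtain ⟨i, rfl⟩ := hj
        refine ⟨?_, fun _ => (hI k _).2 ⟨i, rfl⟩⟩
        rw [← hB]
        simp [Finsupp.single_apply]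
    have hexp : ∀ k k' : K, ∑ i, (B k).repr y i * h (e k i) =
        ∑ m, (B k').repr y m * ∑ i, (B k).repr (w (e k' m)) i * h (e k i) := by
      intro k k'
      conv_lhs => rw [← (B k').sum_repr y]
      simp only [map_sum, map_smul, Finsupp.coe_finsetSum, Finset.sum_apply, Finsupp.coe_smul,
        Pi.smul_apply, smul_eq_mul, Finset.sum_mul, Finset.mul_sum, hB]
      rw [Finset.sum_comm]
      simp [mul_assoc]
    have hcmp : ∀ k k' : K, (∀ i, 0 < (B k').repr y i) →
        ∑ i, (B k).repr y i * h (e k i) ≤ ∑ i, (B k').repr y i * h (e k' i) := by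
      intro k k' hp
      rw [hexp k k']
      exact Finset.sum_le_sum fun m _ => mul_le_mul_of_nonneg_left (hle k _).1 (hp m).le
    have hsub : ∀ k k' : K, (∀ i, 0 < (B k).repr y i) → (∀ i, 0 < (B k').repr y i) →
        k'.1 ⊆ k.1 := by
      intro k k' hp hp' j hj
      have heq := le_antisymm (hcmp k k' hp') (hcmp k' k hp)
      rw [hexp k k'] at heq
      rw [Finset.sum_eq_sum_iff_of_le
        (fun m _ => mul_le_mul_of_nonneg_left (hle k _).1 (hp' m).le)] at heq
      obtain ⟨m, rfl⟩ := (hI k' j).1 hj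
      have := heq m (Finset.mem_univ _)
      exact (hle k _).2 (mul_left_cancel₀ (hp' m).ne' this)
    have hk0 : ∀ i, 0 < (B k0).repr y i := by
      -- coordinates of `y` in `B k0` are those of `B'`, reordered
      intro i
      obtain ⟨i', hi'⟩ : ∃ i', e' i' = e k0 i := by
        have := (hI k0 (e k0 i)).2 ⟨i, rfl⟩
        simpa [k0] using this
      have hinj : Function.Injective (e k0) := by
        intro a b hab
        apply (B k0).injective
        rw [hB, hB, hab]
      have hall : ∀ m, ∃ a, e k0 a = e' m := fun m => (hI k0 (e' m)).1 (by simp [k0])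
      choose σ hσ using hall
      have hrep : y = ∑ m, B'.repr y m • B k0 (σ m) := by
        conv_lhs => rw [← B'.sum_repr y]
        refine Finset.sum_congr rfl fun m _ => ?_
        rw [hB, hB', hσ]
      have hyi : (B k0).repr y i = ∑ m, if σ m = i then B'.repr y m else 0 := by
        conv_lhs => rw [hrep]
        simp [Finsupp.single_apply]
      rw [hyi]
      have hσi : σ i' = i := hinj (by rw [hσ, hi'])
      refine Finset.sum_pos' (fun m _ => by split_ifs <;> [exact (hpos' m).le; exact le_rfl])
        ⟨i', Finset.mem_univ _, ?_⟩
      rw [if_pos hσi]; exact hpos' i'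
    refine ⟨k0, hk0, fun k hk => ?_⟩
    exact Subtype.ext (Finset.Subset.antisymm (hsub k0 k hk0 hk) (hsub k k0 hk hk0))

def slc {d : ℕ} (X : Set ((Fin d → ℤ) × ℤ)) (n : ℤ) : Set (Fin d → ℤ) := {u | (u, n) ∈ X}

noncomputable def genS {d : ℕ} (X : Set ((Fin d → ℤ) × ℤ)) : PowerSeries ℤ :=
  PowerSeries.mk fun n => ((slc X (n : ℤ)).ncard : ℤ)

theorem genS_shift {d : ℕ} (X Y : Set ((Fin d → ℤ) × ℤ)) (v : Fin d → ℤ) (m : ℕ)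
    (hfin : ∀ n, (slc X n).Finite) (hneg : ∀ u n, (u, n) ∈ X → 0 ≤ n)
    (hadd : ∀ u n, (u, n) ∈ X → (u + v, n + (m : ℤ)) ∈ X)
    (hY : ∀ u n, (u, n) ∈ Y ↔ (u, n) ∈ X ∧ (u - v, n - (m : ℤ)) ∉ X) :
    genS Y = (1 - PowerSeries.X ^ m) * genS X := by
  have key : ∀ n : ℤ, (slc X n).ncard = (slc Y n).ncard + (slc X (n - m)).ncard := by
    intro n
    have h1 : slc X n = slc Y n ∪ (fun u => u + v) '' slc X (n - m) := by
      ext u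
      simp only [slc, Set.mem_union, Set.mem_setOf_eq, Set.mem_image, hY]
      constructor
      · intro h
        by_cases h2 : (u - v, n - (m : ℤ)) ∈ X
        · exact Or.inr ⟨u - v, h2, by simp⟩
        · exact Or.inl ⟨h, h2⟩
      · rintro (h | ⟨u', h, rfl⟩)
        · exact h.1
        · simpa using hadd _ _ h
    have h2 : Disjoint (slc Y n) ((fun u => u + v) '' slc X (n - m)) := by
      rw [Set.disjoint_left]
      rintro _ h ⟨u', h', rfl⟩
      have := ((hY _ _).1 h).2
      simp only [add_sub_cancel_right] at this
      exact this h'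
    have hYfin : (slc Y n).Finite := (hfin n).subset (by rw [h1]; exact Set.subset_union_left)
    conv_lhs => rw [h1]
    rw [Set.ncard_union_eq h2 hYfin ((hfin _).image _),
      Set.ncard_image_of_injective _ (add_left_injective v)]
  ext n
  rw [sub_mul, one_mul, map_sub, PowerSeries.coeff_X_pow_mul']
  simp only [genS, PowerSeries.coeff_mk]
  have := key n
  split_ifs with hmn
  · rw [Nat.cast_sub hmn]; omega
  · have h0 : slc X ((n : ℤ) - m) = ∅ := by
      ext u
      simp only [slc, Set.mem_setOf_eq, Set.mem_empty_iff_false, iff_false]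
      intro h
      have := hneg _ _ h
      omega
    rw [h0] at this
    simp at this
    omega

theorem genS_union {d : ℕ} {K : Type} [Fintype K] (X : K → Set ((Fin d → ℤ) × ℤ))
    (Y : Set ((Fin d → ℤ) × ℤ)) (hfin : ∀ k n, (slc (X k) n).Finite)
    (hY : ∀ u n, (u, n) ∈ Y ↔ ∃ k, (u, n) ∈ X k)
    (hd : ∀ u n k k', (u, n) ∈ X k → (u, n) ∈ X k' → k = k') :
    genS Y = ∑ k, genS (X k) := by
  classical
  ext n
  rw [map_sum]
  simp only [genS, PowerSeries.coeff_mk]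
  have h1 : slc Y (n : ℤ) = ((Finset.univ.biUnion fun k => (hfin k n).toFinset : Finset _) : Set _) := by
    ext u
    simp [slc, hY]
  rw [h1, Set.ncard_coe_finset, Finset.card_biUnion]
  · push_cast
    refine Finset.sum_congr rfl fun k _ => ?_
    rw [Set.ncard_eq_toFinset_card _ (hfin k n)]
  · intro k _ k' _ hkk
    rw [Function.onFun, Finset.disjoint_left]
    intro u hu hu'
    exact hkk (hd u n k k' (by simpa [slc] using hu) (by simpa [slc] using hu'))

/-- the projection along `(x, l)` -/
noncomputable def zz {d : ℕ} (l : ℕ) (x : Fin d → ℤ) (u : Fin d → ℤ) (n : ℤ) : Fin d → ℝ :=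
  fun i => (u i : ℝ) - ((n : ℝ) / l) * x i

noncomputable def tt {d : ℕ} (q l : ℕ) (x : Fin d → ℤ)
    (B : Module.Basis (Fin d) ℝ (Fin d → ℝ)) (u : Fin d → ℤ) (n : ℤ) : ℝ :=
  ((n : ℝ) - q * ∑ i, B.repr (zz l x u n) i) / l

def lpos (γ a : ℝ) : Prop := 0 < a ∨ (a = 0 ∧ 0 < γ)

def XX {d : ℕ} (q l : ℕ) (x : Fin d → ℤ) (B : Module.Basis (Fin d) ℝ (Fin d → ℝ)) (γ : Fin d → ℝ)
    (S : Set ℝ) (T : Finset (Fin d)) : Set ((Fin d → ℤ) × ℤ) :=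
  {y | (∀ i, lpos (γ i) (B.repr (zz l x y.1 y.2) i)) ∧
    (∀ i ∈ T, ¬ lpos (γ i) (B.repr (zz l x y.1 y.2) i - 1)) ∧ tt q l x B y.1 y.2 ∈ S}

theorem lpos.nonneg {γ a : ℝ} (h : lpos γ a) : 0 ≤ a := by
  rcases h with h | h
  · exact h.le
  · exact h.1.ge

theorem lpos_add {γ a b : ℝ} (h : lpos γ a) (hb : 0 ≤ b) : lpos γ (a + b) := by
  rcases h with h | h
  · left; linarith
  · rcases hb.eq_or_lt with h0 | h0
    · right; exact ⟨by rw [h.1, ← h0, add_zero], h.2⟩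
    · left; linarith [h.1]

theorem lpos_refl {γ a : ℝ} (hγ : γ ≠ 0) : lpos (-γ) (1 - a) ↔ ¬ lpos γ (a - 1) := by
  unfold lpos
  rcases lt_trichotomy a 1 with h | h | h
  · have h1 : 0 < 1 - a := by linarith
    have h2 : ¬ 0 < a - 1 := by linarith
    have h3 : a - 1 ≠ 0 := by linarith
    simp [h1, h2, h3]
  · subst h
    simp only [sub_self, lt_irrefl, true_and, false_or, not_lt]
    constructor
    · intro h; linarith
    · intro h; have := lt_of_le_of_ne h hγ; linarith
  · have h1 : ¬ 0 < 1 - a := by linarith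
    have h2 : 0 < a - 1 := by linarith
    have h3 : 1 - a ≠ 0 := by linarith
    simp [h1, h2, h3]

section cone
variable {d q l : ℕ} (hl : 0 < l) (x : Fin d → ℤ) (B : Module.Basis (Fin d) ℝ (Fin d → ℝ))
  (v : Fin d → Fin d → ℤ) (hB : ∀ i, B i = zz l x (v i) q)

theorem zz_add (u u' : Fin d → ℤ) (n n' : ℤ) :
    zz l x (u + u') (n + n') = zz l x u n + zz l x u' n' := by
  ext i; simp only [zz, Pi.add_apply]; push_cast; ring

theorem zz_sub (u u' : Fin d → ℤ) (n n' : ℤ) :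
    zz l x (u - u') (n - n') = zz l x u n - zz l x u' n' := by
  ext i; simp only [zz, Pi.sub_apply]; push_cast; ring

theorem zz_sum {κ : Type} (s : Finset κ) (f : κ → Fin d → ℤ) (m : κ → ℤ) :
    zz l x (∑ i ∈ s, f i) (∑ i ∈ s, m i) = ∑ i ∈ s, zz l x (f i) (m i) := by
  classical
  induction s using Finset.induction_on with
  | empty => ext i; simp [zz]
  | insert a s ha ih => rw [Finset.sum_insert ha, Finset.sum_insert ha, Finset.sum_insert ha,
      zz_add, ih]

include hl

theorem zz_apex : zz l x x l = 0 := by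
  have : (l : ℝ) ≠ 0 := by positivity
  ext i; simp [zz, this]

theorem ht_eq (u : Fin d → ℤ) (n : ℤ) :
    (n : ℝ) = q * ∑ i, B.repr (zz l x u n) i + l * tt q l x B u n := by
  have : (l : ℝ) ≠ 0 := by positivity
  simp only [tt]; field_simp; ring

theorem tt_apex (u : Fin d → ℤ) (n : ℤ) :
    tt q l x B (u - x) (n - l) = tt q l x B u n - 1 := by
  have : (l : ℝ) ≠ 0 := by positivity
  simp only [tt, zz_sub, zz_apex hl]
  push_cast
  field_simp
  simp
  ring

include hB

omit hl in
theorem repr_shift (u : Fin d → ℤ) (n : ℤ) (i m : Fin d) :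
    B.repr (zz l x (u - v i) (n - q)) m = B.repr (zz l x u n) m - if i = m then 1 else 0 := by
  rw [zz_sub, ← hB]
  simp [Finsupp.single_apply]

theorem tt_shift (u : Fin d → ℤ) (n : ℤ) (i : Fin d) :
    tt q l x B (u - v i) (n - q) = tt q l x B u n := by
  simp only [tt, repr_shift x B v hB]
  rw [Finset.sum_sub_distrib]
  simp
  ring

theorem u_eq (u : Fin d → ℤ) (n : ℤ) (j : Fin d) :
    (u j : ℝ) = ∑ i, B.repr (zz l x u n) i * v i j + tt q l x B u n * x j := by
  have hl' : (l : ℝ) ≠ 0 := by positivity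
  have h1 := congrFun (B.sum_repr (zz l x u n)) j
  simp only [hB, Finset.sum_apply, Pi.smul_apply, smul_eq_mul] at h1
  have h2 := ht_eq (q := q) hl x B u n
  set c := fun i => B.repr (zz l x u n) i
  have h3 : ∑ i, c i * zz l x (v i) q j = ∑ i, c i * v i j - (∑ i, c i) * (q / l * x j) := by
    rw [Finset.sum_mul, ← Finset.sum_sub_distrib]
    refine Finset.sum_congr rfl fun i _ => ?_
    simp only [zz]; push_cast; ring
  have h4 : zz l x u n j = u j - n / l * x j := rfl
  have h1' : ∑ i, c i * zz l x (v i) q j = zz l x u n j := h1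
  have h2' : (n : ℝ) = q * ∑ i, c i + l * tt q l x B u n := h2
  rw [h3, h4, h2'] at h1'
  have : (u j : ℝ) = ∑ i, c i * v i j - (∑ i, c i) * (q / l * x j) +
    (q * ∑ i, c i + l * tt q l x B u n) / l * x j := by linarith
  rw [this]
  field_simp
  ring

variable (hq : 0 < q) (γ : Fin d → ℝ) (S : Set ℝ) (hS : ∀ s ∈ S, 0 ≤ s)
include hq hS

theorem XX_nonneg (T : Finset (Fin d)) (u : Fin d → ℤ) (n : ℤ) (h : (u, n) ∈ XX q l x B γ S T) :
    0 ≤ n := by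
  have h2 := ht_eq (q := q) hl x B u n
  have h3 : 0 ≤ ∑ i, B.repr (zz l x u n) i := Finset.sum_nonneg fun i _ => (h.1 i).nonneg
  have h4 := hS _ h.2.2
  have : (0 : ℝ) ≤ n := by rw [h2]; positivity
  exact_mod_cast this

theorem XX_finite (T : Finset (Fin d)) (n : ℤ) : (slc (XX q l x B γ S T) n).Finite := by
  have hq' : (0 : ℝ) < q := by exact_mod_cast hq
  have hl' : (0 : ℝ) < l := by exact_mod_cast hl
  let M : Fin d → ℝ := fun j => ∑ i, (n / q : ℝ) * |(v i j : ℝ)| + (n / l : ℝ) * |(x j : ℝ)|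
  apply (Set.finite_Icc (fun j => -⌈M j⌉) (fun j => ⌈M j⌉)).subset
  intro u hu
  have hu : (u, n) ∈ XX q l x B γ S T := hu
  have hht := ht_eq (q := q) hl x B u n
  have hc : ∀ i, 0 ≤ B.repr (zz l x u n) i := fun i => (hu.1 i).nonneg
  have ht : 0 ≤ tt q l x B u n := hS _ hu.2.2
  have hs : 0 ≤ ∑ i, B.repr (zz l x u n) i := Finset.sum_nonneg fun i _ => hc i
  have hs1 : ∀ i, B.repr (zz l x u n) i ≤ n / q := by
    intro i
    have h1 := Finset.single_le_sum (f := fun i => B.repr (zz l x u n) i)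
      (fun i _ => hc i) (Finset.mem_univ i)
    rw [le_div_iff₀ hq']
    have h2 : B.repr (zz l x u n) i ≤ ∑ i, B.repr (zz l x u n) i := h1
    nlinarith [mul_nonneg hl'.le ht, mul_le_mul_of_nonneg_right h2 hq'.le]
  have ht1 : tt q l x B u n ≤ n / l := by
    rw [le_div_iff₀ hl']
    nlinarith [mul_nonneg hq'.le hs]
  have habs : ∀ j, |(u j : ℝ)| ≤ M j := by
    intro j
    rw [u_eq hl x B v hB u n j]
    refine (abs_add_le _ _).trans (add_le_add ?_ ?_)
    · refine (Finset.abs_sum_le_sum_abs _ _).trans (Finset.sum_le_sum fun i _ => ?_)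
      rw [abs_mul, abs_of_nonneg (hc i)]
      exact mul_le_mul_of_nonneg_right (hs1 i) (abs_nonneg _)
    · rw [abs_mul, abs_of_nonneg ht]
      exact mul_le_mul_of_nonneg_right ht1 (abs_nonneg _)
  have hb : ∀ j, |u j| ≤ ⌈M j⌉ := by
    intro j
    have : ((|u j| : ℤ) : ℝ) ≤ (⌈M j⌉ : ℝ) := by
      push_cast
      exact (habs j).trans (Int.le_ceil _)
    exact_mod_cast this
  exact ⟨fun j => (abs_le.1 (hb j)).1, fun j => (abs_le.1 (hb j)).2⟩

theorem genS_XX (T : Finset (Fin d)) :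
    genS (XX q l x B γ S T) = (1 - PowerSeries.X ^ q) ^ T.card * genS (XX q l x B γ S ∅) := by
  classical
  induction T using Finset.induction_on with
  | empty => simp
  | insert a T ha ih =>
    rw [Finset.card_insert_of_notMem ha, pow_succ', mul_assoc, ← ih]
    have hsub : ∀ u n, (u - v a, n - (q : ℤ)) ∈ XX q l x B γ S T ↔
        ((∀ i, lpos (γ i) (B.repr (zz l x u n) i - if a = i then 1 else 0)) ∧
        (∀ i ∈ T, ¬ lpos (γ i) (B.repr (zz l x u n) i - 1)) ∧ tt q l x B u n ∈ S) := by
      intro u n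
      simp only [XX, Set.mem_setOf_eq, repr_shift x B v hB, tt_shift hl x B v hB]
      refine and_congr_right fun _ => and_congr_left fun _ => forall₂_congr fun i hi => ?_
      have : a ≠ i := fun h => ha (h ▸ hi)
      simp [this]
    apply genS_shift _ _ (v a) q (XX_finite hl x B v hB hq γ S hS T)
      (XX_nonneg hl x B v hB hq γ S hS T)
    · intro u n h
      have h2 := (hsub (u + v a) (n + q)).1 (by simpa using h)
      refine ⟨fun i => ?_, h2.2.1, h2.2.2⟩
      have := lpos_add (h2.1 i) (b := if a = i then 1 else 0) (by split_ifs <;> norm_num)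
      simpa using this
    · intro u n
      rw [hsub]
      simp only [XX, Set.mem_setOf_eq, Finset.forall_mem_insert]
      constructor
      · rintro ⟨h1, ⟨h2, h3⟩, h4⟩
        refine ⟨⟨h1, h3, h4⟩, fun h => h2 ?_⟩
        simpa using h.1 a
      · rintro ⟨⟨h1, h3, h4⟩, h5⟩
        refine ⟨h1, ⟨fun h => h5 ⟨fun i => ?_, h3, h4⟩, h3⟩, h4⟩
        by_cases hai : a = i
        · subst hai; simpa using h
        · simpa [hai] using h1 i

omit hq hS in
theorem XX_reflect (hγ : ∀ i, γ i ≠ 0) (ε : ℕ) (hSε : ∀ s, s ∈ S → (ε : ℝ) - s ∈ S) (n : ℤ) :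
    (slc (XX q l x B γ S Finset.univ) n).ncard =
      (slc (XX q l x B (fun i => -γ i) S Finset.univ) (q * d + ε * l - n)).ncard := by
  have hl' : (l : ℝ) ≠ 0 := by positivity
  let c : Fin d → ℤ := ∑ i, v i + ε • x
  have hz : ∀ u n, zz l x (c - u) (q * d + ε * l - n) = ∑ i, B i - zz l x u n := by
    intro u n
    rw [zz_sub]
    congr 1
    have h1 : zz l x (∑ i, v i) (∑ i : Fin d, (q : ℤ)) = ∑ i, B i := by
      rw [zz_sum]; simp [hB]
    have h2 : zz l x (ε • x) (ε * l) = 0 := by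
      ext i; simp [zz]; field_simp; simp
    have h3 : (q * d : ℤ) = ∑ i : Fin d, (q : ℤ) := by simp [mul_comm]
    rw [h3, zz_add, h1, h2, add_zero]
  have hr : ∀ u n i, B.repr (zz l x (c - u) (q * d + ε * l - n)) i = 1 - B.repr (zz l x u n) i := by
    intro u n i
    rw [hz]
    simp [Finsupp.single_apply]
  have ht : ∀ u n, tt q l x B (c - u) (q * d + ε * l - n) = ε - tt q l x B u n := by
    intro u n
    simp only [tt, hr]
    rw [Finset.sum_sub_distrib]
    simp
    field_simp
    ring
  rw [← Set.ncard_image_of_injective (slc (XX q l x B γ S Finset.univ) n)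
    (f := fun u => c - u) sub_right_injective]
  congr 1
  have main : ∀ (γ : Fin d → ℝ), (∀ i, γ i ≠ 0) → ∀ u n, (u, n) ∈ XX q l x B γ S Finset.univ →
      (c - u, q * d + ε * l - n) ∈ XX q l x B (fun i => -γ i) S Finset.univ := by
    rintro γ hγ u n ⟨h1, h2, h3⟩
    refine ⟨fun i => ?_, fun i _ => ?_, ?_⟩
    · simp only [hr]
      exact (lpos_refl (hγ i)).2 (h2 i (Finset.mem_univ _))
    · simp only [hr]
      rw [← lpos_refl (neg_ne_zero.2 (hγ i))]
      simpa using h1 i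
    · simp only [ht]
      exact hSε _ h3
  ext u
  constructor
  · rintro ⟨u', h, rfl⟩
    exact main γ hγ u' n h
  · intro h
    refine ⟨c - u, ?_, by simp⟩
    have := main (fun i => -γ i) (fun i => neg_ne_zero.2 (hγ i)) u _ h
    simpa [slc] using this

end cone

def YY {d : ℕ} (q l : ℕ) (x : Fin d → ℤ) {K : Type} (B : K → Module.Basis (Fin d) ℝ (Fin d → ℝ))
    (S : Set ℝ) : Set ((Fin d → ℤ) × ℤ) :=
  {y | ∃ k, (∀ i, 0 ≤ (B k).repr (zz l x y.1 y.2) i) ∧ tt q l x (B k) y.1 y.2 ∈ S}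

section core
variable {d q l : ℕ} (hl : 0 < l) (hq : 0 < q) (x : Fin d → ℤ) {ι : Type} [Fintype ι]
  (v : ι → Fin d → ℤ) {K : Type} [Fintype K] (e : K → Fin d → ι)
  (B : K → Module.Basis (Fin d) ℝ (Fin d → ℝ)) (g : Fin d → ℝ)
  (hB : ∀ k i, B k i = zz l x (v (e k i)) q)
  (hle : ∀ k j, ∑ i, (B k).repr (zz l x (v j) q) i ≤ 1)
  (hg : ∀ k i, (B k).repr g i ≠ 0)
  (hfan : ∀ s : ℝ, s ≠ 0 → ∀ z, ∃! k, ∀ i, 0 < (B k).repr z i ∨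
        ((B k).repr z i = 0 ∧ 0 < s * (B k).repr g i))

include hB hle in
theorem sum_cmp (z : Fin d → ℝ) (k k' : K) (h : ∀ i, 0 ≤ (B k').repr z i) :
    ∑ i, (B k).repr z i ≤ ∑ i, (B k').repr z i := by
  have : ∑ i, (B k).repr z i = ∑ m, (B k').repr z m * ∑ i, (B k).repr (zz l x (v (e k' m)) q) i := by
    conv_lhs => rw [← (B k').sum_repr z]
    simp only [map_sum, map_smul, Finsupp.coe_finsetSum, Finset.sum_apply, Finsupp.coe_smul,
        Pi.smul_apply, smul_eq_mul, Finset.mul_sum, hB]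
    rw [Finset.sum_comm]
  rw [this]
  refine Finset.sum_le_sum fun m _ => ?_
  exact mul_le_of_le_one_right (h m) (hle k _)

include hl hq hB hle hg hfan

theorem genS_YY (S : Set ℝ) (hS : ∀ s ∈ S, 0 ≤ s) (s : ℝ) (hs : s ≠ 0) :
    (1 - PowerSeries.X ^ q) ^ d * genS (YY q l x B S) =
      ∑ k, genS (XX q l x (B k) (fun i => s * (B k).repr g i) S Finset.univ) := by
  rw [genS_union (fun k => XX q l x (B k) (fun i => s * (B k).repr g i) S ∅) (YY q l x B S)
    (fun k => XX_finite hl x (B k) (fun i => v (e k i)) (hB k) hq _ S hS ∅), Finset.mul_sum]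
  · refine Finset.sum_congr rfl fun k _ => ?_
    rw [genS_XX hl x (B k) (fun i => v (e k i)) (hB k) hq _ S hS Finset.univ]
    simp
  · intro u n
    constructor
    · rintro ⟨k, h1, h2⟩
      obtain ⟨k', hk', -⟩ := hfan s hs (zz l x u n)
      refine ⟨k', hk', by simp, ?_⟩
      have h3 : ∀ i, 0 ≤ (B k').repr (zz l x u n) i := fun i => lpos.nonneg (hk' i)
      have h4 := le_antisymm (sum_cmp x v e B hB hle (zz l x u n) k k' h3)
        (sum_cmp x v e B hB hle (zz l x u n) k' k h1)
      simp only [tt] at h2 ⊢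
      rwa [h4] at h2
    · rintro ⟨k, h1, -, h2⟩
      exact ⟨k, fun i => (h1 i).nonneg, h2⟩
  · intro u n k k' h h'
    exact (hfan s hs (zz l x u n)).unique h.1 h'.1

theorem YY_props (S : Set ℝ) (hS : ∀ s ∈ S, 0 ≤ s) (ε : ℕ)
    (hSε : ∀ s, s ∈ S → (ε : ℝ) - s ∈ S) (L : ℕ)
    (hL : ∀ u n, (u, n) ∈ YY q l x B S → (L : ℤ) ≤ n) :
    ∃ f : ℕ → ℤ, (1 - PowerSeries.X ^ q) ^ d * genS (YY q l x B S) = PowerSeries.mk f ∧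
      (∀ n, 0 ≤ f n) ∧ (∀ n, n < L → f n = 0) ∧ (∀ n, q * d + ε * l < n + L → f n = 0) ∧
      (∀ n, n ≤ q * d + ε * l → f n = f (q * d + ε * l - n)) := by
  let N : ℝ → ℤ → ℤ := fun s n =>
    ∑ k, ((slc (XX q l x (B k) (fun i => s * (B k).repr g i) S Finset.univ) n).ncard : ℤ)
  have hN : ∀ s, s ≠ 0 → (1 - PowerSeries.X ^ q) ^ d * genS (YY q l x B S) =
      PowerSeries.mk fun n => N s n := by
    intro s hs
    rw [genS_YY hl hq x v e B g hB hle hg hfan S hS s hs]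
    ext n
    simp [N, genS]
  have hsame : ∀ n : ℕ, N 1 n = N (-1) n := by
    intro n
    have := (hN 1 one_ne_zero).symm.trans (hN (-1) (by norm_num))
    simpa using congrArg (PowerSeries.coeff n) this
  have hrefl : ∀ n : ℤ, N 1 n = N (-1) (q * d + ε * l - n) := by
    intro n
    simp only [N]
    refine Finset.sum_congr rfl fun k _ => ?_
    rw [XX_reflect hl x (B k) (fun i => v (e k i)) (hB k) _ S (fun i => by simpa using hg k i) ε hSε n]
    congr 3
    simp
  have hlow : ∀ s, ∀ n : ℤ, n < L → N s n = 0 := by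
    intro s n hn
    refine Finset.sum_eq_zero fun k _ => ?_
    have : slc (XX q l x (B k) (fun i => s * (B k).repr g i) S Finset.univ) n = ∅ := by
      ext u
      simp only [Set.mem_empty_iff_false, iff_false]
      rintro ⟨h1, -, h2⟩
      have := hL u n ⟨k, fun i => (h1 i).nonneg, h2⟩
      omega
    rw [this]; simp
  refine ⟨fun n => N 1 n, hN 1 one_ne_zero, fun n => ?_, fun n hn => ?_, fun n hn => ?_, fun n hn => ?_⟩
  · exact Finset.sum_nonneg fun k _ => by positivity
  · exact hlow 1 n (by omega)
  · show N 1 n = 0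
    rw [hrefl]
    apply hlow
    have : ((q * d + ε * l : ℕ) : ℤ) < ((n + L : ℕ) : ℤ) := by exact_mod_cast hn
    push_cast at this
    linarith
  · show N 1 n = N 1 _
    rw [hrefl, hsame]
    congr 1
    rw [Nat.cast_sub hn]
    push_cast
    ring

omit hq hle hg hfan in
theorem YY_cone (u : Fin d → ℤ) (n : ℤ) (S : Set ℝ) (h : (u, n) ∈ YY q l x B S) :
    ∃ (μ : ι → ℝ) (t : ℝ), (∀ j, 0 ≤ μ j) ∧ t ∈ S ∧
      (∀ i, (u i : ℝ) = ∑ j, μ j * v j i + t * x i) ∧ (n : ℝ) = q * ∑ j, μ j + l * t := by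
  classical
  obtain ⟨k, h1, h2⟩ := h
  refine ⟨fun j => ∑ i, if e k i = j then (B k).repr (zz l x u n) i else 0, tt q l x (B k) u n,
    fun j => Finset.sum_nonneg fun i _ => ?_, h2, fun m => ?_, ?_⟩
  · split_ifs
    · exact h1 i
    · exact le_rfl
  · rw [u_eq hl x (B k) (fun i => v (e k i)) (hB k) u n m]
    congr 1
    simp only [Finset.sum_mul]
    rw [Finset.sum_comm]
    simp
  · rw [Finset.sum_comm]
    simp only [Finset.sum_ite_eq, Finset.mem_univ, if_true]
    exact ht_eq hl x (B k) u n

omit hq hg in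
theorem cone_YY (u : Fin d → ℤ) (n : ℤ) (μ : ι → ℝ) (hμ : ∀ j, 0 ≤ μ j)
    (hu : ∀ i, (u i : ℝ) = ∑ j, μ j * v j i) (hn : (n : ℝ) = q * ∑ j, μ j) :
    (u, n) ∈ YY q l x B (Set.Ici 0) := by
  have hl' : (0 : ℝ) < l := by exact_mod_cast hl
  obtain ⟨k, hk, -⟩ := hfan 1 one_ne_zero (zz l x u n)
  refine ⟨k, fun i => lpos.nonneg (hk i), ?_⟩
  have hz : zz l x u n = ∑ j, μ j • zz l x (v j) q := by
    ext i
    simp only [zz, hu, hn, Finset.sum_apply, Pi.smul_apply, smul_eq_mul, mul_sub,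
      Finset.sum_sub_distrib]
    congr 1
    rw [Finset.mul_sum, Finset.sum_div, Finset.sum_mul]
    refine Finset.sum_congr rfl fun j _ => ?_
    push_cast
    ring
  have hs : ∑ i, (B k).repr (zz l x u n) i ≤ ∑ j, μ j := by
    rw [hz]
    simp only [map_sum, map_smul, Finsupp.coe_finsetSum, Finset.sum_apply, Finsupp.coe_smul,
        Pi.smul_apply, smul_eq_mul]
    rw [Finset.sum_comm]
    refine Finset.sum_le_sum fun j _ => ?_
    rw [← Finset.mul_sum]
    exact mul_le_of_le_one_right (hμ j) (hle k _)
  show 0 ≤ tt q l x (B k) u n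
  simp only [tt]
  apply div_nonneg _ hl'.le
  rw [hn]
  have : (0:ℝ) ≤ q := by positivity
  nlinarith

theorem core_aux (hmin : ∀ (u : Fin d → ℤ) (n : ℤ) (μ : ι → ℝ) (t : ℝ), (∀ j, 0 ≤ μ j) → 0 < t →
      (∀ i, (u i : ℝ) = ∑ j, μ j * v j i + t * x i) → (n : ℝ) = q * ∑ j, μ j + l * t → (l : ℤ) ≤ n)
    (ν : ι → ℝ) (hν : ∀ j, 0 ≤ ν j) (hxν : ∀ i, (x i : ℝ) = ∑ j, ν j * v j i)
    (hlν : (l : ℝ) = q * ∑ j, ν j) (E : PowerSeries ℤ)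
    (hE : ∀ n : ℕ, PowerSeries.coeff n E = (Set.ncard {u : Fin d → ℤ | ∃ μ : ι → ℝ, (∀ j, 0 ≤ μ j) ∧
      (∀ i, (u i : ℝ) = ∑ j, μ j * v j i) ∧ (n : ℝ) = q * ∑ j, μ j} : ℤ)) :
    ∃ a b : ℕ → ℤ, (1 - PowerSeries.X ^ q) ^ d * ((1 - PowerSeries.X ^ l) * E) =
        PowerSeries.mk a + PowerSeries.mk b ∧
      (∀ n, 0 ≤ a n) ∧ (∀ n, 0 ≤ b n) ∧ (∀ n, q * d < n → a n = 0) ∧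
      (∀ n, n ≤ q * d → a n = a (q * d - n)) ∧
      (∀ n, n < l → b n = 0) ∧ (∀ n, q * d < n → b n = 0) ∧
      (∀ n, n ≤ q * d + l → b n = b (q * d + l - n)) := by
  have hconv : ∀ u n S, (∀ s ∈ S, (0 : ℝ) ≤ s) → (u, n) ∈ YY q l x B S → (0 : ℤ) ≤ n := by
    intro u n S hS h
    obtain ⟨μ, t, h1, h2, h3, h4⟩ := YY_cone hl x v e B hB u n S h
    have : (0 : ℝ) ≤ n := by
      rw [h4]
      have := hS t h2
      have h5 : 0 ≤ ∑ j, μ j := Finset.sum_nonneg fun j _ => h1 j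
      positivity
    exact_mod_cast this
  have hEeq : E = genS (YY q l x B (Set.Ici 0)) := by
    ext n
    rw [hE]
    simp only [genS, PowerSeries.coeff_mk]
    congr 2
    ext u
    constructor
    · rintro ⟨μ, h1, h2, h3⟩
      exact cone_YY hl x v e B g hB hle hfan u n μ h1 h2 (by exact_mod_cast h3)
    · intro h
      obtain ⟨μ, t, h1, h2, h3, h4⟩ := YY_cone hl x v e B hB u n _ h
      have h2 : 0 ≤ t := h2
      refine ⟨fun j => μ j + t * ν j, fun j => add_nonneg (h1 j) (mul_nonneg h2 (hν j)),
        fun i => ?_, ?_⟩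
      · rw [h3, hxν]
        simp only [add_mul, Finset.sum_add_distrib, mul_assoc, Finset.mul_sum]
      · have h4' : (n : ℝ) = q * ∑ j, μ j + l * t := by exact_mod_cast h4
        rw [h4', Finset.sum_add_distrib, ← Finset.mul_sum, hlν]
        ring
  have hfinY : ∀ (S : Set ℝ), (∀ s ∈ S, (0 : ℝ) ≤ s) → ∀ n, (slc (YY q l x B S) n).Finite := by
    intro S hS n
    have : slc (YY q l x B S) n ⊆ ⋃ k, slc (XX q l x (B k) (fun _ => 1) S ∅) n := by
      rintro u ⟨k, h1, h2⟩
      refine Set.mem_iUnion.2 ⟨k, fun i => ?_, by simp, h2⟩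
      rcases (h1 i).eq_or_lt with h | h
      · exact Or.inr ⟨h.symm, one_pos⟩
      · exact Or.inl h
    exact (Set.finite_iUnion fun k => XX_finite hl x (B k) (fun i => v (e k i)) (hB k) hq _ S hS ∅ n).subset this
  have hap : ∀ u n S, (u - x, n - (l : ℤ)) ∈ YY q l x B S ↔
      ∃ k, (∀ i, 0 ≤ (B k).repr (zz l x u n) i) ∧ tt q l x (B k) u n - 1 ∈ S := by
    intro u n S
    simp only [YY, Set.mem_setOf_eq, tt_apex hl, zz_sub, zz_apex hl, sub_zero]
  have hwd : ∀ u n k k', (∀ i, 0 ≤ (B k).repr (zz l x u n) i) →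
      (∀ i, 0 ≤ (B k').repr (zz l x u n) i) → tt q l x (B k) u n = tt q l x (B k') u n := by
    intro u n k k' h h'
    simp only [tt]
    rw [le_antisymm (sum_cmp x v e B hB hle (zz l x u n) k k' h')
        (sum_cmp x v e B hB hle (zz l x u n) k' k h)]
  have hshift : genS (YY q l x B (Set.Ico 0 1)) = (1 - PowerSeries.X ^ l) * E := by
    rw [hEeq]
    apply genS_shift (YY q l x B (Set.Ici 0)) _ x l (hfinY (Set.Ici 0) fun s hs => hs)
      (fun u n => hconv u n (Set.Ici 0) fun s hs => hs)
    · intro u n h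
      have := (hap (u + x) (n + l) (Set.Ici 0)).1 (by simpa using h)
      obtain ⟨k, h1, h2⟩ := this
      have h2 : 0 ≤ tt q l x (B k) (u + x) (n + l) - 1 := h2
      exact ⟨k, h1, show 0 ≤ tt q l x (B k) (u + x) (n + l) by linarith⟩
    · intro u n
      rw [hap]
      constructor
      · rintro ⟨k, h1, h2⟩
        refine ⟨⟨k, h1, h2.1⟩, ?_⟩
        rintro ⟨k', h3, h4⟩
        rw [hwd u n k' k h3 h1] at h4
        have h4 : 0 ≤ tt q l x (B k) u n - 1 := h4
        have := h2.2
        simp only at this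
        linarith
      · rintro ⟨⟨k, h1, h2⟩, h3⟩
        refine ⟨k, h1, h2, ?_⟩
        by_contra hcon
        refine h3 ⟨k, h1, ?_⟩
        have hcon := not_lt.1 hcon
        show 0 ≤ tt q l x (B k) u n - 1
        simp only at hcon
        linarith
  have hsplit : genS (YY q l x B (Set.Ico 0 1)) =
      genS (YY q l x B {0}) + genS (YY q l x B (Set.Ioo 0 1)) := by
    rw [genS_union (K := Bool) (fun b => if b then YY q l x B {0} else YY q l x B (Set.Ioo 0 1))]
    · simp
    · rintro (_ | _) n
      · exact hfinY _ (fun s hs => hs.1.le) n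
      · exact hfinY _ (fun s hs => hs.ge) n
    · intro u n
      rw [Bool.exists_bool]
      constructor
      · rintro ⟨k, h1, h2⟩
        rcases h2.1.eq_or_lt with h | h
        · right; exact ⟨k, h1, h.symm⟩
        · left; exact ⟨k, h1, h, h2.2⟩
      · rintro (⟨k, h1, h2⟩ | ⟨k, h1, h2⟩)
        · exact ⟨k, h1, h2.1.le, h2.2⟩
        · have h2 : tt q l x (B k) u n = 0 := h2
          exact ⟨k, h1, h2.ge, show tt q l x (B k) u n < 1 by rw [h2]; exact one_pos⟩
    · have aux : ∀ u n, (u, n) ∈ YY q l x B {0} → (u, n) ∈ YY q l x B (Set.Ioo 0 1) → False := by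
        rintro u n ⟨k, h1, h2⟩ ⟨k', h3, h4⟩
        have h2 : tt q l x (B k) u n = 0 := h2
        have h5 : 0 < tt q l x (B k') u n := h4.1
        rw [hwd u n k' k h3 h1, h2] at h5
        exact lt_irrefl _ h5
      rintro u n (_ | _) (_ | _) h h'
      · rfl
      · exact (aux u n h' h).elim
      · exact (aux u n h h').elim
      · rfl
  obtain ⟨a, ha, a1, -, a3, a4⟩ := YY_props hl hq x v e B g hB hle hg hfan {0} (fun s hs => hs.ge) 0
    (by intro s hs; have hs : s = 0 := hs; simp [hs]) 0 (fun u n h => by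
      simpa using hconv u n _ (fun s hs => hs.ge) h)
  obtain ⟨b, hb, b1, b2, b3, b4⟩ := YY_props hl hq x v e B g hB hle hg hfan (Set.Ioo 0 1)
    (fun s hs => hs.1.le) 1 (by intro s hs; simpa using hs.symm) l (fun u n h => by
      obtain ⟨μ, t, h1, h2, h3, h4⟩ := YY_cone hl x v e B hB u n _ h
      exact hmin u n μ t h1 h2.1 h3 h4)
  refine ⟨a, b, ?_, a1, b1, ?_, ?_, b2, ?_, ?_⟩
  · rw [← hshift, hsplit, mul_add, ha, hb]
  · intro n hn; exact a3 n (by omega)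
  · simpa using a4
  · intro n hn; exact b3 n (by omega)
  · simpa using b4

end core

theorem mem_dilate {d q : ℕ} (hq : 0 < q) (P : Set (Fin d → ℝ)) (V : Finset (Fin d → ℝ))
    (hV : (q : ℝ) • P = convexHull ℝ (V : Set (Fin d → ℝ))) (n : ℝ) (hn : 0 < n) (y : Fin d → ℝ) :
    y ∈ n • P ↔ ∃ μ : V → ℝ, (∀ j, 0 ≤ μ j) ∧ y = ∑ j, μ j • (j : Fin d → ℝ) ∧
      n = q * ∑ j, μ j := by
  have hq' : (0 : ℝ) < q := by exact_mod_cast hq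
  constructor
  · rintro ⟨p, hp, rfl⟩
    have h1 : (q : ℝ) • p ∈ convexHull ℝ (V : Set (Fin d → ℝ)) := hV ▸ Set.smul_mem_smul_set hp
    rw [Finset.mem_convexHull'] at h1
    obtain ⟨m, m1, m2, m3⟩ := h1
    rw [← Finset.sum_coe_sort] at m2 m3
    refine ⟨fun j => n / q * m j, fun j => mul_nonneg (by positivity) (m1 j j.2), ?_, ?_⟩
    · simp only [mul_smul, ← Finset.smul_sum]
      rw [m3, smul_smul, div_mul_cancel₀ _ hq'.ne']
    · rw [← Finset.mul_sum, m2]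
      field_simp
  · rintro ⟨μ, h1, h2, h3⟩
    have hmem : ((q : ℝ) / n) • y ∈ (q : ℝ) • P := by
      rw [hV, h2, Finset.smul_sum]
      simp only [smul_smul]
      refine (convex_convexHull ℝ _).sum_mem (fun j _ => mul_nonneg (by positivity) (h1 j)) ?_
        (fun j _ => subset_convexHull ℝ _ j.2)
      rw [← Finset.mul_sum, div_mul_eq_mul_div, ← h3, div_self hn.ne']
    obtain ⟨p, hp, hpe⟩ := hmem
    refine ⟨p, hp, ?_⟩
    have hpe : (q : ℝ) • p = ((q : ℝ) / n) • y := hpe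
    have h4 : y = (n / q) • ((q : ℝ) • p) := by
      rw [hpe, smul_smul, div_mul_div_cancel₀ hq'.ne', div_self hn.ne', one_smul]
    show n • p = y
    rw [h4, smul_smul, div_mul_cancel₀ _ hq'.ne']

theorem latCount_eq {d : ℕ} (S : Set (Fin d → ℝ)) :
    latCount S = Set.ncard {u : Fin d → ℤ | (fun i => (u i : ℝ)) ∈ S} := by
  have hinj : Function.Injective (fun (u : Fin d → ℤ) (i : Fin d) => (u i : ℝ)) := by
    intro u u' h
    ext i
    have : (u i : ℝ) = (u' i : ℝ) := congrFun h i
    exact_mod_cast this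
  rw [← Set.ncard_image_of_injective _ hinj, latCount]
  congr 1
  ext y
  constructor
  · rintro ⟨h1, h2⟩
    choose a ha using h2
    refine ⟨a, ?_, (funext ha).symm⟩
    show (fun i => (a i : ℝ)) ∈ S
    rwa [← funext ha]
  · rintro ⟨u, h, rfl⟩
    exact ⟨h, fun i => ⟨u i, rfl⟩⟩

theorem core_poly {d q l : ℕ} (P : Set (Fin d → ℝ))
    (hrat : IsRationalPolytope P)
    (hq : IsDenominator P q) (hl : IsMinInteriorDilate P l) :
    ∃ a b : ℕ → ℤ, (1 - PowerSeries.X ^ q) ^ d * ((1 - PowerSeries.X ^ l) * ehrSeries P) =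
        PowerSeries.mk a + PowerSeries.mk b ∧
      (∀ n, 0 ≤ a n) ∧ (∀ n, 0 ≤ b n) ∧ (∀ n, q * d < n → a n = 0) ∧
      (∀ n, n ≤ q * d → a n = a (q * d - n)) ∧
      (∀ n, n < l → b n = 0) ∧ (∀ n, q * d < n → b n = 0) ∧
      (∀ n, n ≤ q * d + l → b n = b (q * d + l - n)) := by
  obtain ⟨hq0, ⟨V, hVlat, hV⟩, -⟩ := hq
  obtain ⟨hl0, ⟨xr, hxlat, hxint⟩, hlmin⟩ := hl
  have hconvP : Convex ℝ P := by
    obtain ⟨W, -, hW⟩ := hrat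
    rw [hW]; exact convex_convexHull ℝ _
  have hq' : (0 : ℝ) < q := by exact_mod_cast hq0
  have hl' : (0 : ℝ) < l := by exact_mod_cast hl0
  choose x hx using hxlat
  choose v hv using fun j : V => hVlat j j.2
  have hvv : ∀ j : V, (j : Fin d → ℝ) = fun i => (v j i : ℝ) := fun j => funext (hv j)
  have hxx : xr = fun i => (x i : ℝ) := funext hx
  have hxP : xr ∈ (l : ℝ) • interior P := by
    rwa [interior_smul₀ hl'.ne'] at hxint
  obtain ⟨p', hp', hp'e⟩ := hxP
  have hp'e : (l : ℝ) • p' = xr := hp'e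
  have hpos : ∀ z : Fin d → ℝ, ∃ μ : V → ℝ, (∀ j, 0 ≤ μ j) ∧ ∑ j, μ j • zz l x (v j) q = z := by
    intro z
    have hc : Filter.Tendsto (fun δ : ℝ => p' + δ • z) (nhdsWithin 0 (Set.Ioi 0))
        (nhds (p' + (0 : ℝ) • z)) := by
      apply Filter.Tendsto.mono_left _ nhdsWithin_le_nhds
      apply Continuous.tendsto; fun_prop
    rw [zero_smul, add_zero] at hc
    obtain ⟨δ, h1, h2⟩ := ((hc.eventually (isOpen_interior.mem_nhds hp')).and
      (self_mem_nhdsWithin (a := (0:ℝ)) (s := Set.Ioi 0))).exists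
    have h2 : 0 < δ := h2
    have h3 : (q : ℝ) • (p' + δ • z) ∈ (q : ℝ) • P := Set.smul_mem_smul_set (interior_subset h1)
    rw [mem_dilate hq0 P V hV q hq'] at h3
    obtain ⟨μ, m1, m2, m3⟩ := h3
    have m3' : ∑ j, μ j = 1 := by
      have : (q : ℝ) * 1 = q * ∑ j, μ j := by rw [mul_one]; exact m3
      exact (mul_left_cancel₀ hq'.ne' this).symm
    refine ⟨fun j => μ j / (q * δ), fun j => div_nonneg (m1 j) (by positivity), ?_⟩
    ext i
    have m2i := congrFun m2 i
    simp only [Finset.sum_apply, Pi.smul_apply, smul_eq_mul, Pi.add_apply, hv] at m2i ⊢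
    have hpi : (l : ℝ) * p' i = x i := by rw [← hx, ← hp'e]; rfl
    have hzi : ∀ j, μ j / (q * δ) * zz l x (v j) q i =
        (μ j * v j i - μ j * (q * p' i)) / (q * δ) := by
      intro j
      simp only [zz, ← hpi]
      push_cast
      field_simp
    simp only [hzi]
    rw [← Finset.sum_div, Finset.sum_sub_distrib, ← Finset.sum_mul, m3', ← m2i]
    field_simp
    ring
  obtain ⟨K, _, e, B, g, hB, hle, hg, hfan⟩ := fan_exists (fun j : V => zz l x (v j) q) hpos
  have hxl : xr ∈ (l : ℝ) • P := interior_subset hxint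
  rw [mem_dilate hq0 P V hV l hl'] at hxl
  obtain ⟨ν, n1, n2, n3⟩ := hxl
  refine core_aux hl0 hq0 x v e B g hB hle hg hfan ?_ ν n1 ?_ n3 (ehrSeries P) ?_
  · intro u n μ t hμ ht hu hn
    set s := (q : ℝ) * ∑ j, μ j with hs
    have hs0 : 0 ≤ ∑ j, μ j := Finset.sum_nonneg fun j _ => hμ j
    have hs1 : 0 ≤ s := by positivity
    have hn0 : (0 : ℝ) < n := by rw [hn]; positivity
    have hn0' : 0 < n := by exact_mod_cast hn0
    obtain ⟨k, rfl⟩ := Int.eq_ofNat_of_zero_le hn0'.le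
    have hk0 : 0 < k := by exact_mod_cast hn0'
    suffices h : l ≤ k by exact_mod_cast h
    have hn' : (k : ℝ) = s + l * t := by exact_mod_cast hn
    have hkr : (0 : ℝ) < k := by exact_mod_cast hk0
    apply hlmin k hk0
    refine ⟨fun i => (u i : ℝ), fun i => ⟨u i, rfl⟩, ?_⟩
    rw [interior_smul₀ hkr.ne']
    obtain ⟨p, hp, hpe⟩ : ∃ p ∈ P, s • p = ∑ j, μ j • (j : Fin d → ℝ) := by
      rcases hs1.eq_or_lt with h0 | h0
      · refine ⟨p', interior_subset hp', ?_⟩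
        have h00 : ∑ j, μ j = 0 := by
          rcases mul_eq_zero.1 (hs ▸ h0.symm) with h | h
          · exact absurd h hq'.ne'
          · exact h
        have := (Finset.sum_eq_zero_iff_of_nonneg fun j _ => hμ j).1 h00
        rw [← h0, zero_smul]
        symm
        refine Finset.sum_eq_zero fun j hj => ?_
        rw [this j hj, zero_smul]
      · have := (mem_dilate hq0 P V hV s h0 (∑ j, μ j • (j : Fin d → ℝ))).2 ⟨μ, hμ, rfl, hs⟩
        obtain ⟨p, hp, h⟩ := this
        exact ⟨p, hp, h⟩
    refine ⟨(s / k) • p + (l * t / k) • p', ?_, ?_⟩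
    · refine hconvP.combo_self_interior_mem_interior hp hp' (by positivity) (by positivity) ?_
      rw [← add_div, ← hn', div_self hkr.ne']
    · show (k : ℝ) • ((s / k) • p + (l * t / k) • p') = _
      rw [smul_add, smul_smul, smul_smul, mul_div_cancel₀ _ hkr.ne', mul_div_cancel₀ _ hkr.ne', hpe,
        mul_comm (l : ℝ) t, mul_smul, hp'e]
      ext i
      simp [hu, hv, hx]
  · intro i
    rw [← hx, n2]
    simp [hv]
  · intro n
    simp only [ehrSeries, PowerSeries.coeff_mk]
    split_ifs with h0
    · subst h0
      have : {u : Fin d → ℤ | ∃ μ : V → ℝ, (∀ j, 0 ≤ μ j) ∧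
          (∀ i, (u i : ℝ) = ∑ j, μ j * v j i) ∧ ((0 : ℕ) : ℝ) = q * ∑ j, μ j} = {0} := by
        ext u
        simp only [Set.mem_setOf_eq, Set.mem_singleton_iff]
        constructor
        · rintro ⟨μ, h1, h2, h3⟩
          have h00 : ∑ j, μ j = 0 := by
            rw [Nat.cast_zero] at h3
            rcases mul_eq_zero.1 h3.symm with h | h
            · exact absurd h (by simpa using hq0.ne')
            · exact h
          have := (Finset.sum_eq_zero_iff_of_nonneg fun j _ => h1 j).1 h00
          ext i
          have h4 := h2 i
          rw [Finset.sum_eq_zero fun j hj => by rw [this j hj, zero_mul]] at h4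
          exact_mod_cast h4
        · rintro rfl
          exact ⟨0, by simp⟩
      rw [this]; simp
    · rw [latCount_eq]
      have hn : (0 : ℝ) < n := by positivity
      congr 2
      ext u
      simp only [Set.mem_setOf_eq]
      rw [mem_dilate hq0 P V hV n hn]
      refine exists_congr fun μ => and_congr_right fun _ => and_congr_left fun _ => ?_
      rw [funext_iff]
      simp [hv]

theorem coe_trunc_mk (f : ℕ → ℤ) (N : ℕ) (hf : ∀ n, N ≤ n → f n = 0) :
    ((PowerSeries.trunc N (PowerSeries.mk f) : Polynomial ℤ) : PowerSeries ℤ) = PowerSeries.mk f := by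
  ext n
  rw [Polynomial.coeff_coe, PowerSeries.coeff_trunc, PowerSeries.coeff_mk]
  split_ifs with h
  · rfl
  · exact (hf n (not_lt.1 h)).symm

/-- For a full-dimensional rational polytope `P ⊆ ℝ^d` with denominator `q`
and `l` minimal so that `(lP)°` contains a lattice point,
`((1+z+⋯+z^{l−1})/(1+z+⋯+z^{q−1})) h*_P(z) = a(z) + z^l b(z)` with `a, b` having
nonnegative integer coefficients, `z^{qd} a(1/z) = a(z)` and `z^{qd−l} b(1/z) = b(z)`. -/
theorem hstar_symmetric_decomposition {d q l : ℕ} (P : Set (Fin d → ℝ))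
    (hrat : IsRationalPolytope P) (hfull : IsFullDim P)
    (hq : IsDenominator P q) (hl : IsMinInteriorDilate P l)
    (hP : Polynomial ℤ) (hPdeg : hP.natDegree < q * (d + 1))
    (hPeq : (hP : PowerSeries ℤ) = (1 - PowerSeries.X ^ q) ^ (d + 1) * ehrSeries P) :
    ∃ a b : Polynomial ℤ,
      (∑ i ∈ Finset.range q, (Polynomial.X : Polynomial ℤ) ^ i) *
          (a + Polynomial.X ^ l * b) =
        (∑ i ∈ Finset.range l, (Polynomial.X : Polynomial ℤ) ^ i) * hP ∧
      (∀ i, 0 ≤ a.coeff i) ∧ (∀ i, 0 ≤ b.coeff i) ∧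
      a.natDegree ≤ q * d ∧ (∀ i ≤ q * d, a.coeff i = a.coeff (q * d - i)) ∧
      b.natDegree ≤ q * d - l ∧ (∀ i ≤ q * d - l, b.coeff i = b.coeff (q * d - l - i)) := by
  obtain ⟨a, b, hab, a1, b1, a2, a3, b2, b3, b4⟩ := core_poly P hrat hq hl
  have hac : ∀ n, (PowerSeries.trunc (q * d + 1) (PowerSeries.mk a)).coeff n = a n := by
    intro n
    rw [PowerSeries.coeff_trunc, PowerSeries.coeff_mk]
    split_ifs with h
    · rfl
    · exact (a2 n (by omega)).symm
  have hbz : ∀ n, q * d + 1 - l ≤ n → b (n + l) = 0 := fun n hn => b3 _ (by omega)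
  have hbc : ∀ n, (PowerSeries.trunc (q * d + 1 - l) (PowerSeries.mk fun n => b (n + l))).coeff n =
      b (n + l) := by
    intro n
    rw [PowerSeries.coeff_trunc, PowerSeries.coeff_mk]
    split_ifs with h
    · rfl
    · exact (hbz n (by omega)).symm
  refine ⟨PowerSeries.trunc (q * d + 1) (PowerSeries.mk a),
    PowerSeries.trunc (q * d + 1 - l) (PowerSeries.mk fun n => b (n + l)), ?_, ?_, ?_, ?_, ?_, ?_, ?_⟩
  · have h1X : (1 - Polynomial.X : Polynomial ℤ) ≠ 0 := by
      intro h
      have := congrArg (fun p => Polynomial.coeff p 0) h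
      simp at this
    apply mul_left_cancel₀ h1X
    rw [← mul_assoc, ← mul_assoc, mul_neg_geom_sum, mul_neg_geom_sum]
    rw [← Polynomial.coe_inj]
    push_cast
    rw [coe_trunc_mk a _ (fun n hn => a2 n (by omega)), coe_trunc_mk _ _ hbz, hPeq]
    have hbX : PowerSeries.X ^ l * (PowerSeries.mk fun n => b (n + l)) = PowerSeries.mk b := by
      ext n
      rw [PowerSeries.coeff_X_pow_mul']
      simp only [PowerSeries.coeff_mk]
      split_ifs with h
      · rw [Nat.sub_add_cancel h]
      · exact (b2 n (by omega)).symm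
    rw [hbX, ← hab]
    ring
  · intro i; rw [hac]; exact a1 i
  · intro i; rw [hbc]; exact b1 _
  · rw [Polynomial.natDegree_le_iff_coeff_eq_zero]
    intro n hn; rw [hac]; exact a2 n hn
  · intro i hi; rw [hac, hac]; exact a3 i hi
  · rw [Polynomial.natDegree_le_iff_coeff_eq_zero]
    intro n hn; rw [hbc]; exact b3 _ (by omega)
  · intro i hi
    rw [hbc, hbc]
    by_cases h : l ≤ q * d
    · rw [b4 (i + l) (by omega)]
      congr 1
      omega
    · have : i = 0 := by omega
      subst this
      congr 1
      omega
end

section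
/- Let P ⊂ ℝ^d be a full-dimensional rational polytope with denominator q and let ℓ be the smallest positive integer such that the interior of ℓP contains a lattice point. Then ((1+z+⋯+z^{ℓ−1})/(1+z+⋯+z^{q−1}))·h*_P(z) = h*_{∂P}(z) + z^ℓ·b_P(z), where b_P(z) is a polynomial with nonnegative integer coefficients satisfying z^{qd−ℓ}·b_P(1/z) = b_P(z). -/
open Pointwise

set_option linter.unusedSectionVars false

namespace HS

section geom

variable {E : Type*} [NormedAddCommGroup E] [NormedSpace ℝ E] [FiniteDimensional ℝ E]
variable {ι : Type*} [Fintype ι] [DecidableEq ι]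

/-- `σ` indexes a basis of `E` containing the distinguished vector. -/
def IsB (U : Option ι → E) (σ : Finset (Option ι)) : Prop :=
  none ∈ σ ∧ LinearIndepOn ℝ U (σ : Set (Option ι)) ∧
    Submodule.span ℝ (U '' (σ : Set (Option ι))) = ⊤

lemma exists_co (U : Option ι → E) {σ : Finset (Option ι)} (h : IsB U σ) :
    ∃ c : E →ₗ[ℝ] (Option ι → ℝ), (∀ y, ∑ v, c y v • U v = y) ∧
      (∀ y v, v ∉ σ → c y v = 0) ∧ ∀ v ∈ σ, c (U v) = Pi.single v 1 := by
  classical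
  obtain ⟨-, hli, hsp⟩ := h
  let b : Module.Basis (σ : Set (Option ι)) ℝ E := Module.Basis.mk (v := fun i : (σ : Set (Option ι)) => U i) hli
    (by rw [← hsp, Set.image_eq_range])
  let c : E →ₗ[ℝ] (Option ι → ℝ) :=
    LinearMap.pi fun v => if h : v ∈ (σ : Set (Option ι)) then b.coord ⟨v, h⟩ else 0
  have hc : ∀ y v, v ∉ σ → c y v = 0 := by
    intro y v hv
    simp [c, hv]
  have hc' : ∀ y (v : (σ : Set (Option ι))), c y v = b.repr y v := by
    intro y v
    have : (v : Option ι) ∈ σ := v.2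
    simp [c, this]
  refine ⟨c, ?_, hc, ?_⟩
  · intro y
    have h1 : ∑ v, c y v • U v = ∑ v ∈ σ, c y v • U v := by
      symm
      apply Finset.sum_subset (Finset.subset_univ _)
      intro v _ hv
      rw [hc y v hv, zero_smul]
    rw [h1, ← Finset.sum_coe_sort σ]
    conv_rhs => rw [← b.sum_repr y]
    apply Finset.sum_congr rfl
    intro v _
    rw [hc' y v]
    simp [b]
  · intro v hv
    ext w
    by_cases hw : w ∈ σ
    · have h1 := hc' (U v) ⟨w, hw⟩
      have h2 : U v = b ⟨v, hv⟩ := by simp [b]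
      rw [h2, b.repr_self] at h1
      rw [h2]
      rw [h1, Finsupp.single_apply, Pi.single_apply]
      simp only [Subtype.mk.injEq]
      congr 1
      exact propext eq_comm
    · rw [hc _ _ hw, Pi.single_apply, if_neg]
      rintro rfl
      exact hw hv

open Classical in
/-- coordinates with respect to the basis indexed by `σ`. -/
noncomputable def co (U : Option ι → E) (σ : Finset (Option ι)) : E →ₗ[ℝ] (Option ι → ℝ) :=
  if h : IsB U σ then (exists_co U h).choose else 0

lemma co_spec (U : Option ι → E) {σ : Finset (Option ι)} (h : IsB U σ) :
    (∀ y, ∑ v, co U σ y v • U v = y) ∧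
      (∀ y v, v ∉ σ → co U σ y v = 0) ∧ ∀ v ∈ σ, co U σ (U v) = Pi.single v 1 := by
  unfold co
  rw [dif_pos h]
  exact (exists_co U h).choose_spec

lemma co_sum (U : Option ι → E) {σ : Finset (Option ι)} (h : IsB U σ) (y : E) :
    y = co U σ y none • U none + ∑ v : ι, co U σ y (some v) • U (some v) := by
  conv_lhs => rw [← (co_spec U h).1 y]
  rw [Fintype.sum_option]

/-- the cone generated by the vectors `U (some v)`. -/
def coneC (U : Option ι → E) : Set E :=
  {y | ∃ a : ι → ℝ, (∀ v, 0 ≤ a v) ∧ y = ∑ v, a v • U (some v)}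

/-- functional determined by `σ` and a perturbation `η`. -/
noncomputable def Fn (U : Option ι → E) (η : ι → ℝ) (σ : Finset (Option ι)) (y : E) : ℝ :=
  co U σ y none - ∑ v, co U σ y (some v) * η v

noncomputable def FnL (U : Option ι → E) (η : ι → ℝ) (σ : Finset (Option ι)) : E →L[ℝ] ℝ :=
  LinearMap.toContinuousLinearMap
    { toFun := Fn U η σ
      map_add' := by
        intro a b; simp only [Fn, map_add, Pi.add_apply, add_mul, Finset.sum_add_distrib]; ring
      map_smul' := by
        intro a b
        simp only [Fn, map_smul, Pi.smul_apply, smul_eq_mul, mul_assoc, ← Finset.mul_sum,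
          RingHom.id_apply]; ring }

lemma FnL_apply (U : Option ι → E) (η : ι → ℝ) (σ : Finset (Option ι)) (y : E) :
    FnL U η σ y = Fn U η σ y := rfl

/-- dual polyhedron -/
def DD (U : Option ι → E) (η : ι → ℝ) : Set (E →L[ℝ] ℝ) :=
  {f | f (U none) = 1 ∧ ∀ v, -η v ≤ f (U (some v))}

/-- the simplices -/
def TT (U : Option ι → E) (η : ι → ℝ) : Set (Finset (Option ι)) :=
  {σ | IsB U σ ∧ ∀ v, -η v ≤ Fn U η σ (U (some v))}

lemma Fn_none (U : Option ι → E) (η : ι → ℝ) {σ : Finset (Option ι)} (h : IsB U σ) :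
    Fn U η σ (U none) = 1 := by
  simp [Fn, (co_spec U h).2.2 none h.1]

lemma Fn_some (U : Option ι → E) (η : ι → ℝ) {σ : Finset (Option ι)} (h : IsB U σ)
    {v : ι} (hv : some v ∈ σ) :
    Fn U η σ (U (some v)) = - η v := by
  simp [Fn, (co_spec U h).2.2 _ hv, Pi.single_apply]

lemma dense_ne {F : Type*} [NormedAddCommGroup F] [NormedSpace ℝ F] (a : ℝ) (L : F →L[ℝ] ℝ)
    (hL : L ≠ 0) : Dense {y : F | a + L y ≠ 0} := by
  obtain ⟨e, he⟩ : ∃ e, L e ≠ 0 := by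
    by_contra! h
    exact hL (ContinuousLinearMap.ext h)
  intro y
  by_cases hy : a + L y = 0
  · rw [mem_closure_iff_frequently]
    have ht : Filter.Tendsto (fun t : ℝ => y + t • e) (nhdsWithin 0 {0}ᶜ) (nhds y) := by
      have : Filter.Tendsto (fun t : ℝ => y + t • e) (nhds 0) (nhds (y + (0:ℝ) • e)) :=
        (by fun_prop : Continuous (fun t : ℝ => y + t • e)).tendsto 0
      rw [zero_smul, add_zero] at this
      exact this.mono_left nhdsWithin_le_nhds
    apply ht.frequently
    apply Filter.Eventually.frequently
    filter_upwards [self_mem_nhdsWithin] with t ht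
    have ht' : t ≠ 0 := ht
    simp only [map_add, map_smul, smul_eq_mul]
    rw [← add_assoc, hy, zero_add]
    exact mul_ne_zero ht' he
  · exact subset_closure hy

lemma dense_all_ne {F : Type*} [NormedAddCommGroup F] [NormedSpace ℝ F] [FiniteDimensional ℝ F]
    {κ : Type*} [Finite κ] (a : κ → ℝ) (L : κ → F →L[ℝ] ℝ)
    (hL : ∀ k, L k ≠ 0) : Dense {y : F | ∀ k, a k + L k y ≠ 0} := by
  have : CompleteSpace F := FiniteDimensional.complete ℝ F
  have := dense_iInter_of_isOpen (f := fun k => {y : F | a k + L k y ≠ 0})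
    (fun k => isOpen_ne_fun (by fun_prop) (by fun_prop)) (fun k => dense_ne _ _ (hL k))
  convert this using 1
  ext; simp

structure Good (U : Option ι → E) (η : ι → ℝ) : Prop where
  ne : ∀ σ, IsB U σ → ∀ v, some v ∉ σ → Fn U η σ (U (some v)) ≠ - η v
  nonneg : ∀ σ, IsB U σ → ∀ v, -η v ≤ Fn U η σ (U (some v)) → 0 ≤ co U σ (U (some v)) none

lemma exists_good (U : Option ι → E) (r : ι → ℝ) (hr : ∀ v, 0 < r v) :
    ∃ η : ι → ℝ, Good U η ∧ ∀ v, - η v ≤ r v := by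
  let κ := {p : Finset (Option ι) × ι // IsB U p.1 ∧ some p.2 ∉ p.1}
  let L : κ → (ι → ℝ) →L[ℝ] ℝ := fun p => ContinuousLinearMap.proj p.1.2 -
    ∑ w, co U p.1.1 (U (some p.1.2)) (some w) • ContinuousLinearMap.proj w
  have hLa : ∀ (p : κ) η, L p η = η p.1.2 - ∑ w, co U p.1.1 (U (some p.1.2)) (some w) * η w := by
    intro p η
    simp [L]
  have hd := dense_all_ne (fun p : κ => co U p.1.1 (U (some p.1.2)) none) L (by
    intro p h0
    have h1 := hLa p (Pi.single p.1.2 1)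
    rw [h0] at h1
    have h2 := (co_spec U p.2.1).2.1 (U (some p.1.2)) _ p.2.2
    simp [Pi.single_apply, h2] at h1)
  have hFc : ∀ σ y, Continuous fun η : ι → ℝ => Fn U η σ y := by
    intro σ y; unfold Fn; fun_prop
  have ho : {η : ι → ℝ | (∀ v, - η v < r v) ∧ ∀ (σ : Finset (Option ι)) (v : ι),
      co U σ (U (some v)) none < 0 → Fn U η σ (U (some v)) < - η v} ∈ nhds (0 : ι → ℝ) := by
    refine Filter.inter_mem ?_ ?_
    · change ∀ᶠ η in nhds (0 : ι → ℝ), ∀ v, - η v < r v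
      rw [Filter.eventually_all]
      intro v
      exact (isOpen_lt (f := fun η : ι → ℝ => - η v) (by fun_prop) continuous_const).mem_nhds (by simpa using hr v)
    · change ∀ᶠ η in nhds (0 : ι → ℝ), ∀ (σ : Finset (Option ι)) (v : ι),
        co U σ (U (some v)) none < 0 → Fn U η σ (U (some v)) < - η v
      rw [Filter.eventually_all]
      intro σ
      rw [Filter.eventually_all]
      intro v
      rw [Filter.eventually_imp_distrib_left]
      intro h
      exact (isOpen_lt (hFc σ _) (g := fun η : ι → ℝ => - η v) (by fun_prop)).mem_nhds (by simpa [Fn] using h)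
  obtain ⟨η, h1, h2, h3⟩ := hd.inter_nhds_nonempty ho
  refine ⟨η, ⟨?_, ?_⟩, fun v => (h2 v).le⟩
  · intro σ hσ v hv h
    apply h1 ⟨(σ, v), hσ, hv⟩
    rw [hLa]
    simp only [Fn] at h ⊢
    linarith
  · intro σ hσ v h
    by_contra! hc
    exact absurd (h3 σ v hc) (not_lt.mpr h)

lemma exists_xi (U : Option ι → E) :
    ∃ ξ : E, ∀ σ, IsB U σ → ∀ v, some v ∈ σ → co U σ ξ (some v) ≠ 0 := by
  let κ := {p : Finset (Option ι) × ι // IsB U p.1 ∧ some p.2 ∈ p.1}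
  let L : κ → E →L[ℝ] ℝ := fun p => LinearMap.toContinuousLinearMap
    ((LinearMap.proj (some p.1.2)).comp (co U p.1.1))
  have hd := dense_all_ne (fun p : κ => 0) L (by
    intro p h0
    have h1 : L p (U (some p.1.2)) = co U p.1.1 (U (some p.1.2)) (some p.1.2) := rfl
    rw [h0, (co_spec U p.2.1).2.2 _ p.2.2] at h1
    simp at h1)
  obtain ⟨ξ, hξ⟩ := hd.nonempty
  refine ⟨ξ, fun σ hσ v hv h => hξ ⟨(σ, v), hσ, hv⟩ ?_⟩
  change 0 + co U σ ξ (some v) = 0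
  rw [h, zero_add]

lemma exists_delta {S : Set E} {x : E} (hx : x ∈ interior S) (y : E) :
    ∃ δ : ℝ, 0 < δ ∧ x + δ • y ∈ S := by
  have h1 : Filter.Tendsto (fun t : ℝ => x + t • y) (nhds 0) (nhds (x + (0:ℝ) • y)) :=
    (by fun_prop : Continuous (fun t : ℝ => x + t • y)).tendsto 0
  rw [zero_smul, add_zero] at h1
  have h2 := h1.eventually (mem_interior_iff_mem_nhds.mp hx)
  obtain ⟨δ, h3, h4⟩ := ((h2.filter_mono nhdsWithin_le_nhds).and
    (self_mem_nhdsWithin (s := Set.Ioi (0:ℝ)))).exists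
  exact ⟨δ, h4, h3⟩

lemma DD_compact (U : Option ι → E) (η : ι → ℝ) (hx : U none ∈ interior (coneC U)) :
    IsCompact (DD U η) := by
  have : CompleteSpace E := FiniteDimensional.complete ℝ E
  have hlow : ∀ y ∈ coneC U, ∃ M : ℝ, ∀ f ∈ DD U η, M ≤ f y := by
    rintro y ⟨a, ha, rfl⟩
    refine ⟨∑ v, a v * (-η v), fun f hf => ?_⟩
    rw [map_sum]
    apply Finset.sum_le_sum
    intro v _
    rw [map_smul, smul_eq_mul]
    exact mul_le_mul_of_nonneg_left (hf.2 v) (ha v)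
  have hdir := fun y => exists_delta hx y
  have hlow' : ∀ y : E, ∃ M : ℝ, ∀ f ∈ DD U η, M ≤ f y := by
    intro y
    obtain ⟨δ, hδ, h1⟩ := hdir y
    obtain ⟨M, hM⟩ := hlow _ h1
    refine ⟨(M - 1) / δ, fun f hf => ?_⟩
    have := hM f hf
    rw [map_add, hf.1, map_smul, smul_eq_mul] at this
    rw [div_le_iff₀ hδ]
    linarith
  have hbd : ∃ C', ∀ f : DD U η, ‖(f : E →L[ℝ] ℝ)‖ ≤ C' := by
    apply banach_steinhaus
    intro y
    obtain ⟨M, hM⟩ := hlow' y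
    obtain ⟨N, hN⟩ := hlow' (-y)
    refine ⟨max (-M) (-N), fun f => ?_⟩
    have h1 := hM f f.2
    have h2 := hN f f.2
    rw [map_neg] at h2
    rw [Real.norm_eq_abs, abs_le]
    constructor
    · have := le_max_left (-M) (-N); linarith
    · have := le_max_right (-M) (-N); linarith
  apply Metric.isCompact_of_isClosed_isBounded
  · have : DD U η = {f | f (U none) = 1} ∩ ⋂ v, {f | -η v ≤ f (U (some v))} := by
      ext f; simp [DD]
    rw [this]
    refine (isClosed_eq (by fun_prop) (by fun_prop)).inter (isClosed_iInter fun v => ?_)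
    exact isClosed_le (by fun_prop) (by fun_prop)
  · obtain ⟨C', h⟩ := hbd
    rw [isBounded_iff_forall_norm_le]
    exact ⟨C', fun f hf => h ⟨f, hf⟩⟩

lemma ev_le {a b : ℝ} (h : 0 < a) (k : ℝ) (hb : b = k) :
    ∀ᶠ t in nhdsWithin (0:ℝ) (Set.Ioi 0), 0 < a + t * b := by
  have h1 : Filter.Tendsto (fun t : ℝ => a + t * b) (nhds 0) (nhds (a + 0 * b)) :=
    (by fun_prop : Continuous (fun t : ℝ => a + t * b)).tendsto 0
  rw [zero_mul, add_zero] at h1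
  exact (h1.eventually (lt_mem_nhds h)).filter_mono nhdsWithin_le_nhds

/-- small moves along directions that do not violate the tight constraints stay in `DD`. -/
lemma ev_DD (U : Option ι → E) (η : ι → ℝ) {f k : E →L[ℝ] ℝ} (hf : f ∈ DD U η)
    (hk : k (U none) = 0) (hk' : ∀ v, f (U (some v)) = - η v → 0 ≤ k (U (some v))) :
    ∀ᶠ t in nhdsWithin (0:ℝ) (Set.Ioi 0), f + t • k ∈ DD U η := by
  have h : ∀ᶠ t in nhdsWithin (0:ℝ) (Set.Ioi 0), ∀ v, - η v ≤ (f + t • k) (U (some v)) := by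
    rw [Filter.eventually_all]
    intro v
    rcases (hf.2 v).lt_or_eq with h | h
    · filter_upwards [ev_le (sub_pos.mpr h) _ (rfl : k (U (some v)) = _)] with t ht
      simp only [_root_.add_apply, _root_.smul_apply, smul_eq_mul]
      linarith
    · filter_upwards [self_mem_nhdsWithin] with t ht
      simp only [_root_.add_apply, _root_.smul_apply, smul_eq_mul]
      have := mul_nonneg (le_of_lt (show (0:ℝ) < t from ht)) (hk' v h.symm)
      linarith
  filter_upwards [h] with t ht
  refine ⟨?_, ht⟩
  simp [hk, hf.1]

lemma cover (U : Option ι → E) (η : ι → ℝ) (hg : Good U η)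
    (hx : U none ∈ interior (coneC U)) (hx0 : U none ≠ 0) (hne : (DD U η).Nonempty) (w : E) :
    ∃ σ ∈ TT U η, ∀ v, 0 ≤ co U σ w (some v) := by
  classical
  have hcomp := DD_compact U η hx
  obtain ⟨f₀, hf₀, hmin⟩ := hcomp.exists_isMinOn hne (f := fun f => f w) (by fun_prop)
  set Fa : Set (E →L[ℝ] ℝ) := DD U η ∩ {f | f w = f₀ w} with hFa
  have hFc : IsCompact Fa := hcomp.inter_right (isClosed_eq (by fun_prop) (by fun_prop))
  obtain ⟨f, hf⟩ := hFc.extremePoints_nonempty ⟨f₀, hf₀, rfl⟩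
  rw [mem_extremePoints] at hf
  obtain ⟨⟨hfD, hfw⟩, hext⟩ := hf
  have hfw' : f w = f₀ w := hfw
  have hfmin : ∀ g ∈ DD U η, f w ≤ g w := by
    intro g hg
    rw [hfw']
    exact hmin hg
  -- tight constraints
  let τ : Set (Option ι) := {j | ∀ v, j = some v → f (U (some v)) = - η v}
  have hspan : Submodule.span ℝ (U '' τ) = ⊤ := by
    by_contra hns
    obtain ⟨k₀, hk₀, hker⟩ := Submodule.exists_le_ker_of_lt_top _ (lt_top_iff_ne_top.mpr hns)
    let k : E →L[ℝ] ℝ := LinearMap.toContinuousLinearMap k₀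
    have hkv : ∀ y, k y = k₀ y := fun y => rfl
    have hkτ : ∀ j ∈ τ, k (U j) = 0 := fun j hj =>
      hker (Submodule.subset_span ⟨j, hj, rfl⟩)
    have hkn : k (U none) = 0 := hkτ none (by intro v hv; cases hv)
    have hks : ∀ v, f (U (some v)) = - η v → k (U (some v)) = 0 := fun v hv =>
      hkτ (some v) (by intro w hw; cases hw; exact hv)
    have e1 := ev_DD U η hfD hkn (fun v hv => (hks v hv).ge)
    have e2 := ev_DD U η (k := -k) hfD (by simp [hkn]) (fun v hv => by simp [hks v hv])
    obtain ⟨t, ⟨h1, h2⟩, ht⟩ := ((e1.and e2).and (self_mem_nhdsWithin (s := Set.Ioi (0:ℝ)))).exists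
    have ht' : (0:ℝ) < t := ht
    have hkw : k w = 0 := by
      have a1 := hfmin _ h1
      have a2 := hfmin _ h2
      simp only [_root_.add_apply, _root_.smul_apply, smul_eq_mul,
        _root_.neg_apply] at a1 a2
      have : t * k w = 0 := by linarith
      rcases mul_eq_zero.mp this with h | h
      · exact absurd h ht'.ne'
      · exact h
    have h3 := hext (f + t • k) ⟨h1, by simp [hkw, hfw']⟩ (f + t • (-k)) ⟨h2, by simp [hkw, hfw']⟩
      ⟨1/2, 1/2, by norm_num, by norm_num, by norm_num, by ext y; simp; ring⟩
    have h4 : t • k = 0 := by simpa using h3.1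
    rcases smul_eq_zero.mp h4 with h | h
    · exact absurd h ht'.ne'
    · apply hk₀
      ext y
      have := congrArg (fun g : E →L[ℝ] ℝ => g y) h
      simpa [hkv] using this
  have hli0 : LinearIndepOn ℝ U {(none : Option ι)} := by
    rw [linearIndepOn_singleton_iff]; exact hx0
  obtain ⟨b, hbτ, hnb, hspb, hlib⟩ := exists_linearIndepOn_extension (t := τ) hli0 (by
    intro j hj; rw [Set.mem_singleton_iff] at hj; subst hj; intro v hv; cases hv)
  let σ : Finset (Option ι) := b.toFinset
  have hσb : (σ : Set (Option ι)) = b := by simp [σ]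
  have hB : IsB U σ := by
    refine ⟨?_, ?_, ?_⟩
    · simpa [σ] using hnb
    · rw [hσb]; exact hlib
    · rw [hσb, eq_top_iff, ← hspan, Submodule.span_le]; exact hspb
  have hfσ : ∀ v, some v ∈ σ → f (U (some v)) = - η v := by
    intro v hv
    have : some v ∈ b := by rw [← hσb]; exact hv
    exact hbτ this v rfl
  have hfF : ∀ y, f y = Fn U η σ y := by
    intro y
    conv_lhs => rw [co_sum U hB y]
    rw [map_add, map_smul, hfD.1, map_sum, Fn, sub_eq_add_neg, smul_eq_mul, mul_one,
      ← Finset.sum_neg_distrib]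
    congr 1
    apply Finset.sum_congr rfl
    intro v _
    rw [map_smul, smul_eq_mul]
    by_cases hv : some v ∈ σ
    · rw [hfσ v hv]; ring
    · rw [(co_spec U hB).2.1 _ _ hv]; ring
  refine ⟨σ, ⟨hB, fun v => by rw [← hfF]; exact hfD.2 v⟩, ?_⟩
  intro v
  by_contra! hneg
  have hvσ : some v ∈ σ := by
    by_contra h
    rw [(co_spec U hB).2.1 _ _ h] at hneg
    exact lt_irrefl _ hneg
  let k : E →L[ℝ] ℝ := LinearMap.toContinuousLinearMap
    ((LinearMap.proj (some v)).comp (co U σ))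
  have hk : ∀ y, k y = co U σ y (some v) := fun y => rfl
  have e1 := ev_DD U η (k := k) hfD (by rw [hk, (co_spec U hB).2.2 _ hB.1]; simp) (by
    intro v' hv'
    have hv'σ : some v' ∈ σ := by
      by_contra h
      exact hg.ne σ hB v' h (by rw [← hfF]; exact hv')
    rw [hk, (co_spec U hB).2.2 _ hv'σ, Pi.single_apply]
    split_ifs <;> norm_num)
  obtain ⟨t, h1, ht⟩ := (e1.and (self_mem_nhdsWithin (s := Set.Ioi (0:ℝ)))).exists
  have a1 := hfmin _ h1
  simp only [_root_.add_apply, _root_.smul_apply, smul_eq_mul, hk] at a1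
  have := mul_neg_of_pos_of_neg (show (0:ℝ) < t from ht) hneg
  linarith

lemma Fn_eval (U : Option ι → E) (η : ι → ℝ) {σ τ : Finset (Option ι)} (hσ : IsB U σ) (hτ : IsB U τ)
    (w : E) : Fn U η τ w = Fn U η σ w +
      ∑ v, co U σ w (some v) * (Fn U η τ (U (some v)) + η v) := by
  rw [← FnL_apply U η τ w]
  conv_lhs => rw [co_sum U hσ w]
  rw [map_add, map_smul, map_sum, FnL_apply, Fn_none U η hτ]
  simp only [map_smul, smul_eq_mul, FnL_apply, mul_add, Finset.sum_add_distrib]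
  rw [Fn]
  ring

lemma uniq_aux (U : Option ι → E) (η : ι → ℝ) (hg : Good U η) {σ τ : Finset (Option ι)}
    (hσ : σ ∈ TT U η) (hτ : τ ∈ TT U η) (w : E)
    (h1 : ∀ v, some v ∈ σ → 0 < co U σ w (some v))
    (h2 : ∀ v, some v ∈ τ → 0 < co U τ w (some v)) : σ ⊆ τ := by
  have nn : ∀ {σ τ : Finset (Option ι)}, σ ∈ TT U η → τ ∈ TT U η →
      (∀ v, some v ∈ σ → 0 < co U σ w (some v)) → ∀ v ∈ Finset.univ,
      0 ≤ co U σ w (some v) * (Fn U η τ (U (some v)) + η v) := by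
    intro σ τ hσ hτ h v _
    apply mul_nonneg
    · by_cases hv : some v ∈ σ
      · exact (h v hv).le
      · rw [(co_spec U hσ.1).2.1 _ _ hv]
    · have := hτ.2 v; linarith
  have e1 := Fn_eval U η hσ.1 hτ.1 w
  have e2 := Fn_eval U η hτ.1 hσ.1 w
  have n1 := nn hσ hτ h1
  have n2 := Finset.sum_nonneg (nn hτ hσ h2)
  have n1' := Finset.sum_nonneg n1
  have z : ∑ v, co U σ w (some v) * (Fn U η τ (U (some v)) + η v) = 0 := by linarith
  rw [Finset.sum_eq_zero_iff_of_nonneg n1] at z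
  intro j hj
  cases j with
  | none => exact hτ.1.1
  | some v =>
    by_contra hv
    have z1 := z v (Finset.mem_univ _)
    rcases mul_eq_zero.mp z1 with h | h
    · exact (h1 v hj).ne' h
    · exact hg.ne τ hτ.1 v hv (by linarith)

/-- half-open condition -/
def cond (r c : ℝ) : Prop := 0 < c ∨ (c = 0 ∧ 0 < r)

def HO (U : Option ι → E) (ξ : E) (σ : Finset (Option ι)) (w : E) : Prop :=
  ∀ v, some v ∈ σ → cond (co U σ ξ (some v)) (co U σ w (some v))

lemma cond_nonneg {r c : ℝ} (h : cond r c) : 0 ≤ c := by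
  rcases h with h | h
  · exact h.le
  · exact h.1.ge

lemma ev_cond (r c : ℝ) (hr : r ≠ 0) :
    ∀ᶠ t in nhdsWithin (0:ℝ) (Set.Ioi 0), (0 ≤ c + t * r → cond r c) ∧ (cond r c → 0 < c + t * r) := by
  rcases lt_trichotomy c 0 with h | h | h
  · filter_upwards [ev_le (neg_pos.mpr h) _ (rfl : -r = _)] with t ht
    refine ⟨fun h' => by nlinarith, fun h' => ?_⟩
    have := cond_nonneg h'
    linarith
  · subst h
    filter_upwards [self_mem_nhdsWithin] with t ht
    have ht' : (0:ℝ) < t := ht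
    constructor
    · intro h
      right
      refine ⟨rfl, ?_⟩
      rw [zero_add] at h
      exact lt_of_le_of_ne (nonneg_of_mul_nonneg_right h ht') hr.symm
    · rintro (h | h)
      · exact absurd h (lt_irrefl _)
      · rw [zero_add]; exact mul_pos ht' h.2
  · filter_upwards [ev_le h _ (rfl : r = _)] with t ht
    exact ⟨fun _ => Or.inl h, fun _ => ht⟩

lemma existsUnique_HO (U : Option ι → E) (η : ι → ℝ) (hg : Good U η)
    (hx : U none ∈ interior (coneC U)) (hx0 : U none ≠ 0) (hne : (DD U η).Nonempty)
    (ξ : E) (hξ : ∀ σ, IsB U σ → ∀ v, some v ∈ σ → co U σ ξ (some v) ≠ 0) (w : E) :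
    (∃ σ ∈ TT U η, HO U ξ σ w) ∧
      ∀ σ ∈ TT U η, ∀ τ ∈ TT U η, HO U ξ σ w → HO U ξ τ w → σ = τ := by
  have ev : ∀ᶠ t in nhdsWithin (0:ℝ) (Set.Ioi 0), ∀ (σ : Finset (Option ι)) (v : ι), IsB U σ → some v ∈ σ →
      (0 ≤ co U σ (w + t • ξ) (some v) → cond (co U σ ξ (some v)) (co U σ w (some v))) ∧
      (cond (co U σ ξ (some v)) (co U σ w (some v)) → 0 < co U σ (w + t • ξ) (some v)) := by
    rw [Filter.eventually_all]
    intro σ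
    rw [Filter.eventually_all]
    intro v
    rw [Filter.eventually_imp_distrib_left]
    intro hσ
    rw [Filter.eventually_imp_distrib_left]
    intro hv
    filter_upwards [ev_cond _ (co U σ w (some v)) (hξ σ hσ v hv)] with t ht
    simpa only [map_add, map_smul, Pi.add_apply, Pi.smul_apply, smul_eq_mul] using ht
  obtain ⟨t, ht⟩ := ev.exists
  constructor
  · obtain ⟨σ, hσ, h⟩ := cover U η hg hx hx0 hne (w + t • ξ)
    exact ⟨σ, hσ, fun v hv => (ht σ v hσ.1 hv).1 (h v)⟩
  · intro σ hσ τ hτ h1 h2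
    apply Finset.Subset.antisymm
    · exact uniq_aux U η hg hσ hτ (w + t • ξ) (fun v hv => (ht σ v hσ.1 hv).2 (h1 v hv))
        (fun v hv => (ht τ v hτ.1 hv).2 (h2 v hv))
    · exact uniq_aux U η hg hτ hσ (w + t • ξ) (fun v hv => (ht τ v hτ.1 hv).2 (h2 v hv))
        (fun v hv => (ht σ v hσ.1 hv).2 (h1 v hv))

lemma cone_add (U : Option ι → E) {y z : E} (hy : y ∈ coneC U) (hz : z ∈ coneC U) :
    y + z ∈ coneC U := by
  obtain ⟨a, ha, rfl⟩ := hy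
  obtain ⟨b, hb, rfl⟩ := hz
  exact ⟨fun v => a v + b v, fun v => add_nonneg (ha v) (hb v), by
    simp [add_smul, Finset.sum_add_distrib]⟩

lemma cone_smul (U : Option ι → E) {y : E} (hy : y ∈ coneC U) {c : ℝ} (hc : 0 ≤ c) :
    c • y ∈ coneC U := by
  obtain ⟨a, ha, rfl⟩ := hy
  exact ⟨fun v => c * a v, fun v => mul_nonneg hc (ha v), by
    simp [mul_smul, Finset.smul_sum]⟩

lemma cone_add_int (U : Option ι → E) {y z : E} (hy : y ∈ coneC U) (hz : z ∈ interior (coneC U))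
    {c : ℝ} (hc : 0 < c) : y + c • z ∈ interior (coneC U) := by
  have hopen : IsOpen ((fun w => y + c • w) '' interior (coneC U)) := by
    have := (Homeomorph.addLeft y).isOpenMap.comp (Homeomorph.smulOfNeZero c hc.ne').isOpenMap
    exact this _ isOpen_interior
  refine interior_maximal ?_ hopen ⟨z, hz, rfl⟩
  rintro _ ⟨w, hw, rfl⟩
  exact cone_add U hy (cone_smul U (interior_subset hw) hc.le)

lemma co_none_nonneg (U : Option ι → E) (η : ι → ℝ) (hg : Good U η) {σ : Finset (Option ι)}
    (hσ : σ ∈ TT U η) {y : E} (hy : y ∈ coneC U) : 0 ≤ co U σ y none := by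
  obtain ⟨a, ha, rfl⟩ := hy
  rw [map_sum, Finset.sum_apply]
  apply Finset.sum_nonneg
  intro v _
  rw [map_smul, Pi.smul_apply, smul_eq_mul]
  exact mul_nonneg (ha v) (hg.nonneg σ hσ.1 v (hσ.2 v))

lemma HO_some_nonneg (U : Option ι → E) {ξ : E} {σ : Finset (Option ι)} (hσ : IsB U σ) {y : E}
    (h : HO U ξ σ y) (v : ι) : 0 ≤ co U σ y (some v) := by
  by_cases hv : some v ∈ σ
  · exact cond_nonneg (h v hv)
  · rw [(co_spec U hσ).2.1 _ _ hv]

lemma HO_int_iff (U : Option ι → E) (η : ι → ℝ) (hg : Good U η)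
    (hx : U none ∈ interior (coneC U)) {σ : Finset (Option ι)}
    (hσ : σ ∈ TT U η) {ξ y : E} (h : HO U ξ σ y) :
    y ∈ interior (coneC U) ↔ 0 < co U σ y none := by
  constructor
  · intro hy
    obtain ⟨δ, hδ, h1⟩ := exists_delta hy (-U none)
    have := co_none_nonneg U η hg hσ h1
    rw [map_add, map_smul, map_neg, (co_spec U hσ.1).2.2 _ hσ.1.1] at this
    simp at this
    linarith
  · intro hc
    rw [co_sum U hσ.1 y, add_comm]
    exact cone_add_int U ⟨_, HO_some_nonneg U hσ.1 h, rfl⟩ hx hc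

lemma HO_sub_iff (U : Option ι → E) (η : ι → ℝ) (hg : Good U η)
    (hx : U none ∈ interior (coneC U)) {σ : Finset (Option ι)}
    (hσ : σ ∈ TT U η) {ξ y : E} (h : HO U ξ σ y) :
    y - U none ∈ coneC U ↔ 1 ≤ co U σ y none := by
  constructor
  · intro hy
    have := co_none_nonneg U η hg hσ hy
    rw [map_sub, (co_spec U hσ.1).2.2 _ hσ.1.1] at this
    simpa using this
  · intro hc
    have : y - U none = (∑ v, co U σ y (some v) • U (some v)) + (co U σ y none - 1) • U none := by
      conv_lhs => rw [co_sum U hσ.1 y]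
      rw [sub_smul, one_smul]; abel
    rw [this]
    exact cone_add U ⟨_, HO_some_nonneg U hσ.1 h, rfl⟩
      (cone_smul U (interior_subset hx) (by linarith))

/-- generating function of a set graded by `ht` -/
noncomputable def gf (ht : E →ₗ[ℝ] ℝ) (A : Set E) : PowerSeries ℤ :=
  PowerSeries.mk fun n => (Set.ncard {y | y ∈ A ∧ ht y = (n : ℝ)} : ℤ)

lemma gf_shift (ht : E →ₗ[ℝ] ℝ) (A B : Set E) (u : E) (k : ℕ)
    (hfin : ∀ n : ℕ, {y | y ∈ A ∧ ht y = (n : ℝ)}.Finite)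
    (hpos : ∀ y ∈ B, 0 ≤ ht y) (hsub : ∀ y ∈ B, y + u ∈ A) (hu : ht u = k) :
    gf ht A - PowerSeries.X ^ k * gf ht B = gf ht {y | y ∈ A ∧ y - u ∉ B} := by
  ext n
  rw [map_sub, PowerSeries.coeff_X_pow_mul']
  simp only [gf, PowerSeries.coeff_mk]
  set S := {y | y ∈ A ∧ ht y = (n : ℝ)} with hS
  set Q := {y | y - u ∈ B} with hQ
  have h1 := Set.ncard_inter_add_ncard_sdiff_eq_ncard S Q (hfin n)
  have h2 : S \ Q = {y | y ∈ {y | y ∈ A ∧ y - u ∉ B} ∧ ht y = (n : ℝ)} := by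
    ext y
    simp only [hS, hQ, Set.mem_sdiff, Set.mem_ofPred_eq]
    tauto
  rw [← h2, ← h1]
  have h3 : ((S ∩ Q).ncard : ℤ) = if k ≤ n then
      ((Set.ncard {y | y ∈ B ∧ ht y = ((n - k : ℕ) : ℝ)} : ℕ) : ℤ) else 0 := by
    split_ifs with hk
    · congr 1
      refine Set.ncard_congr (fun y _ => y - u) ?_ ?_ ?_
      · rintro y ⟨hy, hy'⟩
        refine ⟨hy', ?_⟩
        rw [map_sub, hy.2, hu, Nat.cast_sub hk]
      · intro a b _ _ h
        exact sub_left_injective h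
      · rintro b ⟨hb, hb'⟩
        refine ⟨b + u, ⟨⟨hsub b hb, ?_⟩, ?_⟩, by simp⟩
        · rw [map_add, hb', hu, Nat.cast_sub hk]; ring
        · simpa [hQ] using hb
    · have : S ∩ Q = ∅ := by
        rw [Set.eq_empty_iff_forall_notMem]
        rintro y ⟨hy, hy'⟩
        have := hpos _ hy'
        rw [map_sub, hy.2, hu] at this
        have : (k : ℝ) ≤ n := by linarith
        exact hk (by exact_mod_cast this)
      rw [this]; simp
  rw [← h3]
  push_cast
  ring

structure Setup (U : Option ι → E) (ht : E →ₗ[ℝ] ℝ) (L : AddSubgroup E) (q l d : ℕ) : Prop where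
  hx : U none ∈ interior (coneC U)
  memL : ∀ j, U j ∈ L
  htx : ht (U none) = l
  htu : ∀ v, ht (U (some v)) = q
  lpos : 0 < l
  qpos : 0 < q
  fin : ∀ n : ℕ, {y | y ∈ coneC U ∧ y ∈ L ∧ ht y = (n : ℝ)}.Finite
  dim : Module.finrank ℝ E = d + 1

variable {U : Option ι → E} {ht : E →ₗ[ℝ] ℝ} {L : AddSubgroup E} {q l d : ℕ}

lemma Setup.ht_nonneg (h : Setup U ht L q l d) {y : E} (hy : y ∈ coneC U) : 0 ≤ ht y := by
  obtain ⟨a, ha, rfl⟩ := hy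
  rw [map_sum]
  apply Finset.sum_nonneg
  intro v _
  rw [map_smul, smul_eq_mul, h.htu]
  exact mul_nonneg (ha v) (Nat.cast_nonneg _)

lemma Setup.x_ne (h : Setup U ht L q l d) : U none ≠ 0 := by
  intro h0
  have := h.htx
  rw [h0, map_zero] at this
  have h2 := h.lpos
  have : l = 0 := by exact_mod_cast this.symm
  omega

lemma Setup.exists_eta (h : Setup U ht L q l d) :
    ∃ η : ι → ℝ, Good U η ∧ (DD U η).Nonempty := by
  have hl : (0:ℝ) < l := by exact_mod_cast h.lpos
  have hq : (0:ℝ) < q := by exact_mod_cast h.qpos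
  obtain ⟨η, hη, h1⟩ := exists_good U (fun _ => (q : ℝ) / l) (fun _ => div_pos hq hl)
  refine ⟨η, hη, LinearMap.toContinuousLinearMap ((l : ℝ)⁻¹ • ht), ?_, ?_⟩
  · change (l : ℝ)⁻¹ * ht (U none) = 1
    rw [h.htx]; field_simp
  · intro v
    change - η v ≤ (l : ℝ)⁻¹ * ht (U (some v))
    rw [h.htu]
    have := h1 v
    rw [div_eq_inv_mul] at this
    exact this

def Cell (U : Option ι → E) (L : AddSubgroup E) (ξ : E) (σ : Finset (Option ι)) (J : Finset ι) :
    Set E :=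
  {y | y ∈ L ∧ 0 < co U σ y none ∧ co U σ y none < 1 ∧ HO U ξ σ y ∧
    ∀ v ∈ J, ¬ cond (co U σ ξ (some v)) (co U σ y (some v) - 1)}

lemma Cell_sub (h : Setup U ht L q l d) {ξ : E} {σ : Finset (Option ι)} (hσ : IsB U σ)
    {J : Finset ι} {y : E} (hy : y ∈ Cell U L ξ σ J) : y ∈ coneC U := by
  obtain ⟨-, h1, -, h2, -⟩ := hy
  rw [co_sum U hσ y, add_comm]
  exact cone_add U ⟨_, HO_some_nonneg U hσ h2, rfl⟩ (cone_smul U (interior_subset h.hx) h1.le)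

lemma Cell_fin (h : Setup U ht L q l d) {ξ : E} {σ : Finset (Option ι)} (hσ : IsB U σ)
    (J : Finset ι) (n : ℕ) : {y | y ∈ Cell U L ξ σ J ∧ ht y = (n : ℝ)}.Finite := by
  refine (h.fin n).subset ?_
  rintro y ⟨hy, hy'⟩
  exact ⟨Cell_sub h hσ hy, hy.1, hy'⟩

lemma cond_add_one {r c : ℝ} (h : cond r c) : cond r (c + 1) := by
  left
  have := cond_nonneg h
  linarith

lemma Cell_step (h : Setup U ht L q l d) {ξ : E} {σ : Finset (Option ι)} (hσ : IsB U σ)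
    {J : Finset ι} {v : ι} (hv : some v ∈ σ) (hvJ : v ∉ J) :
    (1 - PowerSeries.X ^ q) * gf ht (Cell U L ξ σ J) = gf ht (Cell U L ξ σ (insert v J)) := by
  have hcv := (co_spec U hσ).2.2 _ hv
  have hn : co U σ (U (some v)) none = 0 := by rw [hcv]; simp
  have hs : co U σ (U (some v)) (some v) = 1 := by rw [hcv]; simp
  have ho : ∀ w, w ≠ v → co U σ (U (some v)) (some w) = 0 := by
    intro w hw; rw [hcv, Pi.single_apply, if_neg]; simpa using hw
  have key := gf_shift ht (Cell U L ξ σ J) (Cell U L ξ σ J) (U (some v)) q (Cell_fin h hσ J)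
    (fun y hy => h.ht_nonneg (Cell_sub h hσ hy)) (by
      rintro y ⟨h1, h2, h3, h4, h5⟩
      refine ⟨L.add_mem h1 (h.memL _), ?_, ?_, ?_, ?_⟩
      · simpa [hn] using h2
      · simpa [hn] using h3
      · intro w hw
        rw [map_add, Pi.add_apply]
        by_cases hwv : w = v
        · subst hwv; rw [hs]; exact cond_add_one (h4 w hw)
        · rw [ho w hwv, add_zero]; exact h4 w hw
      · intro w hw
        have hwv : w ≠ v := by rintro rfl; exact hvJ hw
        rw [map_add, Pi.add_apply, ho w hwv, add_zero]
        exact h5 w hw) (h.htu v)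
  rw [sub_mul, one_mul, key]
  congr 1
  ext y
  constructor
  · rintro ⟨⟨h1, h2, h3, h4, h5⟩, h6⟩
    refine ⟨h1, h2, h3, h4, ?_⟩
    intro w hw
    rcases Finset.mem_insert.mp hw with rfl | hw
    · intro hc
      apply h6
      refine ⟨L.sub_mem h1 (h.memL _), ?_, ?_, ?_, ?_⟩
      · simpa [hn] using h2
      · simpa [hn] using h3
      · intro w' hw'
        rw [map_sub, Pi.sub_apply]
        by_cases hwv : w' = w
        · subst hwv; rw [hs]; exact hc
        · rw [ho w' hwv, sub_zero]; exact h4 w' hw'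
      · intro w' hw'
        have hwv : w' ≠ w := by rintro rfl; exact hvJ hw'
        rw [map_sub, Pi.sub_apply, ho w' hwv, sub_zero]
        exact h5 w' hw'
    · exact h5 w hw
  · rintro ⟨h1, h2, h3, h4, h5⟩
    refine ⟨⟨h1, h2, h3, h4, fun w hw => h5 w (Finset.mem_insert_of_mem hw)⟩, ?_⟩
    rintro ⟨-, -, -, h6, -⟩
    have := h6 v hv
    rw [map_sub, Pi.sub_apply, hs] at this
    exact h5 v (Finset.mem_insert_self _ _) this

lemma Cell_box (h : Setup U ht L q l d) {ξ : E} {σ : Finset (Option ι)} (hσ : IsB U σ)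
    (J : Finset ι) (hJ : ∀ v ∈ J, some v ∈ σ) :
    (1 - PowerSeries.X ^ q) ^ J.card * gf ht (Cell U L ξ σ ∅) = gf ht (Cell U L ξ σ J) := by
  induction J using Finset.induction_on with
  | empty => simp
  | insert v J hv ih =>
    rw [Finset.card_insert_of_notMem hv, pow_succ', mul_assoc,
      ih (fun w hw => hJ w (Finset.mem_insert_of_mem hw)),
      Cell_step h hσ (hJ v (Finset.mem_insert_self _ _)) hv]

lemma card_eraseNone (h : Setup U ht L q l d) {σ : Finset (Option ι)} (hσ : IsB U σ) :
    (Finset.eraseNone σ).card = d := by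
  have h1 : σ.card = d + 1 := by
    obtain ⟨-, hli, hsp⟩ := hσ
    let b : Module.Basis (σ : Set (Option ι)) ℝ E := Module.Basis.mk
      (v := fun i : (σ : Set (Option ι)) => U i) hli (by rw [← hsp, Set.image_eq_range])
    rw [← h.dim, Module.finrank_eq_card_basis b]
    simp
  rw [Finset.card_eraseNone_of_mem hσ.1, h1]
  rfl

lemma Setup.decomp (h : Setup U ht L q l d) (η : ι → ℝ) (hg : Good U η) (hne : (DD U η).Nonempty)
    (ξ : E) (hξ : ∀ σ, IsB U σ → ∀ v, some v ∈ σ → co U σ ξ (some v) ≠ 0) (n : ℕ) :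
    PowerSeries.coeff n ((1 - PowerSeries.X ^ q) ^ d *
      (gf ht {y | y ∈ interior (coneC U) ∧ y ∈ L} -
        PowerSeries.X ^ l * gf ht {y | y ∈ coneC U ∧ y ∈ L})) =
      ∑ σ ∈ (TT U η).toFinite.toFinset,
        PowerSeries.coeff n (gf ht (Cell U L ξ σ (Finset.eraseNone σ))) := by
  classical
  have hT : ∀ σ, σ ∈ (TT U η).toFinite.toFinset ↔ σ ∈ TT U η := fun σ => by simp
  rw [gf_shift ht _ _ (U none) l ?_ ?_ ?_ h.htx]
  rotate_left
  · intro n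
    refine (h.fin n).subset ?_
    rintro y ⟨hy, hy'⟩
    exact ⟨interior_subset hy.1, hy.2, hy'⟩
  · intro y hy
    exact h.ht_nonneg hy.1
  · rintro y ⟨hy, hy'⟩
    refine ⟨?_, L.add_mem hy' (h.memL _)⟩
    have := cone_add_int U hy h.hx one_pos
    rwa [one_smul] at this
  have hsplit : gf ht {y | y ∈ {y | y ∈ interior (coneC U) ∧ y ∈ L} ∧
      y - U none ∉ {y | y ∈ coneC U ∧ y ∈ L}} =
      ∑ σ ∈ (TT U η).toFinite.toFinset, gf ht (Cell U L ξ σ ∅) := by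
    ext m
    rw [map_sum]
    simp only [gf, PowerSeries.coeff_mk]
    have hfin := fun σ (hσ : σ ∈ TT U η) => Cell_fin (ξ := ξ) h hσ.1 ∅ m
    have := Set.Finite.ncard_biUnion (TT U η).toFinite hfin (by
      intro σ hσ τ hτ hστ
      rw [Function.onFun, Set.disjoint_left]
      rintro y ⟨hy, -⟩ ⟨hy', -⟩
      exact hστ ((existsUnique_HO U η hg h.hx h.x_ne hne ξ hξ y).2 σ hσ τ hτ hy.2.2.2.1 hy'.2.2.2.1))
    rw [finsum_mem_eq_finite_toFinset_sum _ (TT U η).toFinite] at this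
    rw [← Nat.cast_sum, ← this]
    congr 2
    ext y
    simp only [Set.mem_iUnion, Set.mem_ofPred_eq, Cell]
    constructor
    · rintro ⟨⟨⟨h1, h2⟩, h3⟩, h4⟩
      obtain ⟨σ, hσ, hy⟩ := (existsUnique_HO U η hg h.hx h.x_ne hne ξ hξ y).1
      refine ⟨σ, hσ, ⟨h2, (HO_int_iff U η hg h.hx hσ hy).mp h1, ?_, hy, by simp⟩, h4⟩
      by_contra! hc
      exact h3 ⟨(HO_sub_iff U η hg h.hx hσ hy).mpr hc, L.sub_mem h2 (h.memL _)⟩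
    · rintro ⟨σ, hσ, ⟨h2, h1, h3, hy, -⟩, h4⟩
      refine ⟨⟨⟨(HO_int_iff U η hg h.hx hσ hy).mpr h1, h2⟩, ?_⟩, h4⟩
      rintro ⟨h5, -⟩
      have := (HO_sub_iff U η hg h.hx hσ hy).mp h5
      linarith
  rw [hsplit, Finset.mul_sum, map_sum]
  apply Finset.sum_congr rfl
  intro σ hσ
  have hσ' := ((hT σ).mp hσ).1
  rw [← card_eraseNone h hσ', Cell_box h hσ' _ (fun v hv => by simpa using hv)]

lemma cond_symm {r c : ℝ} (hr : r ≠ 0) :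
    ¬ cond r (c - 1) → cond (-r) (1 - c) := by
  unfold cond
  intro h
  push Not at h
  rcases h.1.lt_or_eq with h1 | h1
  · left; linarith
  · right
    have := h.2 h1
    exact ⟨by linarith, by
      rw [neg_pos]; exact lt_of_le_of_ne this hr⟩

lemma cond_symm' {r c : ℝ} :
    cond r c → ¬ cond (-r) (1 - c - 1) := by
  rintro (h | h) (h' | h') <;> linarith

lemma Cell_symm (h : Setup U ht L q l d) {ξ : E} {σ : Finset (Option ι)} (hσ : IsB U σ)
    (hξ : ∀ v, some v ∈ σ → co U σ ξ (some v) ≠ 0) {y : E}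
    (hy : y ∈ Cell U L ξ σ (Finset.eraseNone σ)) :
    (∑ j ∈ σ, U j) - y ∈ Cell U L (-ξ) σ (Finset.eraseNone σ) := by
  have hs : ∀ j ∈ σ, co U σ (∑ j ∈ σ, U j) j = 1 := by
    intro j hj
    rw [map_sum, Finset.sum_apply]
    rw [Finset.sum_congr rfl (g := fun i => if j = i then 1 else 0)]
    · simp [hj]
    · intro i hi
      rw [(co_spec U hσ).2.2 _ hi, Pi.single_apply]
  obtain ⟨h1, h2, h3, h4, h5⟩ := hy
  refine ⟨L.sub_mem (L.sum_mem fun j _ => h.memL j) h1, ?_, ?_, ?_, ?_⟩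
  · rw [map_sub, Pi.sub_apply, hs _ hσ.1]; linarith
  · rw [map_sub, Pi.sub_apply, hs _ hσ.1]; linarith
  · intro v hv
    rw [map_sub, Pi.sub_apply, hs _ hv, map_neg, Pi.neg_apply]
    exact cond_symm (hξ v hv) (h5 v (by simpa using hv))
  · intro v hv
    have hv : some v ∈ σ := by simpa using hv
    rw [map_sub, Pi.sub_apply, hs _ hv, map_neg, Pi.neg_apply]
    exact cond_symm' (h4 v hv)

lemma ht_sum (h : Setup U ht L q l d) {σ : Finset (Option ι)} (hσ : IsB U σ) :
    ht (∑ j ∈ σ, U j) = ((q * d + l : ℕ) : ℝ) := by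
  have h1 : σ = insert none ((Finset.eraseNone σ).map Function.Embedding.some) := by
    rw [Finset.map_some_eraseNone, Finset.insert_erase hσ.1]
  rw [map_sum, h1, Finset.sum_insert (by simp), Finset.sum_map]
  simp only [Function.Embedding.some_apply, h.htx, h.htu]
  rw [Finset.sum_const, card_eraseNone h hσ, nsmul_eq_mul]
  push_cast
  ring

theorem Setup.main (h : Setup U ht L q l d) (G : PowerSeries ℤ)
    (hG : G = (1 - PowerSeries.X ^ q) ^ d *
      (gf ht {y | y ∈ interior (coneC U) ∧ y ∈ L} -
        PowerSeries.X ^ l * gf ht {y | y ∈ coneC U ∧ y ∈ L})) :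
    (∀ n, 0 ≤ PowerSeries.coeff n G) ∧
    (∀ n m, n + m = q * d + l → PowerSeries.coeff n G = PowerSeries.coeff m G) ∧
    (∀ n, q * d + l < n → PowerSeries.coeff n G = 0) := by
  obtain ⟨η, hg, hne⟩ := h.exists_eta
  obtain ⟨ξ, hξ⟩ := exists_xi U
  have hξ' : ∀ σ, IsB U σ → ∀ v, some v ∈ σ → co U σ (-ξ) (some v) ≠ 0 := by
    intro σ hσ v hv
    simpa using hξ σ hσ v hv
  have d1 := h.decomp η hg hne ξ hξ
  have d2 := h.decomp η hg hne (-ξ) hξ'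
  rw [← hG] at d1 d2
  refine ⟨?_, ?_, ?_⟩
  · intro n
    rw [d1]
    apply Finset.sum_nonneg
    intro σ _
    simp [gf]
  · intro n m hnm
    rw [d1, d2]
    apply Finset.sum_congr rfl
    intro σ hσ
    have hσ' : IsB U σ := by
      have : σ ∈ TT U η := by simpa using hσ
      exact this.1
    have hs := ht_sum h hσ'
    rw [← hnm] at hs
    push_cast at hs
    simp only [gf, PowerSeries.coeff_mk]
    congr 1
    refine Set.ncard_congr (fun y _ => (∑ j ∈ σ, U j) - y) ?_ ?_ ?_
    · rintro y ⟨hy, hy'⟩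
      refine ⟨Cell_symm h hσ' (hξ σ hσ') hy, ?_⟩
      rw [map_sub, hs, hy']; ring
    · intro a b _ _ hab
      exact sub_right_injective hab
    · rintro y ⟨hy, hy'⟩
      refine ⟨(∑ j ∈ σ, U j) - y, ⟨?_, ?_⟩, by simp⟩
      · have := Cell_symm h hσ' (hξ' σ hσ') hy
        rwa [neg_neg] at this
      · rw [map_sub, hs, hy']; ring
  · intro n hn
    rw [d1]
    apply Finset.sum_eq_zero
    intro σ hσ
    have hσ' : IsB U σ := by
      have : σ ∈ TT U η := by simpa using hσ
      exact this.1
    simp only [gf, PowerSeries.coeff_mk]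
    have : {y | y ∈ Cell U L ξ σ (Finset.eraseNone σ) ∧ ht y = (n : ℝ)} = ∅ := by
      rw [Set.eq_empty_iff_forall_notMem]
      rintro y ⟨hy, hy'⟩
      have h1 := h.ht_nonneg (Cell_sub h hσ' (Cell_symm h hσ' (hξ σ hσ') hy))
      rw [map_sub, ht_sum h hσ', hy'] at h1
      have : (n : ℝ) ≤ ((q * d + l : ℕ) : ℝ) := by linarith
      have : n ≤ q * d + l := by exact_mod_cast this
      omega
    rw [this]; simp

end geom

section concrete

variable {d : ℕ}

def latSub (d : ℕ) : AddSubgroup ((Fin d → ℝ) × ℝ) where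
  carrier := {y | IsLatticePt y.1}
  add_mem' := by
    intro a b ha hb i
    obtain ⟨m, hm⟩ := ha i
    obtain ⟨n, hn⟩ := hb i
    exact ⟨m + n, by simp [hm, hn]⟩
  zero_mem' := fun i => ⟨0, by simp⟩
  neg_mem' := by
    intro a ha i
    obtain ⟨m, hm⟩ := ha i
    exact ⟨-m, by simp [hm]⟩

lemma mem_latSub (y : (Fin d → ℝ) × ℝ) : y ∈ latSub d ↔ IsLatticePt y.1 := Iff.rfl

lemma lat_finite {S : Set (Fin d → ℝ)} (hS : Bornology.IsBounded S) :
    {x ∈ S | IsLatticePt x}.Finite := by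
  rw [isBounded_iff_forall_norm_le] at hS
  obtain ⟨R, hR⟩ := hS
  refine ((Set.finite_Icc (fun _ : Fin d => -⌈R⌉) (fun _ => ⌈R⌉)).image
    (fun z i => (z i : ℝ))).subset ?_
  rintro x ⟨hx, hl⟩
  choose z hz using hl
  refine ⟨z, ?_, ?_⟩
  · have h1 := fun i => (norm_le_pi_norm x i).trans (hR x hx)
    have h2 : ∀ i, |(z i : ℝ)| ≤ ⌈R⌉ := by
      intro i
      have := h1 i
      rw [Real.norm_eq_abs, hz i] at this
      exact this.trans (Int.le_ceil R)
    constructor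
    · intro i
      have := (abs_le.mp (h2 i)).1
      exact_mod_cast this
    · intro i
      have := (abs_le.mp (h2 i)).2
      exact_mod_cast this
  · funext i
    exact (hz i).symm

/-- the vectors -/
def UU (V : Finset (Fin d → ℝ)) (q l : ℕ) (x₀ : Fin d → ℝ) : Option V → (Fin d → ℝ) × ℝ
  | none => (x₀, (l : ℝ))
  | some v => (v, (q : ℝ))

lemma mem_cone_iff {V : Finset (Fin d → ℝ)} {q l : ℕ} {x₀ : Fin d → ℝ} {P : Set (Fin d → ℝ)}
    (hq : 0 < q) (hV : (q : ℝ) • P = convexHull ℝ (V : Set (Fin d → ℝ))) (p : Fin d → ℝ)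
    {t : ℝ} (ht : 0 < t) : (p, t) ∈ coneC (UU V q l x₀) ↔ p ∈ t • P := by
  have hq' : (0:ℝ) < q := by exact_mod_cast hq
  constructor
  · rintro ⟨a, ha, hy⟩
    have h1 : p = ∑ v : V, a v • (v : Fin d → ℝ) := by
      have := congrArg Prod.fst hy
      simpa [UU, Prod.fst_sum] using this
    have h2 : t = (∑ v : V, a v) * q := by
      have := congrArg Prod.snd hy
      simpa [UU, Prod.snd_sum, Finset.sum_mul] using this
    have h3 : ((q : ℝ) / t) • p ∈ (q : ℝ) • P := by
      rw [hV, h1, Finset.smul_sum]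
      simp only [smul_smul]
      apply (convex_convexHull ℝ _).sum_mem
      · intro v _
        exact mul_nonneg (div_nonneg hq'.le ht.le) (ha v)
      · rw [← Finset.mul_sum, div_mul_eq_mul_div, div_eq_one_iff_eq ht.ne', h2, mul_comm]
      · intro v _
        exact subset_convexHull ℝ _ v.2
    obtain ⟨z, hz, hz'⟩ := h3
    refine ⟨z, hz, ?_⟩
    change t • z = p
    have hz' : (q : ℝ) • z = ((q : ℝ) / t) • p := hz'
    have : z = (1 / t) • p := by
      have := congrArg (fun w => (q : ℝ)⁻¹ • w) hz'
      simp only [smul_smul] at this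
      rw [inv_mul_cancel₀ hq'.ne', one_smul] at this
      rw [this]
      congr 1
      field_simp
    rw [this, smul_smul, mul_one_div_cancel ht.ne', one_smul]
  · rintro ⟨z, hz, hzp⟩
    have hzp : t • z = p := hzp
    have h1 : (q : ℝ) • z ∈ convexHull ℝ (V : Set (Fin d → ℝ)) := by
      rw [← hV]; exact ⟨z, hz, rfl⟩
    rw [Finset.mem_convexHull'] at h1
    obtain ⟨w, hw0, hw1, hw⟩ := h1
    refine ⟨fun v => t / q * w v, fun v => mul_nonneg (div_nonneg ht.le hq'.le) (hw0 v v.2), ?_⟩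
    have e1 : ∑ v : V, w v • (v : Fin d → ℝ) = (q : ℝ) • z := by
      rw [← hw, Finset.sum_coe_sort V (fun v => w v • v)]
    have e2 : ∑ v : V, w v = 1 := by
      rw [← hw1, Finset.sum_coe_sort V (fun v => w v)]
    refine Prod.ext ?_ ?_
    · simp only [UU, Prod.fst_sum, Prod.smul_fst, mul_smul]
      rw [← Finset.smul_sum, e1, smul_smul, ← hzp]
      congr 1
      field_simp
    · simp only [UU, Prod.snd_sum, Prod.smul_snd, smul_eq_mul]
      rw [← Finset.sum_mul, ← Finset.mul_sum, e2]
      field_simp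

lemma mem_cone_zero {V : Finset (Fin d → ℝ)} {q l : ℕ} {x₀ : Fin d → ℝ}
    (hq : 0 < q) (p : Fin d → ℝ) : (p, (0:ℝ)) ∈ coneC (UU V q l x₀) ↔ p = 0 := by
  have hq' : (0:ℝ) < q := by exact_mod_cast hq
  constructor
  · rintro ⟨a, ha, hy⟩
    have h1 : p = ∑ v : V, a v • (v : Fin d → ℝ) := by
      have := congrArg Prod.fst hy
      simpa [UU, Prod.fst_sum] using this
    have h2 : 0 = (∑ v : V, a v) * q := by
      have := congrArg Prod.snd hy
      simpa [UU, Prod.snd_sum, Finset.sum_mul] using this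
    have h3 : ∑ v : V, a v = 0 := by
      rcases mul_eq_zero.mp h2.symm with h | h
      · exact h
      · exact absurd h hq'.ne'
    rw [Finset.sum_eq_zero_iff_of_nonneg (fun v _ => ha v)] at h3
    rw [h1]
    apply Finset.sum_eq_zero
    intro v hv
    rw [h3 v hv, zero_smul]
  · rintro rfl
    exact ⟨fun _ => 0, fun _ => le_rfl, by simp⟩

lemma mem_int_iff {V : Finset (Fin d → ℝ)} {q l : ℕ} {x₀ : Fin d → ℝ} {P : Set (Fin d → ℝ)}
    (hq : 0 < q) (hV : (q : ℝ) • P = convexHull ℝ (V : Set (Fin d → ℝ))) (p : Fin d → ℝ)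
    {t : ℝ} (ht : 0 < t) :
    (p, t) ∈ interior (coneC (UU V q l x₀)) ↔ p ∈ interior (t • P) := by
  constructor
  · intro h
    have hc : Continuous fun p : Fin d → ℝ => (p, t) := by fun_prop
    refine interior_maximal ?_ (isOpen_interior.preimage hc) h
    intro p' hp'
    exact (mem_cone_iff hq hV p' ht).mp (interior_subset hp')
  · intro h
    rw [interior_smul₀ ht.ne'] at h
    obtain ⟨z, hz, hzp⟩ := h
    have hzp : t • z = p := hzp
    rw [mem_interior_iff_mem_nhds]
    have hc : ContinuousAt (fun y : (Fin d → ℝ) × ℝ => y.2⁻¹ • y.1) (p, t) :=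
      (continuousAt_snd.inv₀ ht.ne').smul continuousAt_fst
    have hz' : (fun y : (Fin d → ℝ) × ℝ => y.2⁻¹ • y.1) (p, t) = z := by
      simp only
      rw [← hzp, smul_smul, inv_mul_cancel₀ ht.ne', one_smul]
    have e1 := hc.eventually_mem (show interior P ∈ nhds _ from isOpen_interior.mem_nhds (by
      have := hz'; simp only at this ⊢; rw [this]; exact hz))
    have e2 : ∀ᶠ y : (Fin d → ℝ) × ℝ in nhds (p, t), 0 < y.2 :=
      continuousAt_snd.eventually (lt_mem_nhds ht)
    filter_upwards [e1, e2] with y h1 h2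
    obtain ⟨p', t'⟩ := y
    rw [mem_cone_iff hq hV p' h2]
    refine ⟨t'⁻¹ • p', interior_subset h1, ?_⟩
    change t' • t'⁻¹ • p' = p'
    rw [smul_smul, mul_inv_cancel₀ (ne_of_gt h2), one_smul]

lemma concrete_setup {V : Finset (Fin d → ℝ)} {q l : ℕ} {x₀ : Fin d → ℝ} {P : Set (Fin d → ℝ)}
    (hq : 0 < q) (hV : (q : ℝ) • P = convexHull ℝ (V : Set (Fin d → ℝ)))
    (hVl : ∀ v ∈ V, IsLatticePt v) (hb : Bornology.IsBounded P)
    (hl : 0 < l) (hx₀ : IsLatticePt x₀) (hx : x₀ ∈ interior ((l : ℝ) • P)) :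
    Setup (UU V q l x₀) (LinearMap.snd ℝ (Fin d → ℝ) ℝ) (latSub d) q l d where
  hx := (mem_int_iff hq hV x₀ (by exact_mod_cast hl)).mpr hx
  memL := by
    rintro (_ | v)
    · exact hx₀
    · exact hVl v v.2
  htx := rfl
  htu := fun _ => rfl
  lpos := hl
  qpos := hq
  fin := by
    intro n
    have hfin := lat_finite (hb.smul₀ (n : ℝ))
    refine Set.Finite.subset ((hfin.union (Set.finite_singleton 0)).image (fun p => (p, (n : ℝ)))) ?_
    rintro ⟨p, t⟩ ⟨h1, h2, h3⟩
    have h3 : t = n := h3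
    subst h3
    refine ⟨p, ?_, rfl⟩
    rcases Nat.eq_zero_or_pos n with rfl | hn
    · right
      rw [Nat.cast_zero] at h1
      exact (mem_cone_zero hq p).mp h1
    · left
      exact ⟨(mem_cone_iff hq hV p (by exact_mod_cast hn)).mp h1, h2⟩
  dim := by simp

lemma ncard_slice (A : Set ((Fin d → ℝ) × ℝ)) (t : ℝ) (S : Set (Fin d → ℝ))
    (h : ∀ p, (p, t) ∈ A ↔ p ∈ S) :
    Set.ncard {y | y ∈ {y | y ∈ A ∧ y ∈ latSub d} ∧ LinearMap.snd ℝ (Fin d → ℝ) ℝ y = t} =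
      latCount S := by
  unfold latCount
  refine Set.ncard_congr (fun y _ => y.1) ?_ ?_ ?_
  · rintro ⟨p, s⟩ ⟨⟨h1, h2⟩, h3⟩
    have h3 : s = t := h3
    subst h3
    exact ⟨(h p).mp h1, h2⟩
  · rintro ⟨p, s⟩ ⟨p', s'⟩ ⟨-, h3⟩ ⟨-, h3'⟩ h4
    have h3 : s = t := h3
    have h3' : s' = t := h3'
    have h4 : p = p' := h4
    rw [h3, h3', h4]
  · rintro p ⟨h1, h2⟩
    exact ⟨(p, t), ⟨⟨(h p).mpr h1, h2⟩, rfl⟩, rfl⟩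

lemma final_alg {d q l : ℕ} (hq0 : 0 < q) (hl0 : 0 < l) (E I : PowerSeries ℤ)
    (hI : ∀ n < l, PowerSeries.coeff n I = 0) (G : PowerSeries ℤ)
    (hG : G = (1 - PowerSeries.X ^ q) ^ d * (I - PowerSeries.X ^ l * E))
    (h1 : ∀ n, 0 ≤ PowerSeries.coeff n G)
    (h2 : ∀ n m, n + m = q * d + l → PowerSeries.coeff n G = PowerSeries.coeff m G)
    (h3 : ∀ n, q * d + l < n → PowerSeries.coeff n G = 0)
    (hP : Polynomial ℤ)
    (hPeq : (hP : PowerSeries ℤ) = (1 - PowerSeries.X ^ q) ^ (d + 1) * E)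
    (hB : Polynomial ℤ)
    (hBeq : (hB : PowerSeries ℤ) = (1 - PowerSeries.X ^ q) ^ d * (E - I)) :
    ∃ b : Polynomial ℤ,
      (∑ i ∈ Finset.range q, (Polynomial.X : Polynomial ℤ) ^ i) *
          (hB + Polynomial.X ^ l * b) =
        (∑ i ∈ Finset.range l, (Polynomial.X : Polynomial ℤ) ^ i) * hP ∧
      (∀ i, 0 ≤ b.coeff i) ∧
      b.natDegree ≤ q * d - l ∧ (∀ i ≤ q * d - l, b.coeff i = b.coeff (q * d - l - i)) := by
  have hG0 : ∀ n < l, PowerSeries.coeff n G = 0 := by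
    rw [← PowerSeries.X_pow_dvd_iff, hG]
    apply Dvd.dvd.mul_left
    apply dvd_sub _ (Dvd.intro _ rfl)
    rw [PowerSeries.X_pow_dvd_iff]
    exact hI
  let b : Polynomial ℤ := PowerSeries.trunc (q * d + 1)
    (PowerSeries.mk fun i => PowerSeries.coeff (i + l) G)
  have hb : ∀ i, b.coeff i = PowerSeries.coeff (i + l) G := by
    intro i
    simp only [b, PowerSeries.coeff_trunc, PowerSeries.coeff_mk]
    split_ifs with h
    · rfl
    · rw [h3]; omega
  have hbG : (PowerSeries.X ^ l * (b : PowerSeries ℤ)) = G := by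
    ext n
    rw [PowerSeries.coeff_X_pow_mul']
    split_ifs with h
    · rw [Polynomial.coeff_coe, hb, Nat.sub_add_cancel h]
    · rw [hG0 n (by omega)]
  have hbz : ∀ i, q * d < l + i → b.coeff i = 0 := by
    intro i hi
    rw [hb]
    by_cases h : i ≤ q * d
    · rw [h2 (i + l) (q * d - i) (by omega)]
      exact hG0 _ (by omega)
    · exact h3 _ (by omega)
  refine ⟨b, ?_, ?_, ?_, ?_⟩
  · have hne : (1 - Polynomial.X : Polynomial ℤ) ≠ 0 := by
      intro h
      have := congrArg (fun p => Polynomial.coeff p 0) h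
      simp at this
    apply mul_left_cancel₀ hne
    rw [← mul_assoc, ← mul_assoc, mul_neg_geom_sum, mul_neg_geom_sum]
    apply Polynomial.coe_injective ℤ
    simp only [Polynomial.coe_mul, Polynomial.coe_add, Polynomial.coe_sub, Polynomial.coe_pow,
      Polynomial.coe_one, Polynomial.coe_X]
    rw [hbG, hBeq, hPeq, hG]
    ring
  · intro i
    rw [hb]; exact h1 _
  · rw [Polynomial.natDegree_le_iff_coeff_eq_zero]
    intro i hi
    exact hbz i (by omega)
  · intro i hi
    by_cases h : l ≤ q * d
    · rw [hb, hb]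
      exact h2 _ _ (by omega)
    · rw [hbz _ (by omega), hbz _ (by omega)]

end concrete

end HS

/-- With `a(z) = h*_{∂P}(z)` the boundary h*-polynomial,
`((1+z+⋯+z^{l−1})/(1+z+⋯+z^{q−1})) h*_P(z) = h*_{∂P}(z) + z^l b_P(z)` where `b_P` has
nonnegative integer coefficients and satisfies `z^{qd−l} b_P(1/z) = b_P(z)`. -/
theorem hstar_decomposition_boundary {d q l : ℕ} (P : Set (Fin d → ℝ))
    (hrat : IsRationalPolytope P) (hfull : IsFullDim P)
    (hq : IsDenominator P q) (hl : IsMinInteriorDilate P l)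
    (hP : Polynomial ℤ) (hPdeg : hP.natDegree < q * (d + 1))
    (hPeq : (hP : PowerSeries ℤ) = (1 - PowerSeries.X ^ q) ^ (d + 1) * ehrSeries P)
    (hB : Polynomial ℤ)
    (hBeq : (hB : PowerSeries ℤ) = (1 - PowerSeries.X ^ q) ^ d * ehrBdSeries P) :
    ∃ b : Polynomial ℤ,
      (∑ i ∈ Finset.range q, (Polynomial.X : Polynomial ℤ) ^ i) *
          (hB + Polynomial.X ^ l * b) =
        (∑ i ∈ Finset.range l, (Polynomial.X : Polynomial ℤ) ^ i) * hP ∧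
      (∀ i, 0 ≤ b.coeff i) ∧
      b.natDegree ≤ q * d - l ∧ (∀ i ≤ q * d - l, b.coeff i = b.coeff (q * d - l - i)) := by
  obtain ⟨hq0, ⟨V, hVl, hV⟩, -⟩ := hq
  obtain ⟨hl0, ⟨x₀, hx₀, hx⟩, hlmin⟩ := hl
  have hcomp : IsCompact P := by
    obtain ⟨W, -, rfl⟩ := hrat
    exact W.finite_toSet.isCompact_convexHull ℝ
  have hS := HS.concrete_setup hq0 hV hVl hcomp.isBounded hl0 hx₀ hx
  have hE : HS.gf (LinearMap.snd ℝ (Fin d → ℝ) ℝ)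
      {y | y ∈ HS.coneC (HS.UU V q l x₀) ∧ y ∈ HS.latSub d} = ehrSeries P := by
    ext n
    simp only [HS.gf, ehrSeries, PowerSeries.coeff_mk]
    split_ifs with h
    · subst h
      rw [HS.ncard_slice _ _ {0} (fun p => by
        rw [Nat.cast_zero]; exact HS.mem_cone_zero hq0 p)]
      have : {x ∈ ({0} : Set (Fin d → ℝ)) | IsLatticePt x} = {0} := by
        ext x
        constructor
        · exact fun hx => hx.1
        · intro hx
          refine ⟨hx, ?_⟩
          rw [Set.mem_singleton_iff] at hx
          subst hx
          exact fun i => ⟨0, by simp⟩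
      rw [latCount, this]
      simp
    · rw [HS.ncard_slice _ _ _ (fun p => HS.mem_cone_iff hq0 hV p
        (by exact_mod_cast Nat.pos_of_ne_zero h))]
  have hI : HS.gf (LinearMap.snd ℝ (Fin d → ℝ) ℝ)
      {y | y ∈ interior (HS.coneC (HS.UU V q l x₀)) ∧ y ∈ HS.latSub d} = ehrIntSeries P := by
    ext n
    simp only [HS.gf, ehrIntSeries, PowerSeries.coeff_mk]
    split_ifs with h
    · subst h
      rw [HS.ncard_slice _ _ ∅ (fun p => by
        rw [Nat.cast_zero]
        refine ⟨fun h => ?_, fun h => h.elim⟩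
        obtain ⟨δ, hδ, h1⟩ := HS.exists_delta h ((0 : Fin d → ℝ), (-1 : ℝ))
        have := hS.ht_nonneg h1
        simp at this
        linarith)]
      simp [latCount]
    · rw [HS.ncard_slice _ _ _ (fun p => HS.mem_int_iff hq0 hV p
        (by exact_mod_cast Nat.pos_of_ne_zero h))]
  have hBd : ehrBdSeries P = ehrSeries P - ehrIntSeries P := by
    ext n
    simp only [ehrBdSeries, ehrSeries, ehrIntSeries, PowerSeries.coeff_mk, map_sub]
    split_ifs with h
    · simp
    · have hc : IsCompact ((n : ℝ) • P) := hcomp.smul (n : ℝ)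
      have hfin := HS.lat_finite hc.isBounded
      have h1 := Set.ncard_inter_add_ncard_sdiff_eq_ncard {x ∈ (n : ℝ) • P | IsLatticePt x}
        (interior ((n : ℝ) • P)) hfin
      have h2 : {x ∈ (n : ℝ) • P | IsLatticePt x} ∩ interior ((n : ℝ) • P) =
          {x ∈ interior ((n : ℝ) • P) | IsLatticePt x} := by
        ext x
        constructor
        · rintro ⟨⟨a, b⟩, c⟩; exact ⟨c, b⟩
        · rintro ⟨a, b⟩; exact ⟨⟨interior_subset a, b⟩, a⟩
      have h3 : {x ∈ (n : ℝ) • P | IsLatticePt x} \ interior ((n : ℝ) • P) =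
          {x ∈ frontier ((n : ℝ) • P) | IsLatticePt x} := by
        rw [hc.isClosed.frontier_eq]
        ext x
        constructor
        · rintro ⟨⟨a, b⟩, c⟩; exact ⟨⟨a, c⟩, b⟩
        · rintro ⟨⟨a, b⟩, c⟩; exact ⟨⟨a, c⟩, b⟩
      rw [h2, h3] at h1
      unfold latCount
      omega
  obtain ⟨m1, m2, m3⟩ := hS.main _ rfl
  rw [hE, hI] at m1 m2 m3
  refine HS.final_alg hq0 hl0 (ehrSeries P) (ehrIntSeries P) ?_ _ rfl m1 m2 m3 hP hPeq hB
    (by rw [hBeq, hBd])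
  intro n hn
  simp only [ehrIntSeries, PowerSeries.coeff_mk]
  split_ifs with h
  · rfl
  · have : {x ∈ interior ((n : ℝ) • P) | IsLatticePt x} = ∅ := by
      rw [Set.eq_empty_iff_forall_notMem]
      rintro x ⟨a, b⟩
      have := hlmin n (Nat.pos_of_ne_zero h) ⟨x, b, a⟩
      omega
    rw [latCount, this]
    simp
end

section
/- Let P ⊂ ℝ^d be a full-dimensional lattice polytope and let ℓ be the smallest positive integer such that the interior of ℓP contains a lattice point. Writing the Ehrhart polynomial of P as ehr_P(n) = k_d n^d + k_{d−1} n^{d−1} + ⋯ + k_0, the two leading coefficients satisfy (ℓ·d/2)·k_d ≥ k_{d−1}. -/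
open Pointwise

section Helpers

open MeasureTheory Filter Topology

lemma meas_round : Measurable (round : ℝ → ℤ) := by
  have : (round : ℝ → ℤ) = fun x => ⌊x + 1/2⌋ := by ext x; exact round_eq x
  rw [this]; exact (measurable_id.add_const _).floor

lemma vol_split (A : Set ℝ) (hA : MeasurableSet A) :
    volume A = ∑' n : ℤ, volume (A ∩ Set.Ico ((n:ℝ) - 1/2) (n + 1/2)) := by
  have h : A = ⋃ n : ℤ, (A ∩ Set.Ico ((n:ℝ) - 1/2) (n + 1/2)) := by
    rw [← Set.inter_iUnion]
    ext x
    simp only [Set.mem_inter_iff, Set.mem_iUnion]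
    exact ⟨fun h => ⟨h, round x, round_eq_iff.1 rfl⟩, fun h => h.1⟩
  conv_lhs => rw [h]
  refine measure_iUnion ?_ fun i => hA.inter measurableSet_Ico
  intro i j hij
  refine Set.disjoint_left.2 fun x hx hy => hij ?_
  rw [← round_eq_iff.2 hx.2, ← round_eq_iff.2 hy.2]

lemma mp_one : MeasurePreserving (fun t : ℝ => 2 * (round t : ℝ) - t) volume volume := by
  have hm : Measurable (fun t : ℝ => 2 * (round t : ℝ) - t) :=
    ((measurable_from_top.comp meas_round).const_mul 2).sub measurable_id
  refine ⟨hm, ?_⟩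
  ext A hA
  rw [Measure.map_apply hm hA, vol_split _ (hm hA), vol_split A hA]
  congr 1
  ext n
  have h1 : (fun t : ℝ => 2 * (round t : ℝ) - t) ⁻¹' A ∩ Set.Ico ((n:ℝ) - 1/2) (n + 1/2)
      = (fun t => 2 * (n:ℝ) - t) ⁻¹' (A ∩ Set.Ioc ((n:ℝ) - 1/2) (n + 1/2)) := by
    ext t
    simp only [Set.mem_inter_iff, Set.mem_preimage]
    constructor
    · rintro ⟨h, h2⟩
      rw [round_eq_iff.2 h2] at h
      exact ⟨h, by constructor <;> linarith [h2.1, h2.2]⟩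
    · rintro ⟨h, h2⟩
      have h3 : t ∈ Set.Ico ((n:ℝ) - 1/2) (n + 1/2) := by constructor <;> linarith [h2.1, h2.2]
      rw [round_eq_iff.2 h3]
      exact ⟨h, h3⟩
  rw [h1, (Measure.measurePreserving_sub_left volume (2 * (n:ℝ))).measure_preimage
    (hA.inter measurableSet_Ioc).nullMeasurableSet]
  exact measure_congr ((ae_eq_refl A).inter Ico_ae_eq_Ioc.symm)

variable {d : ℕ}

lemma mp_pi : MeasurePreserving (fun (u : Fin d → ℝ) i => 2 * (round (u i) : ℝ) - u i)
    volume volume := volume_preserving_pi (fun _ => mp_one)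

lemma meas_roundpi : Measurable (fun (u : Fin d → ℝ) i => round (u i)) :=
  measurable_pi_lambda _ fun i => meas_round.comp (measurable_pi_apply i)

lemma map_round_count : Measure.map (fun (u : Fin d → ℝ) i => round (u i)) volume
    = (Measure.count : Measure (Fin d → ℤ)) := by
  refine Measure.ext_of_singleton fun y => ?_
  rw [Measure.map_apply meas_roundpi (measurableSet_singleton _), Measure.count_singleton]
  have : (fun (u : Fin d → ℝ) i => round (u i)) ⁻¹' {y}
      = Set.univ.pi fun i => Set.Ico ((y i:ℝ) - 1/2) (y i + 1/2) := by
    ext u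
    simp only [Set.mem_preimage, Set.mem_singleton_iff, funext_iff, Set.mem_pi, Set.mem_univ,
      true_imp_iff, round_eq_iff]
  rw [this, Real.volume_pi_Ico]
  refine Finset.prod_eq_one fun i _ => ?_
  rw [show ((y i:ℝ) + 1/2 - (y i - 1/2)) = 1 by ring, ENNReal.ofReal_one]

/-- integral identity -/
lemma int_ident (h : (Fin d → ℝ) → ℝ) (hc : Continuous h) (hs : HasCompactSupport h) :
    (∫ u : Fin d → ℝ, (h u + h (fun i => 2 * (round (u i) : ℝ) - u i)
      - 2 * h (fun i => (round (u i) : ℝ)))) =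
    2 * (∫ u, h u) - 2 * ∑' y : Fin d → ℤ, h (fun i => (y i : ℝ)) := by
  have hi : Integrable h volume := hc.integrable_of_hasCompactSupport hs
  have h2 : Integrable (fun u : Fin d → ℝ => h (fun i => 2 * (round (u i) : ℝ) - u i)) volume :=
    mp_pi.integrable_comp_of_integrable hi
  have e2 : ∫ u : Fin d → ℝ, h (fun i => 2 * (round (u i) : ℝ) - u i) = ∫ u, h u := by
    conv_rhs => rw [← mp_pi.map_eq]
    rw [integral_map mp_pi.measurable.aemeasurable hc.aestronglyMeasurable]
  have h3' : Integrable (fun y : Fin d → ℤ => h (fun i => (y i : ℝ)))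
      (Measure.map (fun (u : Fin d → ℝ) i => round (u i)) volume) := by
    rw [map_round_count]
    rw [integrable_count_iff]
    obtain ⟨R, hR⟩ := hs.isCompact.isBounded.subset_closedBall 0
    refine summable_of_hasFiniteSupport ?_
    have : Set.Finite (Metric.closedBall (0 : Fin d → ℤ) R) :=
      (isCompact_closedBall _ _).finite_of_discrete
    refine this.subset fun y hy => ?_
    have hy' := hR (subset_tsupport _ (show (fun i => (y i : ℝ)) ∈ Function.support h by simpa using hy))
    rw [mem_closedBall_zero_iff] at hy' ⊢
    refine le_trans (le_of_eq ?_) hy'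
    simp only [Pi.norm_def]
    congr 2
  have h3 : Integrable (fun u : Fin d → ℝ => h (fun i => (round (u i) : ℝ))) volume :=
    h3'.comp_measurable meas_roundpi
  have e3 : ∫ u : Fin d → ℝ, h (fun i => (round (u i) : ℝ))
      = ∑' y : Fin d → ℤ, h (fun i => (y i : ℝ)) := by
    rw [← integral_map (f := fun y : Fin d → ℤ => h (fun i => (y i : ℝ)))
      meas_roundpi.aemeasurable h3'.aestronglyMeasurable]
    rw [integral_countable h3', map_round_count]
    simp [Measure.real]
  have h12 : Integrable (fun u : Fin d → ℝ => h u + h (fun i => 2 * (round (u i) : ℝ) - u i)) volume :=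
    hi.add h2
  rw [integral_sub h12 (h3.const_mul 2), integral_add hi h2, integral_const_mul, e2, e3]
  ring

noncomputable def rr (m : ℝ) (z : Fin d → ℝ) : Fin d → ℝ :=
  fun i => z i - (round (m * z i) : ℝ) / m

lemma rr_meas (m : ℝ) : Measurable (rr m : (Fin d → ℝ) → _) := by
  refine measurable_pi_lambda _ fun i => (measurable_pi_apply i).sub ?_
  have h : Measurable (fun c : Fin d → ℝ => m * c i) := by
    fun_prop
  exact (measurable_from_top.comp (meas_round.comp h)).div_const m

lemma rr_norm {m : ℝ} (hm : 0 < m) (z : Fin d → ℝ) : ‖rr m z‖ ≤ 1 / (2 * m) := by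
  rw [pi_norm_le_iff_of_nonneg (by positivity)]
  intro i
  have h := abs_sub_round (m * z i)
  have : rr m z i = (m * z i - round (m * z i)) / m := by unfold rr; field_simp
  rw [this, Real.norm_eq_abs, abs_div, abs_of_pos hm, div_le_div_iff₀ hm (by positivity)]
  nlinarith

noncomputable def FF (f : (Fin d → ℝ) → ℝ) (m : ℝ) (z : Fin d → ℝ) : ℝ :=
  f z + f (z - (2:ℝ) • rr m z) - 2 * f (z - rr m z)

lemma int_FF (f : (Fin d → ℝ) → ℝ) (hc : Continuous f) (hs : HasCompactSupport f)
    {m : ℝ} (hm : 0 < m) :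
    m ^ d * ∫ z, FF f m z = 2 * (m ^ d * ∫ z, f z)
      - 2 * ∑' y : Fin d → ℤ, f (m⁻¹ • (fun i => (y i : ℝ))) := by
  have h1 := int_ident (fun u => f (m⁻¹ • u)) (hc.comp (continuous_const_smul _))
    (hs.comp_smul (inv_ne_zero hm.ne'))
  rw [Measure.integral_comp_inv_smul] at h1
  have h2 := Measure.integral_comp_inv_smul (volume : Measure (Fin d → ℝ)) (FF f m) m
  simp only [Module.finrank_fin_fun, abs_of_pos (pow_pos hm d), smul_eq_mul] at h1 h2
  rw [← h2, ← h1]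
  congr 1
  ext u
  unfold FF
  congr 3
  · ext i
    simp [rr]
    field_simp
    ring
  · ext i
    simp [rr]
    field_simp

lemma FF_tendsto (f : (Fin d → ℝ) → ℝ) (z : Fin d → ℝ) (hz : DifferentiableAt ℝ f z) :
    Tendsto (fun m : ℕ => (m:ℝ) * FF f m z) atTop (𝓝 0) := by
  have hd := hz.hasFDerivAt.isLittleO
  set D := fderiv ℝ f z
  have hO : ∀ c : ℝ, (fun m : ℕ => c • rr (m:ℝ) z) =O[atTop] (fun m : ℕ => (m:ℝ)⁻¹) := by
    intro c
    refine Asymptotics.IsBigO.of_bound (|c| * (1/2)) ?_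
    filter_upwards [eventually_gt_atTop 0] with m hm
    have hm' : (0:ℝ) < m := by exact_mod_cast hm
    have := rr_norm hm' z
    rw [norm_smul, norm_inv, Real.norm_eq_abs, Real.norm_eq_abs, abs_of_pos hm', mul_assoc]
    refine mul_le_mul_of_nonneg_left (this.trans (le_of_eq ?_)) (abs_nonneg _)
    field_simp
  have hinv : Tendsto (fun m : ℕ => (m:ℝ)⁻¹) atTop (𝓝 0) := tendsto_inv_atTop_nhds_zero_nat
  have key : ∀ c : ℝ, (fun m : ℕ => f (z - c • rr (m:ℝ) z) - f z + c * D (rr (m:ℝ) z))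
      =o[atTop] (fun m : ℕ => (m:ℝ)⁻¹) := by
    intro c
    have h0 : Tendsto (fun m : ℕ => c • rr (m:ℝ) z) atTop (𝓝 0) := (hO c).trans_tendsto hinv
    have ht : Tendsto (fun m : ℕ => z - c • rr (m:ℝ) z) atTop (𝓝 z) := by
      simpa using tendsto_const_nhds.sub h0
    have h1 := hd.comp_tendsto ht
    have h2' : ((fun x' => x' - z) ∘ fun m : ℕ => z - c • rr (m:ℝ) z)
        =O[atTop] (fun m : ℕ => (m:ℝ)⁻¹) := by
      refine Asymptotics.IsBigO.congr_left (hO (-c)) fun m => ?_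
      simp
    have h2 := h1.trans_isBigO h2'
    refine h2.congr_left fun m => ?_
    simp [D]
  have h3 := (key 2).sub ((key 1).const_mul_left 2)
  have h4 := h3.tendsto_div_nhds_zero
  refine h4.congr fun m => ?_
  simp only [FF, one_smul, div_inv_eq_mul]
  ring

lemma riem (f : (Fin d → ℝ) → ℝ) (L : NNReal) (hf : LipschitzWith L f)
    (hs : HasCompactSupport f) :
    Tendsto (fun m : ℕ => (m:ℝ) * ((∫ z, f z) -
      (∑' y : Fin d → ℤ, f ((m:ℝ)⁻¹ • (fun i => (y i : ℝ)))) / (m:ℝ)^d)) atTop (𝓝 0) := by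
  obtain ⟨R, hR⟩ := hs.isCompact.isBounded.subset_closedBall 0
  have hfz : ∀ z, R < ‖z‖ → f z = 0 := by
    intro z hz
    by_contra h
    have := hR (subset_tsupport _ h)
    rw [mem_closedBall_zero_iff] at this
    linarith
  have hL : ∀ a b, |f a - f b| ≤ L * ‖a - b‖ := fun a b => by
    simpa [Real.norm_eq_abs] using hf.norm_sub_le a b
  have main : Tendsto (fun m : ℕ => ∫ z, (m:ℝ) * FF f m z) atTop (𝓝 (∫ z : Fin d → ℝ, (0:ℝ))) := by
    refine tendsto_integral_filter_of_dominated_convergence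
      (Set.indicator (Metric.closedBall 0 (R+1)) fun _ => (L:ℝ)) ?_ ?_ ?_ ?_
    · refine Eventually.of_forall fun m => ?_
      have hm := hf.continuous.measurable
      refine Measurable.aestronglyMeasurable (Measurable.const_mul ?_ _)
      exact (hm.add (hm.comp (measurable_id.sub ((rr_meas _).const_smul (2:ℝ))))).sub
        ((hm.comp (measurable_id.sub (rr_meas _))).const_mul 2)
    · filter_upwards [eventually_gt_atTop 0] with m hm
      refine Eventually.of_forall fun z => ?_
      have hm' : (1:ℝ) ≤ m := by exact_mod_cast hm
      have hm0 : (0:ℝ) < m := by linarith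
      have hr := rr_norm hm0 z
      have hr1 : ‖rr (m:ℝ) z‖ ≤ 1/2 := hr.trans (by
        rw [div_le_div_iff₀ (by positivity) (by norm_num)]; linarith)
      by_cases hz : z ∈ Metric.closedBall (0 : Fin d → ℝ) (R+1)
      · rw [Set.indicator_of_mem hz, Real.norm_eq_abs, abs_mul, abs_of_pos hm0]
        have h1 := hL z (z - rr (m:ℝ) z)
        have h2 := hL (z - (2:ℝ) • rr (m:ℝ) z) (z - rr (m:ℝ) z)
        rw [show z - (z - rr (m:ℝ) z) = rr (m:ℝ) z by abel] at h1
        rw [show z - (2:ℝ) • rr (m:ℝ) z - (z - rr (m:ℝ) z) = - rr (m:ℝ) z by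
          rw [two_smul]; abel, norm_neg] at h2
        have h3 : |FF f m z| ≤ 2 * (L * ‖rr (m:ℝ) z‖) := by
          unfold FF
          rw [abs_le] at h1 h2 ⊢
          constructor <;> linarith [h1.1, h1.2, h2.1, h2.2]
        calc (m:ℝ) * |FF f m z| ≤ m * (2 * (L * (1/(2*m)))) := by
              gcongr
              exact h3.trans (by gcongr)
          _ = L := by field_simp
      · rw [Set.indicator_of_notMem hz]
        rw [mem_closedBall_zero_iff, not_le] at hz
        have a1 : f z = 0 := hfz _ (by linarith)
        have a2 : f (z - rr (m:ℝ) z) = 0 := hfz _ (by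
          linarith [norm_sub_norm_le z (rr (m:ℝ) z)])
        have a3 : f (z - (2:ℝ) • rr (m:ℝ) z) = 0 := hfz _ (by
          have := norm_sub_norm_le z ((2:ℝ) • rr (m:ℝ) z)
          rw [norm_smul, Real.norm_ofNat] at this
          linarith)
        simp [FF, a1, a2, a3]
    · exact (integrable_indicator_iff Metric.isClosed_closedBall.measurableSet).2
        (integrableOn_const (measure_closedBall_lt_top.ne))
    · filter_upwards [hf.ae_differentiableAt (μ := volume)] with z hz
      exact FF_tendsto f z hz
  rw [integral_zero] at main
  have main2 := main.const_mul (1/2)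
  rw [mul_zero] at main2
  refine main2.congr' ?_
  filter_upwards [eventually_gt_atTop 0] with m hm
  have hm' : (0:ℝ) < m := by exact_mod_cast hm
  have h := int_FF f hf.continuous hs hm'
  rw [integral_const_mul]
  have h5 : (∫ z, FF f m z) = 2 * (∫ z, f z) - 2 * (∑' y : Fin d → ℤ, f ((m:ℝ)⁻¹ • (fun i => (y i : ℝ)))) / (m:ℝ)^d := by
    have : (m:ℝ)^d ≠ 0 := by positivity
    generalize (∑' y : Fin d → ℤ, f ((m:ℝ)⁻¹ • (fun i => (y i : ℝ)))) = S at h ⊢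
    field_simp
    linarith
  rw [h5]
  ring

lemma ratio0 {a b : ℕ} (h : a < b) : Tendsto (fun m : ℕ => (m:ℝ)^a / (m:ℝ)^b) atTop (𝓝 0) :=
  (tendsto_pow_div_pow_atTop_zero h).comp tendsto_natCast_atTop_atTop

lemma ratio1 (a : ℕ) : Tendsto (fun m : ℕ => (m:ℝ)^a / (m:ℝ)^a) atTop (𝓝 1) := by
  refine tendsto_const_nhds.congr' ?_
  filter_upwards [eventually_gt_atTop 0] with m hm
  have : (m:ℝ) ≠ 0 := by positivity
  field_simp

lemma faul (n p : ℕ) : ∑ k ∈ Finset.range n, (k:ℝ)^p =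
    ∑ i ∈ Finset.range (p + 1), (bernoulli i : ℝ) * ((p + 1).choose i : ℝ) * (n:ℝ) ^ (p + 1 - i) / ((p:ℝ) + 1) := by
  have := congrArg (fun q : ℚ => (q : ℝ)) (sum_range_pow n p)
  push_cast at this
  exact this

lemma icoSum (m : ℕ) (hm : 0 < m) (j : ℕ) :
    ∑ i ∈ Finset.Ico 1 m, (i:ℝ)^j = ∑ i ∈ Finset.range m, (i:ℝ)^j - 0^j := by
  rw [Finset.range_eq_Ico, Finset.sum_eq_sum_Ico_succ_bot hm]
  simp

lemma T1 (e : ℕ) : Tendsto (fun m : ℕ => (∑ i ∈ Finset.Ico 1 m, (i:ℝ)^(e+1)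
    - (m:ℝ)^(e+2) / (e+2)) / (m:ℝ)^(e+1)) atTop (𝓝 (-1/2)) := by
  have h : Tendsto (fun m : ℕ => (∑ i ∈ Finset.range e,
      (bernoulli (i+2) : ℝ) * ((e + 2).choose (i+2) : ℝ) / ((e:ℝ)+2) *
        ((m:ℝ) ^ (e - i) / (m:ℝ)^(e+1))) + (-1/2) * ((m:ℝ)^(e+1) / (m:ℝ)^(e+1))) atTop
      (𝓝 ((∑ i ∈ Finset.range e, (bernoulli (i+2) : ℝ) * ((e + 2).choose (i+2) : ℝ) / ((e:ℝ)+2) * 0)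
        + (-1/2) * 1)) := by
    refine (tendsto_finsetSum _ fun i _ => (ratio0 (by omega)).const_mul _).add ((ratio1 _).const_mul _)
  simp only [mul_zero, Finset.sum_const_zero, mul_one, zero_add] at h
  refine h.congr' ?_
  filter_upwards [eventually_gt_atTop 0] with m hm
  have hm' : (m:ℝ) ≠ 0 := by positivity
  rw [icoSum m hm, faul, Finset.sum_range_succ', Finset.sum_range_succ']
  simp only [zero_add, bernoulli_one, bernoulli_zero, Nat.choose_zero_right, Nat.choose_one_right]
  have : ∀ i : ℕ, e + 1 + 1 - (i + 1 + 1) = e - i := by intro i; omega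
  simp only [this]
  push_cast
  have he : (e:ℝ) + 1 + 1 ≠ 0 := by positivity
  have hsum : ∑ i ∈ Finset.range e, (bernoulli (i+2) : ℝ) * ((e + 2).choose (i+2) : ℝ) / ((e:ℝ)+2) *
        ((m:ℝ) ^ (e - i) / (m:ℝ)^(e+1)) = (∑ i ∈ Finset.range e, (bernoulli (i+1+1) : ℝ) * ((e + 1+1).choose (i+1+1) : ℝ) * (m:ℝ) ^ (e - i) / ((e:ℝ)+1+1)) / (m:ℝ)^(e+1) := by
    rw [Finset.sum_div]
    refine Finset.sum_congr rfl fun i _ => ?_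
    rw [show (e:ℝ)+1+1 = e+2 by ring]
    ring
  rw [hsum]
  generalize (∑ i ∈ Finset.range e, (bernoulli (i+1+1) : ℝ) * ((e + 1+1).choose (i+1+1) : ℝ) * (m:ℝ) ^ (e - i) / ((e:ℝ)+1+1)) = X
  have he : (e:ℝ) + 2 ≠ 0 := by positivity
  rw [show (e:ℝ)+1+1 = e+2 by ring]
  field_simp
  ring

lemma T2 (j : ℕ) : Tendsto (fun m : ℕ => (∑ i ∈ Finset.Ico 1 m, (i:ℝ)^j) / (m:ℝ)^(j+1))
    atTop (𝓝 (1/(j+1))) := by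
  have h : Tendsto (fun m : ℕ => (∑ i ∈ Finset.range j,
      (bernoulli (i+1) : ℝ) * ((j + 1).choose (i+1) : ℝ) / ((j:ℝ)+1) *
        ((m:ℝ) ^ (j - i) / (m:ℝ)^(j+1))) + (1/((j:ℝ)+1)) * ((m:ℝ)^(j+1) / (m:ℝ)^(j+1))
          - 0^j * ((m:ℝ)^0/(m:ℝ)^(j+1))) atTop
      (𝓝 ((∑ i ∈ Finset.range j, (bernoulli (i+1) : ℝ) * ((j + 1).choose (i+1) : ℝ) / ((j:ℝ)+1) * 0)
        + (1/((j:ℝ)+1)) * 1 - 0^j * 0)) := by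
    refine ((tendsto_finsetSum _ fun i _ => (ratio0 (by omega)).const_mul _).add ((ratio1 _).const_mul _)).sub
      ((ratio0 (by omega)).const_mul _)
  simp only [mul_zero, Finset.sum_const_zero, mul_one, zero_add, sub_zero] at h
  refine h.congr' ?_
  filter_upwards [eventually_gt_atTop 0] with m hm
  have hm' : (m:ℝ) ≠ 0 := by positivity
  rw [icoSum m hm, faul, Finset.sum_range_succ']
  have : ∀ i : ℕ, j + 1 - (i + 1) = j - i := by intro i; omega
  simp only [this, bernoulli_zero, Nat.choose_zero_right]
  rw [sub_div, add_div, Finset.sum_div]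
  congr 2
  · refine Finset.sum_congr rfl fun i _ => ?_
    ring
  · push_cast
    simp
    ring
  · simp

lemma asym (e : ℕ) (b c : ℕ → ℝ) (S : ℕ → ℝ) (I : ℝ)
    (hS : Tendsto (fun m : ℕ => (m:ℝ) * (I - S m / (m:ℝ)^(e+2))) atTop (𝓝 0))
    (hc : ∀ i : ℕ, 0 < i → c i = ∑ j ∈ Finset.range (e+2), b j * (i:ℝ)^j)
    (h1 : ∀ m : ℕ, 0 < m → ∑ i ∈ Finset.Ico 1 m, c i ≤ S m)
    (h2 : ∀ m : ℕ, 0 < m → S m ≤ ∑ i ∈ Finset.Ico 1 (m+1), c i) :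
    b e ≤ ((e:ℝ)+1) / 2 * b (e+1) := by
  set A : ℕ → ℝ := fun m => ∑ i ∈ Finset.Ico 1 m, c i with hA
  set K : ℝ := b (e+1) / (e+2) with hK
  have hAe : ∀ m, A m = ∑ j ∈ Finset.range (e+2), b j * ∑ i ∈ Finset.Ico 1 m, (i:ℝ)^j := by
    intro m
    simp only [hA, Finset.mul_sum]
    rw [Finset.sum_comm]
    refine Finset.sum_congr rfl fun i hi => hc i ?_
    rw [Finset.mem_Ico] at hi; omega
  have hU : Tendsto (fun m : ℕ => (A m - K * (m:ℝ)^(e+2)) / (m:ℝ)^(e+1)) atTop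
      (𝓝 ((∑ j ∈ Finset.range e, b j * (1/((j:ℝ)+1) * 0)) + b e * (1/((e:ℝ)+1)) + b (e+1) * (-1/2))) := by
    have h : Tendsto (fun m : ℕ => (∑ j ∈ Finset.range e, b j * ((∑ i ∈ Finset.Ico 1 m, (i:ℝ)^j) / (m:ℝ)^(j+1) * ((m:ℝ)^(j+1) / (m:ℝ)^(e+1)))) + b e * ((∑ i ∈ Finset.Ico 1 m, (i:ℝ)^e) / (m:ℝ)^(e+1)) + b (e+1) * ((∑ i ∈ Finset.Ico 1 m, (i:ℝ)^(e+1)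
    - (m:ℝ)^(e+2) / (e+2)) / (m:ℝ)^(e+1))) atTop
      (𝓝 ((∑ j ∈ Finset.range e, b j * (1/((j:ℝ)+1) * 0)) + b e * (1/((e:ℝ)+1)) + b (e+1) * (-1/2))) := by
      refine ((tendsto_finsetSum _ fun j hj => ?_).add ((T2 e).const_mul _)).add ((T1 e).const_mul _)
      exact ((T2 j).mul (ratio0 (by have := Finset.mem_range.1 hj; omega))).const_mul _
    refine h.congr' ?_
    filter_upwards [eventually_gt_atTop 0] with m hm
    have hm' : (m:ℝ) ≠ 0 := by positivity
    rw [hAe, Finset.sum_range_succ _ (e+1), Finset.sum_range_succ _ e, hK,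
      sub_div (_ + _ + _), add_div, add_div]
    have : ∀ j ∈ Finset.range e, b j * ((∑ i ∈ Finset.Ico 1 m, (i:ℝ)^j) / (m:ℝ)^(j+1) * ((m:ℝ)^(j+1) / (m:ℝ)^(e+1))) = b j * (∑ i ∈ Finset.Ico 1 m, (i:ℝ)^j) / (m:ℝ)^(e+1) := by
      intro j _
      field_simp
    rw [Finset.sum_congr rfl this, ← Finset.sum_div]
    generalize ∑ i ∈ Finset.Ico 1 m, (i:ℝ)^e = X
    generalize ∑ i ∈ Finset.Ico 1 m, (i:ℝ)^(e+1) = Y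
    ring
  simp only [mul_zero, Finset.sum_const_zero, zero_add] at hU
  have hcl : Tendsto (fun m : ℕ => c m / (m:ℝ)^(e+1)) atTop (𝓝 (b (e+1))) := by
    have h : Tendsto (fun m : ℕ => (∑ j ∈ Finset.range (e+1), b j * ((m:ℝ)^j / (m:ℝ)^(e+1))) + b (e+1) * ((m:ℝ)^(e+1) / (m:ℝ)^(e+1))) atTop (𝓝 ((∑ j ∈ Finset.range (e+1), b j * 0) + b (e+1) * 1)) := by
      refine (tendsto_finsetSum _ fun j hj => ?_).add ((ratio1 _).const_mul _)
      exact (ratio0 (Finset.mem_range.1 hj)).const_mul _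
    simp only [mul_zero, Finset.sum_const_zero, zero_add, mul_one] at h
    refine h.congr' ?_
    filter_upwards [eventually_gt_atTop 0] with m hm
    rw [hc m hm, Finset.sum_range_succ _ (e+1), add_div, Finset.sum_div]
    simp only [mul_div_assoc]
  set U : ℕ → ℝ := fun m => (A m - K * (m:ℝ)^(e+2)) / (m:ℝ)^(e+1) with hUd
  set E : ℕ → ℝ := fun m => (m:ℝ) * (I - S m / (m:ℝ)^(e+2)) with hE
  have hSE : ∀ m : ℕ, 0 < m → S m / (m:ℝ)^(e+1) = I * m - E m := by
    intro m hm
    have hm' : (m:ℝ) ≠ 0 := by positivity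
    simp only [hE]
    field_simp
    ring
  have hAU : ∀ m : ℕ, 0 < m → A m / (m:ℝ)^(e+1) = U m + K * m := by
    intro m hm
    have hm' : (m:ℝ) ≠ 0 := by positivity
    simp only [hUd]
    field_simp
    ring
  have i1 : ∀ m : ℕ, 0 < m → U m + K * m ≤ I * m - E m := by
    intro m hm
    rw [← hSE m hm, ← hAU m hm]
    exact div_le_div_of_nonneg_right (h1 m hm) (by positivity)
  have i2 : ∀ m : ℕ, 0 < m → I * m - E m ≤ U m + K * m + c m / (m:ℝ)^(e+1) := by
    intro m hm
    rw [← hSE m hm, ← hAU m hm, ← add_div]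
    refine div_le_div_of_nonneg_right ((h2 m hm).trans (le_of_eq ?_)) (by positivity)
    rw [Finset.sum_Ico_succ_top hm]
  have hIK : I ≤ K := by
    by_contra hlt
    push Not at hlt
    have ht : Tendsto (fun m : ℕ => (I - K) * (m:ℝ)) atTop atTop :=
      tendsto_natCast_atTop_atTop.const_mul_atTop (by linarith)
    have hb := (hS.add hU).add hcl
    refine not_tendsto_nhds_of_tendsto_atTop (tendsto_atTop_mono' _ ?_ ht) _ hb
    filter_upwards [eventually_gt_atTop 0] with m hm
    have := i2 m hm
    simp only [hE, hUd] at this ⊢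
    linarith
  have hle : b e * (1/((e:ℝ)+1)) + b (e+1) * (-1/2) ≤ -0 := by
    refine le_of_tendsto_of_tendsto hU hS.neg ?_
    filter_upwards [eventually_gt_atTop 0] with m hm
    have := i1 m hm
    have h3 : I * (m:ℝ) ≤ K * m := mul_le_mul_of_nonneg_right hIK (by positivity)
    simp only [hE, hUd] at this ⊢
    linarith
  have he : (0:ℝ) < (e:ℝ)+1 := by positivity
  have h5 : b e = (b e * (1/((e:ℝ)+1))) * (e+1) := by field_simp
  rw [h5]
  nlinarith

lemma step_le (a : ℝ) (m : ℕ) (hm : 1 ≤ m) :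
    ∑ i ∈ Finset.Ico 1 m, (if a ≤ (i:ℝ) then (1:ℝ) else 0) ≤ max 0 ((m:ℝ) - a) := by
  induction m, hm using Nat.le_induction with
  | base => simp
  | succ m hm ih =>
    rw [Finset.sum_Ico_succ_top hm]
    push_cast
    split_ifs with h
    · rw [max_eq_right (by linarith)] at ih ⊢
      linarith
    · refine le_trans (by simpa using ih) (max_le_max le_rfl (by linarith))

lemma le_step (a : ℝ) (ha : 0 ≤ a) (m : ℕ) :
    max 0 ((m:ℝ) - a) ≤ ∑ i ∈ Finset.Ico 1 (m+1), (if a ≤ (i:ℝ) then (1:ℝ) else 0) := by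
  induction m with
  | zero => simp [ha]
  | succ m ih =>
    rw [Finset.sum_Ico_succ_top (by omega)]
    have h0 := (le_max_left _ _).trans ih
    have h1 := (le_max_right _ _).trans ih
    push_cast
    split_ifs with h
    · exact max_le (by linarith) (by linarith)
    · exact max_le (by linarith) (by push Not at h; linarith)

lemma gauge_core {e : ℕ} (Q : Set (Fin (e+1) → ℝ)) (hQc : Convex ℝ Q) (hQk : IsCompact Q)
    (hQ0 : Q ∈ 𝓝 0) (b : ℕ → ℝ)
    (hb : ∀ i : ℕ, 0 < i →
      (Set.ncard {y : Fin (e+1) → ℤ | (i:ℝ)⁻¹ • (fun j => (y j : ℝ)) ∈ Q} : ℝ)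
        = ∑ j ∈ Finset.range (e+2), b j * (i:ℝ)^j) :
    b e ≤ ((e:ℝ)+1) / 2 * b (e+1) := by
  obtain ⟨K, hK⟩ := hQc.lipschitz_gauge hQ0
  set g := gauge Q with hg
  have hg1 : ∀ z, g z ≤ 1 ↔ z ∈ Q := fun z => by
    rw [hg, gauge_le_one_iff_mem_closure hQc hQ0, hQk.isClosed.closure_eq]
  have hgs : ∀ (m : ℕ) z, 0 < m → g ((m:ℝ)⁻¹ • z) = (m:ℝ)⁻¹ * g z := fun m z hm => by
    rw [hg, gauge_smul_of_nonneg (by positivity), smul_eq_mul]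
  have hgi : ∀ (m : ℕ) z, 0 < m → ((m:ℝ)⁻¹ • z ∈ Q ↔ g z ≤ m) := fun m z hm => by
    have hm' : (0:ℝ) < m := by exact_mod_cast hm
    rw [← hg1, hgs m z hm, inv_mul_le_iff₀ hm', mul_one]
  set f : (Fin (e+1) → ℝ) → ℝ := fun z => max 0 (1 - g z) with hf
  have hfL : LipschitzWith (0 + K) f := ((LipschitzWith.const 1).sub hK).const_max 0
  have hfs : HasCompactSupport f := by
    refine HasCompactSupport.intro hQk fun z hz => ?_
    rw [← hg1] at hz
    push Not at hz
    exact max_eq_left (by linarith)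
  have hR := riem f _ hfL hfs
  set S : ℕ → ℝ := fun m => ∑' y : Fin (e+1) → ℤ, max 0 ((m:ℝ) - g (fun j => (y j : ℝ))) with hS
  have hSf : ∀ m : ℕ, 0 < m → S m = m * ∑' y : Fin (e+1) → ℤ, f ((m:ℝ)⁻¹ • (fun j => (y j : ℝ))) := by
    intro m hm
    have hm' : (0:ℝ) < m := by exact_mod_cast hm
    rw [← tsum_mul_left]
    simp only [hS]
    refine tsum_congr fun y => ?_
    simp only [hf]
    rw [hgs m _ hm, mul_max_of_nonneg _ _ hm'.le, mul_zero, mul_sub, mul_inv_cancel_left₀ hm'.ne', mul_one]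
  set c : ℕ → ℝ := fun i => (Set.ncard {y : Fin (e+1) → ℤ | g (fun j => (y j : ℝ)) ≤ i} : ℝ) with hc
  have hfin : ∀ m : ℕ, 0 < m → {y : Fin (e+1) → ℤ | g (fun j => (y j : ℝ)) ≤ m}.Finite := by
    intro m hm
    have hm' : (0:ℝ) < m := by exact_mod_cast hm
    obtain ⟨R, hR⟩ := hQk.isBounded.subset_closedBall 0
    have : Set.Finite (Metric.closedBall (0 : Fin (e+1) → ℤ) (m * R)) :=
      (isCompact_closedBall _ _).finite_of_discrete
    refine this.subset fun y hy => ?_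
    have hy' := hR ((hgi m _ hm).2 hy)
    rw [mem_closedBall_zero_iff] at hy' ⊢
    rw [norm_smul, norm_inv, Real.norm_natCast, inv_mul_le_iff₀ hm'] at hy'
    refine le_trans (le_of_eq ?_) hy'
    simp only [Pi.norm_def]
    congr 2
  have hSsum : ∀ (m : ℕ) (hm : 0 < m), S m = ∑ y ∈ (hfin m hm).toFinset, max 0 ((m:ℝ) - g (fun j => (y j : ℝ))) := by
    intro m hm
    refine tsum_eq_sum fun y hy => ?_
    simp only [Set.Finite.mem_toFinset, Set.mem_ofPred_eq, not_le] at hy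
    exact max_eq_left (by linarith)
  have hcsum : ∀ (m : ℕ) (hm : 0 < m) (i : ℕ), i ≤ m → c i = ∑ y ∈ (hfin m hm).toFinset,
      (if g (fun j => (y j : ℝ)) ≤ (i:ℝ) then (1:ℝ) else 0) := by
    intro m hm i hi
    rw [← Finset.sum_filter, Finset.sum_const, nsmul_eq_mul, mul_one]
    simp only [hc]
    rw [← Set.ncard_coe_finset]
    congr 2
    ext y
    simp only [Set.mem_ofPred_eq, Finset.coe_filter, Set.Finite.mem_toFinset]
    have : (i:ℝ) ≤ m := by exact_mod_cast hi
    exact ⟨fun h => ⟨h.trans this, h⟩, fun h => h.2⟩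
  refine asym e b c S (∫ z, f z) ?_ ?_ ?_ ?_
  · refine hR.congr' ?_
    filter_upwards [eventually_gt_atTop 0] with m hm
    have hm' : (m:ℝ) ≠ 0 := by positivity
    rw [hSf m hm]
    congr 2
    rw [show e + 2 = (e+1) + 1 by ring, pow_succ' (m:ℝ) (e+1), mul_div_mul_left _ _ hm']
  · intro i hi
    rw [← hb i hi]
    simp only [hc, hgi i _ hi]
  · intro m hm
    rw [hSsum m hm, Finset.sum_congr rfl fun i hi => hcsum m hm i (Finset.mem_Ico.1 hi).2.le,
      Finset.sum_comm]
    exact Finset.sum_le_sum fun y _ => step_le _ m hm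
  · intro m hm
    rw [hSsum m hm, Finset.sum_congr rfl fun i hi => hcsum m hm i
      (Nat.lt_succ_iff.1 (Finset.mem_Ico.1 hi).2), Finset.sum_comm]
    exact Finset.sum_le_sum fun y _ => le_step _ (gauge_nonneg _) m

end Helpers

/-- For a full-dimensional lattice polytope `P ⊆ ℝ^d` with Ehrhart
polynomial `ehr_P(n) = k_d n^d + ⋯ + k_0` and `l` minimal so that `(lP)°` contains a
lattice point, the two leading coefficients satisfy `(l d / 2) k_d ≥ k_{d−1}`. -/
theorem two_leading_coefficients {d l : ℕ} (hd : 0 < d) (P : Set (Fin d → ℝ))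
    (hlat : IsLatticePolytope P) (hfull : IsFullDim P)
    (hl : IsMinInteriorDilate P l)
    (k : ℕ → ℝ)
    (hk : ∀ n : ℕ, 0 < n →
      (latCount ((n : ℝ) • P) : ℝ) = ∑ i ∈ Finset.range (d + 1), k i * (n : ℝ) ^ i) :
    k (d - 1) ≤ ((l : ℝ) * d / 2) * k d := by
  obtain ⟨e, rfl⟩ : ∃ e, d = e + 1 := ⟨d - 1, by omega⟩
  obtain ⟨V, -, hV⟩ := hlat
  obtain ⟨hl0, ⟨x, hxl, hxi⟩, -⟩ := hl
  have hl' : (0:ℝ) < l := by exact_mod_cast hl0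
  choose t ht using hxl
  have hPc : Convex ℝ P := hV ▸ convex_convexHull ℝ _
  have hPk : IsCompact P := hV ▸ V.finite_toSet.isCompact_convexHull (𝕜 := ℝ)
  set Q : Set (Fin (e+1) → ℝ) := (fun z => z + x) ⁻¹' ((l:ℝ) • P) with hQ
  have hQc : Convex ℝ Q := (hPc.smul _).translate_preimage_left x
  have hQk : IsCompact Q := (Homeomorph.addRight x).isCompact_preimage.2 (hPk.smul _)
  have hQ0 : Q ∈ nhds 0 := by
    refine (continuous_add_const x).continuousAt.preimage_mem_nhds ?_
    rw [zero_add]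
    exact mem_interior_iff_mem_nhds.1 hxi
  have key := gauge_core Q hQc hQk hQ0 (fun j => k j * (l:ℝ)^j) (by
    intro i hi
    have hi' : (0:ℝ) < i := by exact_mod_cast hi
    have h1 := hk (l * i) (Nat.mul_pos hl0 hi)
    have h2 : latCount (((l * i : ℕ) : ℝ) • P) = Set.ncard
        {y : Fin (e+1) → ℤ | (i:ℝ)⁻¹ • (fun j => (y j : ℝ)) ∈ Q} := by
      have hinj : Function.Injective
          (fun (y : Fin (e+1) → ℤ) => (fun j => (y j : ℝ) + (i:ℝ) * x j : Fin (e+1) → ℝ)) := by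
        intro y y' h
        ext j
        have := congrFun h j
        simpa using this
      rw [← Set.ncard_image_of_injective _ hinj, latCount]
      congr 1
      have hiff : ∀ y : Fin (e+1) → ℤ, (i:ℝ)⁻¹ • (fun j => (y j : ℝ)) ∈ Q ↔
          (fun j => (y j : ℝ) + (i:ℝ) * x j : Fin (e+1) → ℝ) ∈ ((l * i : ℕ) : ℝ) • P := by
        intro y
        have hli : ((l * i : ℕ) : ℝ) = i * l := by push_cast; ring
        rw [hli, mul_smul, Set.mem_smul_set_iff_inv_smul_mem₀ hi'.ne', hQ, Set.mem_preimage]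
        have : ((i:ℝ)⁻¹ • (fun j => (y j : ℝ)) + x)
            = (i:ℝ)⁻¹ • (fun j => (y j : ℝ) + (i:ℝ) * x j : Fin (e+1) → ℝ) := by
          ext j
          simp
          field_simp
        rw [this]
      ext z
      simp only [Set.mem_ofPred_eq, Set.mem_image]
      constructor
      · rintro ⟨hz, hzl⟩
        choose u hu using hzl
        refine ⟨fun j => u j - i * t j, ?_, ?_⟩
        · rw [hiff]
          convert hz using 1
          ext j
          push_cast
          rw [hu, ht]; ring
        · ext j
          push_cast
          rw [hu, ht]; ring
      · rintro ⟨y, hy, rfl⟩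
        refine ⟨(hiff y).1 hy, fun j => ⟨y j + i * t j, ?_⟩⟩
        push_cast
        rw [ht]
    rw [← h2, h1]
    refine Finset.sum_congr rfl fun j _ => ?_
    push_cast
    rw [mul_pow]; ring)
  rw [Nat.add_sub_cancel]
  have hp : (0:ℝ) < (l:ℝ)^e := by positivity
  refine le_of_mul_le_mul_right (key.trans (le_of_eq ?_)) hp
  push_cast
  ring
end
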